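/- The ring homomorphism Φ from the group ring ℤ[ℚ/ℤ] to the product ring ℂ^{ℕ≥1} determined on group elements by Φ([γ]) = ζ^(γ) (well defined since ζ^(γ) depends only on γ mod ℤ and ζ^(γ)·ζ^(γ') = ζ^(γ+γ')) is injective, and its image is exactly W^a_ℤ(ℤ̄), the set of Witt vectors in W_ℤ(ℤ̄) that are integral over ℤ. In particular W^a_ℤ(ℤ̄) is isomorphic as a ring to ℤ[ℚ/ℤ], and the integral Witt vectors over ℤ are precisely the ℤ-linear combinations of the vectors ζ^(γ), γ ∈ ℚ. -/

import Mathlib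

open scoped Real

/-- The sets `U_k` in the inductive construction of `W_ℤ(ℤ̄) ⊆ ℂ^{ℕ≥1}`:
`U_0` consists of the vectors whose entries are integral over `ℤ` (i.e. lie in `ℤ̄`),
and `U_{k+1}` consists of those `ξ ∈ U_k` such that for every prime `p` the vector
`ψ_p ξ - ξ^p = (ξ_{pn} - ξ_n^p)_n` lies in the ℤ-submodule generated by `{p·η : η ∈ U_k}`. -/
def UQ : ℕ → Set (ℕ+ → ℂ)
  | 0 => {ξ | ∀ n, IsIntegral ℤ (ξ n)}
  | k + 1 =>
      {ξ | ξ ∈ UQ k ∧ ∀ (p : ℕ) (hp : p.Prime),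
        (fun n => ξ (⟨p, hp.pos⟩ * n)) - ξ ^ p ∈
          Submodule.span ℤ {x | ∃ η ∈ UQ k, x = (p : ℤ) • η}}

/-- The set `W^a_ℤ(ℤ̄)` of integral Witt vectors over `ℤ`: elements of
`W_ℤ(ℤ̄) = ⋂ k, U_k` that are integral over `ℤ` as elements of `ℂ^{ℕ≥1}`. -/
def WaQ : Set (ℕ+ → ℂ) := {ξ | (∀ k, ξ ∈ UQ k) ∧ IsIntegral ℤ ξ}

/-- The vector `ζ^(γ) = (e^{2πiγn})_{n ≥ 1}`. -/
noncomputable def zetaVec (γ : ℚ) : ℕ+ → ℂ :=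
  fun n => Complex.exp (2 * π * Complex.I * (γ : ℂ) * (n : ℂ))

/-! ### Part A -/

def ppos (p : ℕ) (hp : p.Prime) : ℕ+ := ⟨p, hp.pos⟩
theorem ppos_coe (p : ℕ) (hp : p.Prime) : ((ppos p hp : ℕ+) : ℕ) = p := rfl

def psiV (m : ℕ+) (ξ : ℕ+ → ℂ) : ℕ+ → ℂ := fun n => ξ (m * n)

theorem psiV_add (m : ℕ+) (x y : ℕ+ → ℂ) : psiV m (x + y) = psiV m x + psiV m y := rfl
theorem psiV_mul (m : ℕ+) (x y : ℕ+ → ℂ) : psiV m (x * y) = psiV m x * psiV m y := rfl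
theorem psiV_pow (m : ℕ+) (x : ℕ+ → ℂ) (k : ℕ) : psiV m (x ^ k) = psiV m x ^ k := rfl
theorem psiV_smul (m : ℕ+) (x : ℕ+ → ℂ) (k : ℤ) : psiV m (k • x) = k • psiV m x := rfl
theorem psiV_comm (m k : ℕ+) (x : ℕ+ → ℂ) : psiV m (psiV k x) = psiV k (psiV m x) := by
  funext n; simp only [psiV]; congr 1; rw [mul_left_comm]

theorem span_p_aux (S : Subring (ℕ+ → ℂ)) (p : ℤ) (y : ℕ+ → ℂ) :
    y ∈ Submodule.span ℤ {x | ∃ η ∈ (S : Set (ℕ+ → ℂ)), x = p • η} ↔ ∃ η ∈ S, y = p • η := by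
  constructor
  · intro h
    induction h using Submodule.span_induction with
    | mem x hx => exact hx
    | zero => exact ⟨0, S.zero_mem, by simp⟩
    | add x y _ _ hx hy =>
      obtain ⟨a, ha, rfl⟩ := hx
      obtain ⟨b, hb, rfl⟩ := hy
      exact ⟨a + b, S.add_mem ha hb, by rw [smul_add]⟩
    | smul c x _ hx =>
      obtain ⟨a, ha, rfl⟩ := hx
      exact ⟨c • a, zsmul_mem ha c, by rw [smul_comm]⟩
  · rintro h
    exact Submodule.subset_span h

theorem UQ_succ_aux (S : Subring (ℕ+ → ℂ)) (k : ℕ) (hS : (S : Set (ℕ+ → ℂ)) = UQ k) (ξ : ℕ+ → ℂ) :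
    ξ ∈ UQ (k + 1) ↔ ξ ∈ S ∧ ∀ (p : ℕ) (hp : p.Prime), ∃ η ∈ S,
      psiV (ppos p hp) ξ = ξ ^ p + (p : ℤ) • η := by
  simp only [UQ, ← hS, Set.mem_ofPred_eq, SetLike.mem_coe]
  refine and_congr_right fun h => forall_congr' fun p => forall_congr' fun hp => ?_
  have := span_p_aux S p ((fun n => ξ (⟨p, hp.pos⟩ * n)) - ξ ^ p)
  simp only [SetLike.mem_coe] at this
  rw [this]
  refine exists_congr fun η => and_congr_right fun _ => ?_
  rw [sub_eq_iff_eq_add, add_comm]; rfl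

theorem exists_subring_UQ (k : ℕ) : ∃ S : Subring (ℕ+ → ℂ), (S : Set (ℕ+ → ℂ)) = UQ k := by
  induction k with
  | zero =>
    refine ⟨{ carrier := UQ 0, mul_mem' := ?_, one_mem' := ?_, add_mem' := ?_, zero_mem' := ?_, neg_mem' := ?_ }, rfl⟩
    · intro a b ha hb n; exact (ha n).mul (hb n)
    · intro n; exact isIntegral_one
    · intro a b ha hb n; exact (ha n).add (hb n)
    · intro n; exact isIntegral_zero
    · intro a ha n; exact (ha n).neg
  | succ k ih =>
    obtain ⟨S, hS⟩ := ih
    have key := UQ_succ_aux S k hS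
    have hmul : ∀ {a b}, a ∈ UQ (k+1) → b ∈ UQ (k+1) → a * b ∈ UQ (k+1) := by
      intro a b ha hb
      rw [key] at *
      refine ⟨S.mul_mem ha.1 hb.1, fun p hp => ?_⟩
      obtain ⟨x, hx, hx'⟩ := ha.2 p hp
      obtain ⟨y, hy, hy'⟩ := hb.2 p hp
      refine ⟨a ^ p * y + x * b ^ p + (p : ℤ) • (x * y), ?_, ?_⟩
      · exact S.add_mem (S.add_mem (S.mul_mem (pow_mem ha.1 p) hy) (S.mul_mem hx (pow_mem hb.1 p)))
          (zsmul_mem (S.mul_mem hx hy) _)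
      · rw [psiV_mul, hx', hy']; simp only [zsmul_eq_mul]; push_cast; ring
    have hadd : ∀ {a b}, a ∈ UQ (k+1) → b ∈ UQ (k+1) → a + b ∈ UQ (k+1) := by
      intro a b ha hb
      rw [key] at *
      refine ⟨S.add_mem ha.1 hb.1, fun p hp => ?_⟩
      obtain ⟨x, hx, hx'⟩ := ha.2 p hp
      obtain ⟨y, hy, hy'⟩ := hb.2 p hp
      obtain ⟨r, hr⟩ := exists_add_pow_prime_eq hp (⟨a, ha.1⟩ : S) ⟨b, hb.1⟩
      have hr' : (a + b) ^ p = a ^ p + b ^ p + p * (a * b * (r : ℕ+ → ℂ)) := by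
        have := congrArg (Subtype.val : S → (ℕ+ → ℂ)) hr
        push_cast at this
        rw [this]; ring
      refine ⟨x + y - a * b * r, ?_, ?_⟩
      · exact S.sub_mem (S.add_mem hx hy) (S.mul_mem (S.mul_mem ha.1 hb.1) r.2)
      · rw [psiV_add, hx', hy', hr']; simp only [zsmul_eq_mul]; push_cast; ring
    have hneg1 : (-1 : ℕ+ → ℂ) ∈ UQ (k+1) := by
      rw [key]
      refine ⟨S.neg_mem S.one_mem, fun p hp => ?_⟩
      rcases hp.eq_two_or_odd' with rfl | ho
      · refine ⟨-1, S.neg_mem S.one_mem, ?_⟩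
        funext n; simp [psiV]; norm_num
      · refine ⟨0, S.zero_mem, ?_⟩
        rw [ho.neg_one_pow]; simp; rfl
    have hzero : (0 : ℕ+ → ℂ) ∈ UQ (k+1) := by
      rw [key]
      refine ⟨S.zero_mem, fun p hp => ⟨0, S.zero_mem, ?_⟩⟩
      rw [zero_pow hp.ne_zero]; simp; rfl
    refine ⟨{ carrier := UQ (k+1), mul_mem' := hmul, one_mem' := ?_, add_mem' := hadd, zero_mem' := hzero, neg_mem' := ?_ }, rfl⟩
    · have := hmul hneg1 hneg1; simpa using this
    · intro a ha
      have := hmul hneg1 ha; simpa using this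

theorem UQ_psi (k : ℕ) (m : ℕ+) {ξ : ℕ+ → ℂ} (h : ξ ∈ UQ k) : psiV m ξ ∈ UQ k := by
  induction k generalizing ξ with
  | zero => intro n; exact h _
  | succ k ih =>
    obtain ⟨S, hS⟩ := exists_subring_UQ k
    rw [UQ_succ_aux S k hS] at *
    have hS' : ∀ x, x ∈ S ↔ x ∈ UQ k := fun x => by rw [← hS]; rfl
    refine ⟨(hS' _).2 (ih ((hS' _).1 h.1)), fun p hp => ?_⟩
    obtain ⟨x, hx, hx'⟩ := h.2 p hp
    refine ⟨psiV m x, (hS' _).2 (ih ((hS' _).1 hx)), ?_⟩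
    rw [psiV_comm, hx']; rfl

/-- The ring of Witt vectors. -/
theorem exists_subring_W : ∃ S : Subring (ℕ+ → ℂ), ∀ ξ, ξ ∈ S ↔ ∀ k, ξ ∈ UQ k := by
  choose S hS using exists_subring_UQ
  refine ⟨⨅ k, S k, fun ξ => ?_⟩
  simp only [Subring.mem_iInf]
  refine forall_congr' fun k => ?_
  rw [← hS]; rfl

noncomputable def WR : Subring (ℕ+ → ℂ) := exists_subring_W.choose
theorem mem_WR {ξ : ℕ+ → ℂ} : ξ ∈ WR ↔ ∀ k, ξ ∈ UQ k := exists_subring_W.choose_spec ξ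

theorem WR_int {ξ : ℕ+ → ℂ} (h : ξ ∈ WR) (n : ℕ+) : IsIntegral ℤ (ξ n) := (mem_WR.1 h) 0 n

theorem WR_psi {ξ : ℕ+ → ℂ} (h : ξ ∈ WR) (m : ℕ+) : psiV m ξ ∈ WR :=
  mem_WR.2 fun k => UQ_psi k m (mem_WR.1 h k)

theorem WR_delta {ξ : ℕ+ → ℂ} (h : ξ ∈ WR) (p : ℕ) (hp : p.Prime) :
    ∃ η ∈ WR, ∀ n, ξ ((ppos p hp) * n) = ξ n ^ p + p * η n := by
  have h1 : ∀ k, ∃ η ∈ UQ k, psiV (ppos p hp) ξ = ξ ^ p + (p : ℤ) • η := by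
    intro k
    obtain ⟨S, hS⟩ := exists_subring_UQ k
    obtain ⟨η, hη, e⟩ := ((UQ_succ_aux S k hS ξ).1 (mem_WR.1 h (k+1))).2 p hp
    exact ⟨η, by rw [← hS]; exact hη, e⟩
  choose η hη e using h1
  have hp0 : (p : ℂ) ≠ 0 := by exact_mod_cast hp.ne_zero
  have e2 : ∀ k n, ξ ((ppos p hp) * n) = ξ n ^ p + p * η k n := by
    intro k n
    have := congrFun (e k) n
    simpa [psiV] using this
  have e3 : ∀ k, η k = η 0 := by
    intro k; funext n
    have := e2 k n
    rw [e2 0 n] at this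
    exact (mul_left_cancel₀ hp0 (add_left_cancel this)).symm
  exact ⟨η 0, mem_WR.2 fun k => by rw [← e3 k]; exact hη k, e2 0⟩

theorem WR_of_psi {ξ : ℕ+ → ℂ} (h0 : ∀ n, IsIntegral ℤ (ξ n))
    (h : ∀ (p : ℕ) (hp : p.Prime), ∀ n, ξ ((ppos p hp) * n) = ξ n ^ p) : ξ ∈ WR := by
  rw [mem_WR]
  intro k
  induction k with
  | zero => exact h0
  | succ k ih =>
    obtain ⟨S, hS⟩ := exists_subring_UQ k
    rw [UQ_succ_aux S k hS]
    refine ⟨by rw [← SetLike.mem_coe, hS]; exact ih, fun p hp => ⟨0, S.zero_mem, ?_⟩⟩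
    funext n; simpa [psiV] using h p hp n

theorem zetaVec_eq_pow (γ : ℚ) (n : ℕ+) : zetaVec γ n = Complex.exp (2 * π * Complex.I * γ) ^ (n : ℕ) := by
  rw [← Complex.exp_nat_mul]; simp only [zetaVec]; congr 1; ring

theorem exp_pow_den (γ : ℚ) : Complex.exp (2 * π * Complex.I * γ) ^ γ.den = 1 := by
  rw [← Complex.exp_nat_mul]
  have : (γ.den : ℂ) * (2 * π * Complex.I * γ) = (γ.num : ℂ) * (2 * π * Complex.I) := by
    have : (γ.den : ℂ) * (γ : ℂ) = γ.num := by exact_mod_cast Rat.den_mul_eq_num γ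
    rw [← this]; ring
  rw [this, Complex.exp_int_mul_two_pi_mul_I]

theorem zetaVec_pow_den (γ : ℚ) : zetaVec γ ^ γ.den = 1 := by
  funext n
  rw [Pi.pow_apply, zetaVec_eq_pow, ← pow_mul, mul_comm (n : ℕ), pow_mul, exp_pow_den, one_pow]; rfl

theorem zetaVec_mem (γ : ℚ) : zetaVec γ ∈ WR := by
  refine WR_of_psi (fun n => ?_) (fun p hp n => ?_)
  · refine IsIntegral.of_pow γ.den_pos (x := zetaVec γ n) ?_
    have := congrFun (zetaVec_pow_den γ) n
    simp only [Pi.pow_apply, Pi.one_apply] at this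
    rw [this]; exact isIntegral_one
  · rw [zetaVec_eq_pow, zetaVec_eq_pow, ← pow_mul]
    congr 1
    rw [PNat.mul_coe, ppos_coe, mul_comm]

theorem zetaVec_integral (γ : ℚ) : IsIntegral ℤ (zetaVec γ) :=
  IsIntegral.of_pow γ.den_pos (by rw [zetaVec_pow_den]; exact isIntegral_one)

theorem zetaVec_add (γ γ' : ℚ) : zetaVec (γ + γ') = zetaVec γ * zetaVec γ' := by
  funext n; simp only [zetaVec, Pi.mul_apply, ← Complex.exp_add]; congr 1; push_cast; ring

theorem zetaVec_zero : zetaVec 0 = 1 := by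
  funext n; simp [zetaVec]

theorem zetaVec_int (m : ℤ) : zetaVec m = 1 := by
  funext n
  rw [zetaVec_eq_pow]
  have : (2 * π * Complex.I * ((m : ℚ) : ℂ)) = (m : ℂ) * (2 * π * Complex.I) := by push_cast; ring
  rw [this, Complex.exp_int_mul_two_pi_mul_I, one_pow]; rfl

noncomputable def zetaHom : AddCircle (1 : ℚ) →+ Additive (ℕ+ → ℂ) :=
  QuotientAddGroup.lift _
    ({ toFun := fun γ => Additive.ofMul (zetaVec γ), map_zero' := by rw [zetaVec_zero]; rfl,
       map_add' := fun a b => by rw [zetaVec_add]; rfl } : ℚ →+ Additive (ℕ+ → ℂ)) (by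
    intro x hx
    obtain ⟨m, rfl⟩ := AddSubgroup.mem_zmultiples_iff.1 hx
    simp only [zsmul_eq_mul, mul_one]
    rw [AddMonoidHom.mem_ker]
    change Additive.ofMul (zetaVec (m : ℚ)) = 0
    rw [zetaVec_int]; rfl)

noncomputable def zetaMon : Multiplicative (AddCircle (1 : ℚ)) →* (ℕ+ → ℂ) := AddMonoidHom.toMultiplicativeLeft zetaHom

theorem zetaMon_apply (γ : ℚ) : zetaMon (Multiplicative.ofAdd (γ : AddCircle (1 : ℚ))) = zetaVec γ := rfl

noncomputable def PhiA : AddMonoidAlgebra ℤ (AddCircle (1 : ℚ)) →ₐ[ℤ] (ℕ+ → ℂ) :=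
  AddMonoidAlgebra.lift ℤ _ _ zetaMon

theorem PhiA_single (γ : ℚ) : PhiA (AddMonoidAlgebra.single (↑γ : AddCircle (1 : ℚ)) 1) = zetaVec γ := by
  rw [PhiA, AddMonoidAlgebra.lift_single, zetaMon_apply, one_smul]

theorem zetaVec_inj {γ γ' : ℚ} (h : zetaVec γ 1 = zetaVec γ' 1) : (γ : AddCircle (1 : ℚ)) = γ' := by
  simp only [zetaVec, Complex.exp_eq_exp_iff_exists_int] at h
  obtain ⟨m, hm⟩ := h
  have h2 : (γ : ℂ) = γ' + m := by
    have hpi : (2 * π * Complex.I : ℂ) ≠ 0 := Complex.two_pi_I_ne_zero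
    apply mul_left_cancel₀ hpi
    have : ((1 : ℕ+) : ℕ) = 1 := rfl
    rw [this] at hm
    push_cast at hm
    linear_combination hm
  have h3 : γ = γ' + m := by exact_mod_cast h2
  rw [h3]
  rw [AddCircle.coe_add]
  have : ((m : ℚ) : AddCircle (1 : ℚ)) = 0 := by
    rw [AddCircle.coe_eq_zero_iff]; exact ⟨m, by simp⟩
  rw [this, add_zero]

theorem PhiA_range : (Set.range PhiA) = ↑(Submodule.span ℤ (Set.range zetaVec)) := by
  ext ξ
  constructor
  · rintro ⟨x, rfl⟩
    induction x using AddMonoidAlgebra.induction_linear with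
    | zero => rw [map_zero]; exact Submodule.zero_mem _
    | add a b ha hb => rw [map_add]; exact Submodule.add_mem _ ha hb
    | single a b =>
      obtain ⟨γ, rfl⟩ := QuotientAddGroup.mk_surjective a
      rw [PhiA, AddMonoidAlgebra.lift_single]
      exact Submodule.smul_mem _ _ (Submodule.subset_span ⟨γ, rfl⟩)
  · intro h
    induction h using Submodule.span_induction with
    | mem x hx => obtain ⟨γ, rfl⟩ := hx; exact ⟨_, PhiA_single γ⟩
    | zero => exact ⟨0, map_zero _⟩
    | add x y _ _ hx hy =>
      obtain ⟨a, rfl⟩ := hx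
      obtain ⟨b, rfl⟩ := hy
      exact ⟨a + b, map_add _ _ _⟩
    | smul c x _ hx =>
      obtain ⟨a, rfl⟩ := hx
      exact ⟨c • a, map_smul _ _ _⟩

theorem PhiA_inj : Function.Injective PhiA := by
  rw [injective_iff_map_eq_zero]
  intro x hx
  -- characters of ℕ
  let ch : AddCircle (1 : ℚ) → (Multiplicative ℕ →* ℂ) := fun a => powersHom ℂ (zetaMon (Multiplicative.ofAdd a) 1)
  have hch : Function.Injective ch := by
    intro a b hab
    obtain ⟨γ, rfl⟩ := QuotientAddGroup.mk_surjective a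
    obtain ⟨γ', rfl⟩ := QuotientAddGroup.mk_surjective b
    exact zetaVec_inj ((powersHom ℂ).injective hab)
  have li := (linearIndependent_monoidHom (Multiplicative ℕ) ℂ).comp ch hch
  rw [linearIndependent_iff'] at li
  have key := li x.coeff.support (fun a => (x.coeff a : ℂ) * zetaMon (Multiplicative.ofAdd a) 1) (by
    funext m
    have h2 := congrFun hx (Nat.succPNat m.toAdd)
    rw [PhiA, AddMonoidAlgebra.lift_apply, Finsupp.sum, Finset.sum_apply] at h2
    rw [Finset.sum_apply, Pi.zero_apply] at *
    rw [← h2]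
    refine Finset.sum_congr rfl fun a ha => ?_
    obtain ⟨γ, rfl⟩ := QuotientAddGroup.mk_surjective a
    have e1 : zetaMon (Multiplicative.ofAdd (γ : AddCircle (1 : ℚ))) = zetaVec γ := rfl
    have e2 : zetaVec γ (Nat.succPNat m.toAdd) = zetaVec γ 1 * zetaVec γ 1 ^ m.toAdd := by
      rw [zetaVec_eq_pow, zetaVec_eq_pow, Nat.succPNat_coe, PNat.one_coe, pow_one, pow_succ']
    change (x.coeff (γ : AddCircle (1 : ℚ)) : ℂ) * zetaVec γ 1 * (zetaVec γ 1 ^ m.toAdd) = ((x.coeff (γ : AddCircle (1 : ℚ))) • zetaVec γ) (Nat.succPNat m.toAdd)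
    rw [Pi.smul_apply, e2, zsmul_eq_mul, mul_assoc])
  ext a
  by_contra hne
  have h3 := key a (Finsupp.mem_support_iff.2 hne)
  rw [mul_eq_zero] at h3
  rcases h3 with h3 | h3
  · exact hne (by exact_mod_cast h3)
  · obtain ⟨γ, rfl⟩ := QuotientAddGroup.mk_surjective a
    exact Complex.exp_ne_zero _ h3

theorem span_sub_WaQ : ↑(Submodule.span ℤ (Set.range zetaVec)) ⊆ WaQ := by
  intro ξ h
  suffices ξ ∈ WR ∧ IsIntegral ℤ ξ from ⟨mem_WR.1 this.1, this.2⟩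
  induction h using Submodule.span_induction with
  | mem x hx => obtain ⟨γ, rfl⟩ := hx; exact ⟨zetaVec_mem γ, zetaVec_integral γ⟩
  | zero => exact ⟨WR.zero_mem, isIntegral_zero⟩
  | add x y _ _ hx hy => exact ⟨WR.add_mem hx.1 hy.1, hx.2.add hy.2⟩
  | smul c x _ hx => exact ⟨zsmul_mem hx.1 c, hx.2.smul c⟩

theorem final_of (h : WaQ ⊆ ↑(Submodule.span ℤ (Set.range zetaVec))) :
    (∃ Φ : AddMonoidAlgebra ℤ (AddCircle (1 : ℚ)) →+* (ℕ+ → ℂ),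
      (∀ γ : ℚ, Φ (AddMonoidAlgebra.single (↑γ : AddCircle (1 : ℚ)) 1) = zetaVec γ) ∧
      Function.Injective Φ ∧ Set.range Φ = WaQ) ∧
    WaQ = ↑(Submodule.span ℤ (Set.range zetaVec)) := by
  have e : WaQ = ↑(Submodule.span ℤ (Set.range zetaVec)) := h.antisymm span_sub_WaQ
  refine ⟨⟨PhiA.toRingHom, PhiA_single, PhiA_inj, ?_⟩, e⟩
  rw [e]; exact PhiA_range

section PartB
open scoped Real

/-! ### Part B -/

open NumberField in
theorem frob_congr_pow {R : Type*} [CommRing R] (P : Ideal R) (p : ℕ) (hp : p.Prime) (hpP : (p : R) ∈ P)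
    (k : ℕ) (u w : R) (h : u - w ∈ P ^ (k + 1)) : u ^ p - w ^ p ∈ P ^ (k + 2) := by
  obtain ⟨r, hr⟩ := exists_add_pow_prime_eq hp w (u - w)
  rw [add_sub_cancel] at hr
  have e : u ^ p - w ^ p = (u - w) ^ p + (p : R) * (u - w) * (w * r) := by rw [hr]; ring
  rw [e]
  refine Ideal.add_mem _ ?_ (Ideal.mul_mem_right _ _ ?_)
  · have h1 : (u - w) ^ p ∈ (P ^ (k + 1)) ^ p := Ideal.pow_mem_pow h p
    rw [← pow_mul] at h1
    refine Ideal.pow_le_pow_right ?_ h1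
    have := hp.two_le
    nlinarith
  · rw [pow_succ', ]
    exact Ideal.mul_mem_mul hpP h

open NumberField

/-- Vector in `𝓞 M` mapping to a Witt vector. -/
def WM (M : IntermediateField ℚ ℂ) : Set (ℕ+ → 𝓞 M) := {x | (fun n => ((x n : M) : ℂ)) ∈ WR}

/-- The embedding of the ring of integers in `ℂ`. -/
noncomputable def embO (M : IntermediateField ℚ ℂ) : 𝓞 M →+* ℂ := (algebraMap M ℂ).comp (algebraMap (𝓞 M) M)
theorem embO_inj {M : IntermediateField ℚ ℂ} : Function.Injective (embO M) :=
  fun a b hab => RingOfIntegers.ext (Subtype.ext hab)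

theorem exists_ringInt {M : IntermediateField ℚ ℂ} {z : ℂ} (hz : z ∈ M) (hi : IsIntegral ℤ z) :
    ∃ y : 𝓞 M, ((y : M) : ℂ) = z :=
  ⟨⟨⟨z, hz⟩, (isIntegral_algHom_iff (M.val.restrictScalars ℤ) M.val.injective).1 hi⟩, rfl⟩

theorem WM_delta {M : IntermediateField ℚ ℂ} {x : ℕ+ → 𝓞 M} (hx : x ∈ WM M) (p : ℕ) (hp : p.Prime) :
    ∃ y ∈ WM M, ∀ n, x (ppos p hp * n) = x n ^ p + p * y n := by
  obtain ⟨η, hη, e⟩ := WR_delta hx p hp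
  have hp0 : (p : ℂ) ≠ 0 := by exact_mod_cast hp.ne_zero
  have hM : ∀ n, η n ∈ M := by
    intro n
    have : η n = ((((x (ppos p hp * n) : M) - (x n : M) ^ p) / (p : M) : M) : ℂ) := by
      push_cast
      rw [e n]; field_simp; ring
    rw [this]; exact SetLike.coe_mem _
  choose y hy using fun n => exists_ringInt (hM n) (WR_int hη n)
  refine ⟨y, ?_, fun n => ?_⟩
  · change (fun n => ((y n : M) : ℂ)) ∈ WR
    simp only [hy]; exact hη
  apply embO_inj
  rw [map_add, map_pow, map_mul, map_natCast]
  have := e n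
  rw [← hy] at this
  exact this

def Frob {M : IntermediateField ℚ ℂ} (p : ℕ) (P : Ideal (𝓞 M)) (φ : M ≃ₐ[ℚ] M) : Prop :=
  ∀ x : 𝓞 M, φ • x - x ^ p ∈ P

theorem frob_star {M : IntermediateField ℚ ℂ} (p : ℕ) (hp : p.Prime) (P : Ideal (𝓞 M)) (hpP : (p : 𝓞 M) ∈ P)
    (φ : M ≃ₐ[ℚ] M) (hφ : Frob p P φ) (a : ℕ) : ∀ x ∈ WM M, ∀ n,
    φ • x (ppos p hp ^ a * n) - x (ppos p hp ^ (a + 1) * n) ∈ P ^ (a + 1) := by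
  induction a with
  | zero =>
    intro x hx n
    obtain ⟨y, hy, e⟩ := WM_delta hx p hp
    simp only [pow_zero, one_mul, zero_add, pow_one]
    rw [e, ← sub_sub]
    exact P.sub_mem (hφ _) (Ideal.mul_mem_right _ _ hpP)
  | succ a ih =>
    intro x hx n
    obtain ⟨y, hy, e⟩ := WM_delta hx p hp
    have e1 : x (ppos p hp ^ (a + 1) * n) = x (ppos p hp ^ a * n) ^ p + p * y (ppos p hp ^ a * n) := by
      rw [← e, ← mul_assoc, ← pow_succ']
    have e2 : x (ppos p hp ^ (a + 1 + 1) * n) = x (ppos p hp ^ (a + 1) * n) ^ p + p * y (ppos p hp ^ (a + 1) * n) := by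
      rw [← e, ← mul_assoc, ← pow_succ']
    rw [e2]
    have e3 : φ • x (ppos p hp ^ (a + 1) * n) = (φ • x (ppos p hp ^ a * n)) ^ p + p * φ • y (ppos p hp ^ a * n) := by
      rw [e1, smul_add, smul_mul', smul_pow']
      congr 2
      exact map_natCast (MulSemiringAction.toRingHom (M ≃ₐ[ℚ] M) (𝓞 M) φ) p
    rw [e3]
    have h1 := frob_congr_pow P p hp hpP a _ _ (ih x hx n)
    have h2 := Ideal.mul_mem_mul hpP (ih y hy n)
    rw [← pow_succ'] at h2
    have := Ideal.add_mem _ h1 h2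
    convert this using 1
    ring

theorem pow_dvd_absNorm {M : Type*} [Field M] [NumberField M] (p : ℕ) (hp : p.Prime) (P : Ideal (𝓞 M)) (hP : P ≠ ⊤) (hpP : (p : 𝓞 M) ∈ P)
    (δ : 𝓞 M) (k : ℕ) (h : δ ∈ P ^ k) : p ^ k ∣ Ideal.absNorm (Ideal.span {δ}) := by
  have h1 : Ideal.absNorm (P ^ k) ∣ Ideal.absNorm (Ideal.span {δ}) :=
    Ideal.absNorm_dvd_absNorm_of_le (by rwa [Ideal.span_singleton_le_iff_mem])
  rw [map_pow] at h1
  refine (pow_dvd_pow_of_dvd ?_ k).trans h1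
  by_contra hn
  have hc : Nat.Coprime p (Ideal.absNorm P) := (Nat.Prime.coprime_iff_not_dvd hp).2 hn
  have hc' : IsCoprime (p : ℤ) (Ideal.absNorm P : ℤ) := Nat.isCoprime_iff_coprime.2 hc
  obtain ⟨a, b, hab⟩ := hc'
  apply hP
  rw [Ideal.eq_top_iff_one]
  have : (1 : 𝓞 M) = a * p + b * (Ideal.absNorm P : ℕ) := by exact_mod_cast congrArg (Int.cast : ℤ → 𝓞 M) hab.symm
  rw [this]
  exact P.add_mem (P.mul_mem_left _ hpP) (P.mul_mem_left _ (Ideal.absNorm_mem P))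

theorem WaQ_finite {ξ : ℕ+ → ℂ} (h : ξ ∈ WaQ) : (Set.range ξ).Finite := by
  obtain ⟨f, hf, h0⟩ := h.2
  refine Set.Finite.subset (f.rootSet_finite ℂ) ?_
  rintro _ ⟨n, rfl⟩
  rw [Polynomial.mem_rootSet]
  refine ⟨hf.ne_zero, ?_⟩
  have h1 : Polynomial.aeval ξ f = 0 := h0
  have := congrArg (Pi.evalAlgHom ℤ (fun _ : ℕ+ => ℂ) n) h1
  rw [← Polynomial.aeval_algHom_apply] at this
  simpa using this

theorem frob_exact (M : IntermediateField ℚ ℂ) [FiniteDimensional ℚ M] {ξ : ℕ+ → ℂ} (h : ξ ∈ WaQ)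
    (x : ℕ+ → 𝓞 M) (hx : ∀ n, ((x n : M) : ℂ) = ξ n) :
    ∃ D : ℕ, 0 < D ∧ ∀ (p : ℕ) (hp : p.Prime) (P : Ideal (𝓞 M)), P ≠ ⊤ → (p : 𝓞 M) ∈ P →
      ∀ φ : M ≃ₐ[ℚ] M, Frob p P φ → ∀ (a : ℕ), D.factorization p ≤ a → ∀ n,
      φ • x (ppos p hp ^ a * n) = x (ppos p hp ^ (a + 1) * n) := by
  have : NumberField M := { to_charZero := inferInstance, to_finiteDimensional := inferInstance }
  have hW : x ∈ WM M := by
    change (fun n => ((x n : M) : ℂ)) ∈ WR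
    simp only [hx]; exact mem_WR.2 h.1
  have hfin : (Set.range x).Finite := by
    refine Set.Finite.of_finite_image (f := fun y : 𝓞 M => ((y : M) : ℂ)) ?_ ?_
    · refine (WaQ_finite h).subset ?_
      rintro _ ⟨_, ⟨n, rfl⟩, rfl⟩
      exact ⟨n, (hx n).symm⟩
    · intro a _ b _ hab
      exact RingOfIntegers.ext (Subtype.ext hab)
  classical
  have hfin2 : (Set.image2 (fun (σ : M ≃ₐ[ℚ] M) (y : 𝓞 M × 𝓞 M) => σ • y.1 - y.2) Set.univ
      (Set.range x ×ˢ Set.range x)).Finite := Set.Finite.image2 _ Set.finite_univ (hfin.prod hfin)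
  have hne : ∀ d ∈ hfin2.toFinset.filter (· ≠ 0), Ideal.absNorm (Ideal.span {d}) ≠ 0 := by
    intro d hd
    rw [Finset.mem_filter] at hd
    rw [Ne, Ideal.absNorm_eq_zero_iff, Ideal.span_singleton_eq_bot]; exact hd.2
  refine ⟨∏ d ∈ hfin2.toFinset.filter (· ≠ 0), Ideal.absNorm (Ideal.span {d}), ?_, ?_⟩
  · exact Nat.pos_of_ne_zero (Finset.prod_ne_zero_iff.2 hne)
  intro p hp P hP hpP φ hφ a ha n
  by_contra hcon
  have hmem : φ • x (ppos p hp ^ a * n) - x (ppos p hp ^ (a + 1) * n) ∈ hfin2.toFinset.filter (· ≠ 0) := by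
    rw [Finset.mem_filter]
    refine ⟨?_, sub_ne_zero.2 hcon⟩
    rw [Set.Finite.mem_toFinset]
    exact ⟨φ, trivial, (_, _), ⟨⟨_, rfl⟩, ⟨_, rfl⟩⟩, rfl⟩
  have h1 := pow_dvd_absNorm p hp P hP hpP _ _ (frob_star p hp P hpP φ hφ a x hW n)
  have h2 := h1.trans (Finset.dvd_prod_of_mem (fun d => Ideal.absNorm (Ideal.span {d})) hmem)
  rw [hp.pow_dvd_iff_le_factorization (Finset.prod_ne_zero_iff.2 hne)] at h2
  omega

theorem exists_frob (M : IntermediateField ℚ ℂ) [FiniteDimensional ℚ M] [IsGalois ℚ M] (p : ℕ) (hp : p.Prime)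
    (P : Ideal (𝓞 M)) [P.IsPrime] (hpP : (p : 𝓞 M) ∈ P) : ∃ φ : M ≃ₐ[ℚ] M, Frob p P φ := by
  have : NumberField M := { to_charZero := inferInstance, to_finiteDimensional := inferInstance }
  have hP0 : P ≠ ⊥ := by
    rintro rfl
    rw [Ideal.mem_bot] at hpP
    exact hp.ne_zero (by exact_mod_cast hpP)
  have : Finite (𝓞 M ⧸ P) := Ideal.finiteQuotientOfFreeOfNeBot P hP0
  obtain ⟨φ, hφ⟩ := IsArithFrobAt.exists_of_isInvariant ℤ (M ≃ₐ[ℚ] M) P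
  refine ⟨φ, fun x => ?_⟩
  have hu : P.under ℤ = Ideal.span {(p : ℤ)} := by
    refine ((Ideal.IsMaximal.eq_of_le ?_ ?_ ?_)).symm
    · exact PrincipalIdealRing.isMaximal_of_irreducible (Nat.prime_iff_prime_int.1 hp).irreducible
    · exact (Ideal.IsPrime.under ℤ P).ne_top
    · rw [Ideal.span_singleton_le_iff_mem, Ideal.under_def, Ideal.mem_comap]
      simpa using hpP
  have hc : Nat.card (ℤ ⧸ P.under ℤ) = p := by
    rw [hu, Nat.card_congr (Int.quotientSpanNatEquivZMod p).toEquiv, Nat.card_zmod]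
  have := hφ x
  rw [hc] at this
  exact this

theorem Frob.conj {M : IntermediateField ℚ ℂ} {p : ℕ} {P : Ideal (𝓞 M)} {φ : M ≃ₐ[ℚ] M} (h : Frob p P φ) (g : M ≃ₐ[ℚ] M) :
    Frob p (P.comap (MulSemiringAction.toRingHom (M ≃ₐ[ℚ] M) (𝓞 M) g⁻¹)) (g * φ * g⁻¹) := by
  intro x
  rw [Ideal.mem_comap]
  have := h (g⁻¹ • x)
  rw [MulSemiringAction.toRingHom_apply, smul_sub, smul_pow', ← mul_smul, ← mul_assoc, ← mul_assoc, inv_mul_cancel, one_mul, mul_smul]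
  exact this
end PartB

section PartE1
open scoped Real
open NumberField

/-! ### Part E1: divisibility, restriction maps, cyclotomic fields -/

theorem div_prime_pow (p : ℕ) (hp : p.Prime) (n : ℕ+) (k : ℕ) : ∀ η ∈ WR,
    (∀ i < k, η (ppos p hp ^ i * n) = 0) → ∃ y, IsIntegral ℤ y ∧ η (ppos p hp ^ k * n) = (p : ℂ) ^ k * y := by
  induction k with
  | zero => intro η hη _; exact ⟨_, WR_int hη _, by simp; rfl⟩
  | succ k ih =>
    intro η hη h0
    obtain ⟨η', hη', e⟩ := WR_delta hη p hp
    have hp0 : (p : ℂ) ≠ 0 := by exact_mod_cast hp.ne_zero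
    have e' : ∀ i, η (ppos p hp ^ (i + 1) * n) = η (ppos p hp ^ i * n) ^ p + p * η' (ppos p hp ^ i * n) := by
      intro i; rw [← e, ← mul_assoc, ← pow_succ']
    obtain ⟨y, hy, hy'⟩ := ih η' hη' (fun i hi => by
      have := e' i
      rw [h0 (i + 1) (by omega), h0 i (by omega), zero_pow hp.ne_zero, zero_add] at this
      exact (mul_eq_zero.1 this.symm).resolve_left hp0)
    refine ⟨y, hy, ?_⟩
    rw [e', hy', h0 k (by omega), zero_pow hp.ne_zero]; ring

theorem div_of_prime_pow (z : ℂ) (m : ℕ) (hm : 0 < m)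
    (h : ∀ p k, p.Prime → p ^ k ∣ m → ∃ y, IsIntegral ℤ y ∧ z = ((p ^ k : ℕ) : ℂ) * y) :
    ∃ y, IsIntegral ℤ y ∧ z = (m : ℂ) * y := by
  induction m using Nat.recOnPosPrimePosCoprime with
  | prime_pow p n hp hn => exact h p n hp dvd_rfl
  | zero => omega
  | one =>
    obtain ⟨y, hy, e⟩ := h 2 0 Nat.prime_two (by simp)
    exact ⟨y, hy, by simpa using e⟩
  | coprime a b ha hb hab iha ihb =>
    obtain ⟨y, hy, e⟩ := iha (by omega) (fun p k hp hk => h p k hp (hk.mul_right _))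
    obtain ⟨y', hy', e'⟩ := ihb (by omega) (fun p k hp hk => h p k hp (hk.mul_left _))
    obtain ⟨s, t, hst⟩ := Nat.isCoprime_iff_coprime.2 hab
    refine ⟨s * y' + t * y, ((isIntegral_algebraMap (R := ℤ) (A := ℂ) (x := s)).mul hy').add ((isIntegral_algebraMap (R := ℤ) (A := ℂ) (x := t)).mul hy), ?_⟩
    have hst' : (s : ℂ) * a + t * b = 1 := by exact_mod_cast congrArg (Int.cast : ℤ → ℂ) hst
    push_cast
    have : z = (s * a + t * b) * z := by rw [hst', one_mul]
    rw [this]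
    nth_rewrite 1 [add_mul, mul_assoc, e', mul_assoc (t : ℂ)]
    have e2 : (t : ℂ) * (b * z) = t * (b * (a * y)) := by rw [← e]
    rw [← e'] 
    rw [e2]
    rw [e']; ring

theorem div_lemma {ξ : ℕ+ → ℂ} (h : ξ ∈ WR) (d : ℕ+) (h0 : ∀ d' : ℕ+, d' ∣ d → d' ≠ d → ξ d' = 0) :
    ∃ y, IsIntegral ℤ y ∧ ξ d = (d : ℂ) * y := by
  refine div_of_prime_pow _ _ d.pos fun p k hp hk => ?_
  obtain ⟨m, hm⟩ := hk
  have hm0 : 0 < m := Nat.pos_of_ne_zero (by rintro rfl; simp at hm)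
  have hd : d = ppos p hp ^ k * ⟨m, hm0⟩ := by
    apply PNat.eq; rw [hm]; rfl
  obtain ⟨y, hy, e⟩ := div_prime_pow p hp ⟨m, hm0⟩ k ξ h (fun i hi => by
    apply h0
    · rw [hd]; exact mul_dvd_mul (pow_dvd_pow _ hi.le) dvd_rfl
    · intro hh
      rw [hd] at hh
      have := congrArg (fun q : ℕ+ => (q : ℕ)) (mul_right_cancel hh)
      simp only [PNat.pow_coe, ppos_coe] at this
      exact hi.ne (Nat.pow_right_injective hp.two_le this))
  exact ⟨y, hy, by rw [hd, e]; push_cast; rfl⟩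

/-- Restriction of automorphisms. -/
noncomputable def resH {K L : IntermediateField ℚ ℂ} (h : K ≤ L) [Normal ℚ K] : (L ≃ₐ[ℚ] L) →* (K ≃ₐ[ℚ] K) :=
  letI := (IntermediateField.inclusion h).toRingHom.toAlgebra
  haveI : IsScalarTower ℚ K L := IsScalarTower.of_algebraMap_eq (fun _ => rfl)
  AlgEquiv.restrictNormalHom K

theorem resH_apply {K L : IntermediateField ℚ ℂ} (h : K ≤ L) [Normal ℚ K] (σ : L ≃ₐ[ℚ] L) (x : K) :
    IntermediateField.inclusion h (resH h σ x) = σ (IntermediateField.inclusion h x) :=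
  letI := (IntermediateField.inclusion h).toRingHom.toAlgebra
  haveI : IsScalarTower ℚ K L := IsScalarTower.of_algebraMap_eq (fun _ => rfl)
  AlgEquiv.restrictNormal_commutes σ K x

theorem resH_coe {K L : IntermediateField ℚ ℂ} (h : K ≤ L) [Normal ℚ K] (σ : L ≃ₐ[ℚ] L) (x : K) :
    ((resH h σ x : K) : ℂ) = (σ ⟨x, h x.2⟩ : L) :=
  congrArg (Subtype.val) (resH_apply h σ x)

theorem resH_surj {K L : IntermediateField ℚ ℂ} (h : K ≤ L) [Normal ℚ K] [Normal ℚ L] :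
    Function.Surjective (resH h) :=
  letI := (IntermediateField.inclusion h).toRingHom.toAlgebra
  haveI : IsScalarTower ℚ K L := IsScalarTower.of_algebraMap_eq (fun _ => rfl)
  AlgEquiv.restrictNormalHom_surjective L

noncomputable def zN (N : ℕ) : ℂ := Complex.exp (2 * π * Complex.I / N)
noncomputable def CF (N : ℕ) : IntermediateField ℚ ℂ := IntermediateField.adjoin ℚ {zN N}
theorem zN_prim (N : ℕ) (hN : 0 < N) : IsPrimitiveRoot (zN N) N := Complex.isPrimitiveRoot_exp N hN.ne'
theorem zN_mem (N : ℕ) : zN N ∈ CF N := IntermediateField.mem_adjoin_simple_self ℚ _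
noncomputable def zC (N : ℕ) : CF N := ⟨zN N, zN_mem N⟩
theorem zC_prim (N : ℕ) (hN : 0 < N) : IsPrimitiveRoot (zC N) N :=
  IsPrimitiveRoot.of_map_of_injective (f := (CF N).val) (zN_prim N hN) (CF N).val.injective

instance CF_cyc (N : ℕ) [NeZero N] : IsCyclotomicExtension {N} ℚ (CF N) := by
  have hz := zN_prim N (NeZero.pos N)
  change IsCyclotomicExtension {N} ℚ (IntermediateField.adjoin ℚ {zN N}).toSubalgebra
  rw [IntermediateField.adjoin_simple_toSubalgebra_of_isAlgebraic
    (hz.isIntegral (NeZero.pos N)).tower_top.isAlgebraic]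
  exact hz.adjoin_isCyclotomicExtension ℚ

instance CF_fin (N : ℕ) [NeZero N] : FiniteDimensional ℚ (CF N) := IsCyclotomicExtension.finiteDimensional {N} ℚ _
instance CF_gal (N : ℕ) [NeZero N] : IsGalois ℚ (CF N) := IsCyclotomicExtension.isGalois {N} ℚ _
instance CF_nf (N : ℕ) [NeZero N] : NumberField (CF N) := { to_charZero := inferInstance, to_finiteDimensional := inferInstance }

theorem zN_pow_mul (N d : ℕ) (hN : 0 < N) (hd : d ∣ N) : zN (N / d) = zN N ^ d := by
  have hd0 : 0 < d := Nat.pos_of_dvd_of_pos hd hN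
  rw [zN, zN, ← Complex.exp_nat_mul, Nat.cast_div hd (by exact_mod_cast hd0.ne')]
  congr 1
  have : (d : ℂ) ≠ 0 := by exact_mod_cast hd0.ne'
  have : (N : ℂ) ≠ 0 := by exact_mod_cast hN.ne'
  field_simp

theorem CF_mono {m N : ℕ} (hN : 0 < N) (h : m ∣ N) : CF m ≤ CF N := by
  rw [CF, IntermediateField.adjoin_simple_le_iff]
  have hm := Nat.pos_of_dvd_of_pos h hN
  have := zN_pow_mul N (N / m) hN (Nat.div_dvd_of_dvd h)
  rw [Nat.div_div_self h hN.ne'] at this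
  rw [this]; exact pow_mem (zN_mem N) _

theorem CF_pow_mem {N : ℕ} (hN : 0 < N) {z : ℂ} (hz : z ^ N = 1) : z ∈ CF N := by
  have : NeZero N := ⟨hN.ne'⟩
  obtain ⟨i, _, rfl⟩ := (zN_prim N hN).eq_pow_of_pow_eq_one hz
  exact pow_mem (zN_mem N) _

theorem zC_pow_congr_iff {N : ℕ} (hN : 0 < N) {a b : ℕ} : zC N ^ a = zC N ^ b ↔ a ≡ b [MOD N] := by
  have h1 : N = orderOf (zC N) := (zC_prim N hN).eq_orderOf
  have h2 : IsOfFinOrder (zC N) := isOfFinOrder_iff_pow_eq_one.2 ⟨N, hN, (zC_prim N hN).pow_eq_one⟩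
  rw [h2.pow_eq_pow_iff_modEq, ← h1]

theorem zC_pow_congr {N : ℕ} (hN : 0 < N) {a b : ℕ} (h : a ≡ b [MOD N]) : zC N ^ a = zC N ^ b :=
  (zC_pow_congr_iff hN).2 h

theorem CF_aut (N : ℕ) [NeZero N] (u : ℕ) (hu : u.Coprime N) : ∃ σ : CF N ≃ₐ[ℚ] CF N, σ (zC N) = zC N ^ u := by
  have hN := NeZero.pos N
  have hz := IsCyclotomicExtension.zeta_spec N ℚ (CF N)
  obtain ⟨σ, hσ⟩ := (IsCyclotomicExtension.autEquivPow (CF N) (Polynomial.cyclotomic.irreducible_rat hN)).surjective (ZMod.unitOfCoprime u hu)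
  refine ⟨σ, ?_⟩
  have h1 := hz.autToPow_spec ℚ σ
  have h2 : hz.autToPow ℚ σ = ZMod.unitOfCoprime u hu := hσ
  rw [h2] at h1
  obtain ⟨i, _, hi⟩ := hz.eq_pow_of_pow_eq_one (zC_prim N hN).pow_eq_one
  have h3 : σ (zC N) = zC N ^ ((ZMod.unitOfCoprime u hu : (ZMod N)ˣ) : ZMod N).val := by
    rw [← hi, map_pow, ← h1, ← pow_mul, ← pow_mul, mul_comm]
  rw [h3, zC_pow_congr_iff hN, ZMod.coe_unitOfCoprime, ZMod.val_natCast]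
  exact Nat.mod_modEq _ _

theorem CF_aut_exp (N : ℕ) [NeZero N] (σ : CF N ≃ₐ[ℚ] CF N) : ∃ u : ℕ, u.Coprime N ∧ σ (zC N) = zC N ^ u := by
  have hN := NeZero.pos N
  have h1 := (zC_prim N hN).autToPow_spec ℚ σ
  exact ⟨_, ZMod.val_coe_unit_coprime _, h1.symm⟩

theorem CF_hom_ext {N : ℕ} {σ τ : CF N ≃ₐ[ℚ] CF N} (h : σ (zC N) = τ (zC N)) : σ = τ := by
  have hh : (σ : CF N →ₐ[ℚ] CF N) = τ := by
    refine IntermediateField.algHom_ext_of_eq_adjoin ℚ (S := CF N) (s := {zN N}) rfl ?_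
    rintro x hx
    obtain rfl : x = zN N := hx
    exact h
  ext x
  exact congrArg _ (DFunLike.congr_fun hh x)

theorem CF_integral {N : ℕ} [NeZero N] {z : ℂ} (hz : z ∈ CF N) (hi : IsIntegral ℤ z) : z ∈ Algebra.adjoin ℤ {zN N} := by
  have hN := NeZero.pos N
  have hi' : IsIntegral ℤ (⟨z, hz⟩ : CF N) := (isIntegral_algHom_iff ((CF N).val.restrictScalars ℤ) (CF N).val.injective).1 hi
  have := (IsCyclotomicExtension.Rat.isIntegralClosure_adjoin_singleton (zC_prim N hN)).isIntegral_iff.1 hi'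
  obtain ⟨y, hy⟩ := this
  have hy2 := y.2
  have h3 : ((CF N).val.restrictScalars ℤ) (y : CF N) ∈ (Algebra.adjoin ℤ {zC N}).map ((CF N).val.restrictScalars ℤ) := ⟨_, hy2, rfl⟩
  rw [AlgHom.map_adjoin, Set.image_singleton] at h3
  have h4 : (y : CF N) = ⟨z, hz⟩ := hy
  rw [h4] at h3
  exact h3
end PartE1

section PartE2
open scoped Real
open NumberField

/-! ### Part E2 -/

theorem exists_prime_over (M : Type*) [Field M] [NumberField M] (p : ℕ) (hp : p.Prime) :
    ∃ P : Ideal (𝓞 M), P.IsPrime ∧ (p : 𝓞 M) ∈ P := by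
  have h : Ideal.span {(p : 𝓞 M)} ≠ ⊤ := by
    intro h
    have h1 := Ideal.absNorm_span_singleton (p : 𝓞 M)
    rw [h, Ideal.absNorm_top] at h1
    have h2 : Algebra.norm ℤ ((p : ℤ) : 𝓞 M) = (p : ℤ) ^ (Module.finrank ℤ (𝓞 M)) := by
      have := Algebra.norm_algebraMap (R := ℤ) (S := 𝓞 M) (p : ℤ)
      simpa using this
    rw [Int.cast_natCast] at h2
    rw [h2, RingOfIntegers.rank, Int.natAbs_pow, Int.natAbs_natCast] at h1
    have := Nat.one_lt_pow (Module.finrank_pos (R := ℚ) (M := M)).ne' hp.one_lt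
    omega
  obtain ⟨P, hP, hle⟩ := Ideal.exists_le_maximal _ h
  exact ⟨P, hP.isPrime, (Ideal.span_singleton_le_iff_mem _).1 hle⟩

theorem Frob.of_adjoin {M : IntermediateField ℚ ℂ} {p : ℕ} (hp : p.Prime) {P : Ideal (𝓞 M)} (hpP : (p : 𝓞 M) ∈ P)
    {φ : M ≃ₐ[ℚ] M} (S : Set (𝓞 M)) (hS : Algebra.adjoin ℤ S = ⊤) (h : ∀ s ∈ S, φ • s - s ^ p ∈ P) : Frob p P φ := by
  intro x
  have hx : x ∈ Algebra.adjoin ℤ S := by rw [hS]; trivial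
  have := hp.two_le
  induction hx using Algebra.adjoin_induction with
  | mem x hx => exact h x hx
  | algebraMap r =>
    have e : φ • (algebraMap ℤ (𝓞 M) r) = algebraMap ℤ (𝓞 M) r :=
      map_intCast (MulSemiringAction.toRingHom (M ≃ₐ[ℚ] M) (𝓞 M) φ) r
    rw [e, ← map_pow, ← map_sub]
    have : (p : ℤ) ∣ r - r ^ p := by
      have : Fact p.Prime := ⟨hp⟩
      rw [← ZMod.intCast_zmod_eq_zero_iff_dvd]; push_cast
      rw [ZMod.pow_card, sub_self]
    obtain ⟨c, hc⟩ := this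
    rw [hc, map_mul]
    exact Ideal.mul_mem_right _ _ (by simpa using hpP)
  | add x y _ _ hx hy =>
    obtain ⟨r, hr⟩ := exists_add_pow_prime_eq hp x y
    rw [hr, smul_add]
    have := P.sub_mem (P.add_mem hx hy) (P.mul_mem_right (x * y * r) hpP)
    convert this using 1; ring
  | mul x y _ _ hx hy =>
    rw [smul_mul', mul_pow]
    have := P.add_mem (P.mul_mem_right (φ • y) hx) (P.mul_mem_left (x ^ p) hy)
    convert this using 1; ring

theorem frob_domain_inj {R : Type*} [CommRing R] {P : Ideal R} [P.IsPrime] {p : ℕ} (hp : p.Prime) (hpP : (p : R) ∈ P)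
    (k : ℕ) : ∀ {a b : R}, a ^ p ^ k - b ^ p ^ k ∈ P → a - b ∈ P := by
  induction k with
  | zero => intro a b h; simpa using h
  | succ k ih =>
    intro a b h
    apply ih
    obtain ⟨r, hr⟩ := exists_add_pow_prime_eq hp (b ^ p ^ k) (a ^ p ^ k - b ^ p ^ k)
    rw [add_sub_cancel] at hr
    rw [pow_succ, pow_mul, pow_mul, hr] at h
    refine Ideal.IsPrime.mem_of_pow_mem (I := P) inferInstance p ?_
    have := P.sub_mem h (P.mul_mem_right (b ^ p ^ k * (a ^ p ^ k - b ^ p ^ k) * r) hpP)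
    convert this using 1; ring

theorem CF_frob {N : ℕ} [NeZero N] {p : ℕ} (hp : p.Prime) {u : ℕ} (hu : u ≡ p [MOD ordCompl[p] N])
    {σ : CF N ≃ₐ[ℚ] CF N} (hσ : σ (zC N) = zC N ^ u) {P : Ideal (𝓞 (CF N))} [P.IsPrime] (hpP : (p : 𝓞 (CF N)) ∈ P) :
    Frob p P σ := by
  have hN := NeZero.pos N
  obtain ⟨z, hz⟩ := exists_ringInt (zN_mem N) ((zN_prim N hN).isIntegral hN)
  have hzC : (z : CF N) = zC N := Subtype.ext hz
  refine Frob.of_adjoin hp hpP {z} ?_ ?_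
  · rw [eq_top_iff]
    intro x _
    have h1 : embO _ x ∈ Algebra.adjoin ℤ {zN N} := CF_integral (SetLike.coe_mem (x : CF N)) (x.isIntegral_coe.map (algebraMap (CF N) ℂ).toIntAlgHom)
    have h2 : Algebra.adjoin ℤ {zN N} = (Algebra.adjoin ℤ {z}).map (embO (CF N)).toIntAlgHom := by
      rw [AlgHom.map_adjoin, Set.image_singleton]
      congr 2
      exact hz.symm
    rw [h2] at h1
    obtain ⟨y, hy, hyx⟩ := h1
    rw [← embO_inj hyx]; exact hy
  · intro s hs
    obtain rfl : s = z := hs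
    refine frob_domain_inj hp hpP (N.factorization p) ?_
    rw [sub_eq_zero.2]
    · exact P.zero_mem
    apply RingOfIntegers.ext
    have e1 : ((σ • s : 𝓞 (CF N)) : CF N) = zC N ^ u := by
      rw [← hσ, ← hzC]; rfl
    have e2 : (((σ • s : 𝓞 (CF N)) ^ p ^ N.factorization p : 𝓞 (CF N)) : CF N) = (zC N ^ u) ^ p ^ N.factorization p := by
      rw [← e1]; rfl
    have e3 : (((s ^ p) ^ p ^ N.factorization p : 𝓞 (CF N)) : CF N) = (zC N ^ p) ^ p ^ N.factorization p := by
      rw [← hzC]; rfl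
    refine e2.trans (Eq.trans ?_ e3.symm)
    rw [← pow_mul, ← pow_mul, zC_pow_congr_iff hN]
    have := Nat.ModEq.mul_left' (p ^ N.factorization p) hu
    rw [Nat.ordProj_mul_ordCompl_eq_self] at this
    rwa [mul_comm u, mul_comm p]
end PartE2

section PartE3
open scoped Real
open NumberField

/-! ### Part E3 -/

theorem crt_aux (N p : ℕ) (hN : 0 < N) (hp : p.Prime) (a b : ℕ) : ∃ u, u ≡ a [MOD p ^ N.factorization p] ∧ u ≡ b [MOD ordCompl[p] N] := by
  have hc : Nat.Coprime (p ^ N.factorization p) (ordCompl[p] N) :=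
    Nat.Coprime.pow_left _ (Nat.coprime_ordCompl hp hN.ne')
  exact ⟨_, (Nat.chineseRemainder hc a b).2⟩

theorem coprime_aux (N p : ℕ) (hp : p.Prime) {u : ℕ} (h1 : u.Coprime (p ^ N.factorization p))
    (h2 : u.Coprime (ordCompl[p] N)) : u.Coprime N := by
  rw [← Nat.ordProj_mul_ordCompl_eq_self N p]
  exact Nat.Coprime.mul_right h1 h2

theorem modEq_aux (N p : ℕ) (hN : 0 < N) (hp : p.Prime) {u w : ℕ} (h1 : u ≡ w [MOD p ^ N.factorization p])
    (h2 : u ≡ w [MOD ordCompl[p] N]) : u ≡ w [MOD N] := by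
  have hc : Nat.Coprime (p ^ N.factorization p) (ordCompl[p] N) :=
    Nat.Coprime.pow_left _ (Nat.coprime_ordCompl hp hN.ne')
  rw [← Nat.ordProj_mul_ordCompl_eq_self N p]
  exact (Nat.modEq_and_modEq_iff_modEq_mul hc).1 ⟨h1, h2⟩

theorem coprime_of_modEq {u w m : ℕ} (h : u ≡ w [MOD m]) (hw : w.Coprime m) : u.Coprime m := by
  rw [Nat.Coprime, h.gcd_eq]; exact hw

/-- Data extracted from an integral Witt vector with values in `CF N`. -/
structure EData (ξ : ℕ+ → ℂ) (N D : ℕ) (x : ℕ+ → CF N) : Prop where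
  hN : 0 < N
  hD : 0 < D
  coe : ∀ n, ((x n : CF N) : ℂ) = ξ n
  frob : ∀ (p : ℕ) (hp : p.Prime) (u : ℕ), u ≡ p [MOD ordCompl[p] N] → ∀ σ : CF N ≃ₐ[ℚ] CF N, σ (zC N) = zC N ^ u →
    ∀ n : ℕ+, D.factorization p ≤ (n : ℕ).factorization p → σ (x n) = x (ppos p hp * n)

theorem exists_EData {ξ : ℕ+ → ℂ} (h : ξ ∈ WaQ) (N : ℕ) (hN : 0 < N) (hval : ∀ n, ξ n ∈ CF N) :
    ∃ D x, EData ξ N D x := by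
  have : NeZero N := ⟨hN.ne'⟩
  choose x hx using fun n => exists_ringInt (hval n) (h.1 0 n)
  obtain ⟨D, hD, H⟩ := frob_exact (CF N) h x hx
  refine ⟨D, fun n => (x n : CF N), hN, hD, hx, ?_⟩
  intro p hp u hu σ hσ n hn
  obtain ⟨P, hP, hpP⟩ := exists_prime_over (CF N) p hp
  have hF := CF_frob hp hu hσ hpP
  obtain ⟨m, hm⟩ := Nat.ordProj_dvd (n : ℕ) p
  have hm0 : 0 < m := Nat.pos_of_ne_zero (by rintro rfl; simp at hm)
  obtain ⟨m', hm'⟩ : ∃ m' : ℕ+, (m' : ℕ) = m := ⟨⟨m, hm0⟩, rfl⟩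
  have hd : n = ppos p hp ^ (n : ℕ).factorization p * m' := by
    apply PNat.eq; rw [PNat.mul_coe, PNat.pow_coe, ppos_coe, hm']; exact hm
  have := H p hp P hP.ne_top hpP σ hF _ hn m'
  rw [pow_succ', mul_assoc, ← hd] at this
  exact congrArg (algebraMap (𝓞 (CF N)) (CF N)) this

theorem EData.inert {ξ : ℕ+ → ℂ} {N D : ℕ} {x : ℕ+ → CF N} (H : EData ξ N D x) (p : ℕ) (hp : p.Prime) (w : ℕ)
    (hwN : w.Coprime N) (hw : w ≡ 1 [MOD ordCompl[p] N]) (σ : CF N ≃ₐ[ℚ] CF N) (hσ : σ (zC N) = zC N ^ w)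
    (n : ℕ+) (hn : D.factorization p ≤ (n : ℕ).factorization p) : σ (x n) = x n := by
  have : NeZero N := ⟨H.hN.ne'⟩
  obtain ⟨u, hu1, hu2⟩ := crt_aux N p H.hN hp 1 p
  have huN : u.Coprime N := coprime_aux N p hp (coprime_of_modEq hu1 (Nat.coprime_one_left _))
    (coprime_of_modEq hu2 (Nat.coprime_ordCompl hp H.hN.ne'))
  obtain ⟨τ, hτ⟩ := CF_aut N u huN
  have h1 := H.frob p hp u hu2 τ hτ n hn
  have h2 := H.frob p hp (w * u) (by simpa using hw.mul hu2) (τ * σ) (by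
    rw [AlgEquiv.mul_apply, hσ, map_pow, hτ, ← pow_mul, mul_comm]) n hn
  rw [← h1, AlgEquiv.mul_apply] at h2
  exact τ.injective h2

theorem EData.fixed_aux {ξ : ℕ+ → ℂ} {N D : ℕ} {x : ℕ+ → CF N} (H : EData ξ N D x) (d : ℕ+) (T : Finset ℕ) :
    (∀ p ∈ T, D.factorization p ≤ (d : ℕ).factorization p) → ∀ w : ℕ, w.Coprime N →
    (∀ p, p.Prime → p ∉ T → w ≡ 1 [MOD p ^ N.factorization p]) → ∀ σ : CF N ≃ₐ[ℚ] CF N, σ (zC N) = zC N ^ w →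
    σ (x d) = x d := by
  have hNZ : NeZero N := ⟨H.hN.ne'⟩
  induction T using Finset.induction_on with
  | empty =>
    intro _ w hw h1 σ hσ
    have : w ≡ 1 [MOD N] := by
      rw [← Int.natCast_modEq_iff, Int.modEq_iff_dvd]
      rw [← Int.natAbs_dvd_natAbs, Int.natAbs_natCast]
      rcases eq_or_ne ((((1 : ℕ) : ℤ) - (w : ℤ)).natAbs) 0 with h0 | h0
      · rw [h0]; exact dvd_zero _
      rw [← Nat.factorization_le_iff_dvd H.hN.ne' h0]
      intro p
      by_cases hp : p.Prime
      · rw [← hp.pow_dvd_iff_le_factorization h0]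
        have := h1 p hp (by simp)
        rw [← Int.natCast_modEq_iff, Int.modEq_iff_dvd, ← Int.natAbs_dvd_natAbs, Int.natAbs_natCast] at this
        exact this
      · rw [Nat.factorization_eq_zero_of_not_prime _ hp]; exact Nat.zero_le _
    have h2 : σ = 1 := CF_hom_ext (by rw [hσ, zC_pow_congr H.hN this, pow_one]; rfl)
    rw [h2]; rfl
  | insert p T hpT ih =>
    intro hT w hw h1 σ hσ
    by_cases hp : p.Prime
    swap
    · refine ih (fun q hq => hT q (Finset.mem_insert_of_mem hq)) w hw (fun q hq hqT => h1 q hq ?_) σ hσ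
      rw [Finset.mem_insert, not_or]
      exact ⟨by rintro rfl; exact hp hq, hqT⟩
    have hcp := Nat.Coprime.coprime_dvd_right (Nat.ordProj_dvd N p) hw
    have hcc := Nat.Coprime.coprime_dvd_right (Nat.ordCompl_dvd N p) hw
    obtain ⟨w1, h11, h12⟩ := crt_aux N p H.hN hp w 1
    obtain ⟨w2, h21, h22⟩ := crt_aux N p H.hN hp 1 w
    have c1 : w1.Coprime N := coprime_aux N p hp (coprime_of_modEq h11 hcp) (coprime_of_modEq h12 (Nat.coprime_one_left _))
    have c2 : w2.Coprime N := coprime_aux N p hp (coprime_of_modEq h21 (Nat.coprime_one_left _)) (coprime_of_modEq h22 hcc)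
    have e : w1 * w2 ≡ w [MOD N] := modEq_aux N p H.hN hp (by simpa using h11.mul h21) (by simpa using h12.mul h22)
    obtain ⟨σ1, hσ1⟩ := CF_aut N w1 c1
    obtain ⟨σ2, hσ2⟩ := CF_aut N w2 c2
    have f1 := H.inert p hp w1 c1 h12 σ1 hσ1 d (hT p (Finset.mem_insert_self _ _))
    have f2 := ih (fun q hq => hT q (Finset.mem_insert_of_mem hq)) w2 c2 (fun q hq hqT => by
      by_cases hqp : q = p
      · rw [hqp]; exact h21
      · have h3 : w2 ≡ w [MOD q ^ N.factorization q] := by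
          refine h22.of_dvd ?_
          have hc : Nat.Coprime (q ^ N.factorization q) (p ^ N.factorization p) :=
            Nat.coprime_pow_primes _ _ hq hp hqp
          have := Nat.ordProj_dvd N q
          nth_rewrite 2 [← Nat.ordProj_mul_ordCompl_eq_self N p] at this
          exact hc.dvd_of_dvd_mul_left this
        exact h3.trans (h1 q hq (by rw [Finset.mem_insert, not_or]; exact ⟨hqp, hqT⟩))) σ2 hσ2
    have h2 : σ = σ2 * σ1 := CF_hom_ext (by
      rw [hσ, AlgEquiv.mul_apply, hσ1, map_pow, hσ2, ← pow_mul, mul_comm, zC_pow_congr H.hN e])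
    rw [h2, AlgEquiv.mul_apply, f1, f2]

theorem EData.fixed {ξ : ℕ+ → ℂ} {N D : ℕ} {x : ℕ+ → CF N} (H : EData ξ N D x) (d : ℕ+) (hd : (d : ℕ) ∣ N * D)
    (w : ℕ) (hw : w.Coprime N) (hw1 : w ≡ 1 [MOD (N * D) / d]) (σ : CF N ≃ₐ[ℚ] CF N) (hσ : σ (zC N) = zC N ^ w) :
    σ (x d) = x d := by
  classical
  refine H.fixed_aux d (((N * D).primeFactors).filter fun p => D.factorization p ≤ (d : ℕ).factorization p)
    (fun p hp => (Finset.mem_filter.1 hp).2) w hw (fun p hp hpT => ?_) σ hσ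
  have hND : N * D ≠ 0 := (Nat.mul_pos H.hN H.hD).ne'
  by_cases hpN : p ∣ N
  swap
  · rw [Nat.factorization_eq_zero_of_not_dvd hpN, pow_zero]; exact Nat.modEq_one
  have hlt : (d : ℕ).factorization p < D.factorization p := by
    by_contra h1
    exact hpT (Finset.mem_filter.2 ⟨Nat.mem_primeFactors.2 ⟨hp, hpN.mul_right _, hND⟩, not_lt.1 h1⟩)
  refine hw1.of_dvd ?_
  have h0 : N * D / d ≠ 0 := (Nat.div_pos (Nat.le_of_dvd (Nat.pos_of_ne_zero hND) hd) d.pos).ne'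
  rw [hp.pow_dvd_iff_le_factorization h0, Nat.factorization_div hd, Nat.factorization_mul H.hN.ne' H.hD.ne']
  simp only [Finsupp.coe_tsub, Finsupp.coe_add, Pi.sub_apply, Pi.add_apply]
  omega
end PartE3

section PartE4
open scoped Real
open NumberField

/-! ### Part E4 -/

/-- Vectors with the Frobenius and inertia properties of level `Q`. -/
noncomputable def EQS (Q : ℕ) : AddSubgroup (ℕ+ → ℂ) where
  carrier := {ξ | ∃ x : ℕ+ → CF Q, (∀ n, ((x n : CF Q) : ℂ) = ξ n) ∧
    (∀ (p : ℕ) (hp : p.Prime) (u : ℕ), u ≡ p [MOD ordCompl[p] Q] → ∀ σ : CF Q ≃ₐ[ℚ] CF Q, σ (zC Q) = zC Q ^ u →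
      ∀ n : ℕ+, Q.factorization p ≤ (n : ℕ).factorization p → σ (x n) = x (ppos p hp * n)) ∧
    (∀ d : ℕ+, (d : ℕ) ∣ Q → ∀ w : ℕ, w.Coprime Q → w ≡ 1 [MOD Q / d] → ∀ σ : CF Q ≃ₐ[ℚ] CF Q, σ (zC Q) = zC Q ^ w →
      σ (x d) = x d)}
  add_mem' := by
    rintro a b ⟨x, h1, h2, h3⟩ ⟨y, k1, k2, k3⟩
    refine ⟨fun n => x n + y n, fun n => ?_, fun p hp u hu σ hσ n hn => ?_, fun d hd w hw hw1 σ hσ => ?_⟩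
    · rw [Pi.add_apply, ← h1, ← k1]; rfl
    · rw [map_add, h2 p hp u hu σ hσ n hn, k2 p hp u hu σ hσ n hn]
    · rw [map_add, h3 d hd w hw hw1 σ hσ, k3 d hd w hw hw1 σ hσ]
  zero_mem' := ⟨fun _ => 0, fun n => rfl, fun p hp u hu σ hσ n hn => map_zero _, fun d hd w hw hw1 σ hσ => map_zero _⟩
  neg_mem' := by
    rintro a ⟨x, h1, h2, h3⟩
    refine ⟨fun n => - x n, fun n => ?_, fun p hp u hu σ hσ n hn => ?_, fun d hd w hw hw1 σ hσ => ?_⟩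
    · rw [Pi.neg_apply, ← h1]; rfl
    · rw [map_neg, h2 p hp u hu σ hσ n hn]
    · rw [map_neg, h3 d hd w hw hw1 σ hσ]

theorem zeta_val (Q : ℕ) (hQ : 0 < Q) (j : ℕ) (n : ℕ+) : zetaVec ((j : ℚ) / Q) n = zN Q ^ (j * (n : ℕ)) := by
  rw [zetaVec_eq_pow, zN, ← Complex.exp_nat_mul, ← Complex.exp_nat_mul]
  congr 1
  push_cast
  ring

theorem zeta_mem_EQS (Q : ℕ) (hQ : 0 < Q) (j : ℕ) : zetaVec ((j : ℚ) / Q) ∈ EQS Q := by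
  refine ⟨fun n => zC Q ^ (j * (n : ℕ)), fun n => ?_, fun p hp u hu σ hσ n hn => ?_, fun d hd w hw hw1 σ hσ => ?_⟩
  · rw [zeta_val Q hQ]; rfl
  · rw [map_pow, hσ, ← pow_mul]
    change _ = zC Q ^ (j * ((ppos p hp * n : ℕ+) : ℕ))
    rw [PNat.mul_coe, ppos_coe]
    apply zC_pow_congr hQ
    have h1 : u * (n : ℕ) ≡ p * (n : ℕ) [MOD Q] := by
      have hpn : p ^ Q.factorization p ∣ (n : ℕ) := (hp.pow_dvd_iff_le_factorization n.ne_zero).2 hn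
      obtain ⟨m, hm⟩ := hpn
      rw [hm, mul_left_comm, mul_left_comm p]
      have := Nat.ModEq.mul_left' (p ^ Q.factorization p) (hu.mul_right m)
      rwa [Nat.ordProj_mul_ordCompl_eq_self Q p] at this
    rw [mul_left_comm]
    exact Nat.ModEq.mul_left _ h1
  · rw [map_pow, hσ, ← pow_mul]
    apply zC_pow_congr hQ
    have h1 : (d : ℕ) * w ≡ d * 1 [MOD Q] := by
      have := Nat.ModEq.mul_left' (d : ℕ) hw1
      rwa [Nat.mul_div_cancel' hd] at this
    rw [mul_one] at h1
    rw [mul_comm w, mul_assoc]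
    exact Nat.ModEq.mul_left _ h1

noncomputable def GamQ (Q : ℕ) : AddSubgroup (ℕ+ → ℂ) := AddSubgroup.closure (Set.range fun j : ℕ => zetaVec ((j : ℚ) / Q))

theorem GamQ_EQS (Q : ℕ) (hQ : 0 < Q) : GamQ Q ≤ EQS Q := by
  rw [GamQ, AddSubgroup.closure_le]; rintro _ ⟨j, rfl⟩; exact zeta_mem_EQS Q hQ j
theorem GamQ_WR (Q : ℕ) : GamQ Q ≤ WR.toAddSubgroup := by
  rw [GamQ, AddSubgroup.closure_le]; rintro _ ⟨j, rfl⟩; exact zetaVec_mem _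
theorem GamQ_span (Q : ℕ) : GamQ Q ≤ (Submodule.span ℤ (Set.range zetaVec)).toAddSubgroup := by
  rw [GamQ, AddSubgroup.closure_le]; rintro _ ⟨j, rfl⟩; exact Submodule.subset_span ⟨_, rfl⟩

theorem EQS_vanish (Q : ℕ) (hQ : 0 < Q) {ξ : ℕ+ → ℂ} (h : ξ ∈ EQS Q) (h0 : ∀ d : ℕ+, (d : ℕ) ∣ Q → ξ d = 0) : ξ = 0 := by
  have hNZ : NeZero Q := ⟨hQ.ne'⟩
  obtain ⟨x, h1, h2, h3⟩ := h
  funext n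
  induction n using PNat.strongInductionOn with
  | _ n ih =>
  by_cases hn : (n : ℕ) ∣ Q
  · exact h0 n hn
  have : ∃ p, Q.factorization p < (n : ℕ).factorization p := by
    by_contra hc
    push Not at hc
    exact hn ((Nat.factorization_le_iff_dvd n.ne_zero hQ.ne').1 hc)
  obtain ⟨p, hpf⟩ := this
  have hp : p.Prime := by
    by_contra hp; rw [Nat.factorization_eq_zero_of_not_prime _ hp, Nat.factorization_eq_zero_of_not_prime _ hp] at hpf; exact absurd hpf (Nat.not_lt_zero _)
  obtain ⟨m, hm⟩ := (hp.dvd_iff_one_le_factorization n.ne_zero).2 (by omega)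
  have hm0 : 0 < m := Nat.pos_of_ne_zero (by rintro rfl; simp at hm)
  obtain ⟨m', hm'⟩ : ∃ m' : ℕ+, (m' : ℕ) = m := ⟨⟨m, hm0⟩, rfl⟩
  have hd : n = ppos p hp * m' := by
    apply PNat.eq; rw [PNat.mul_coe, ppos_coe, hm']; exact hm
  obtain ⟨u, hu1, hu2⟩ := crt_aux Q p hQ hp 1 p
  have huN : u.Coprime Q := coprime_aux Q p hp (coprime_of_modEq hu1 (Nat.coprime_one_left _))
    (coprime_of_modEq hu2 (Nat.coprime_ordCompl hp hQ.ne'))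
  obtain ⟨σ, hσ⟩ := CF_aut Q u huN
  have hf : Q.factorization p ≤ (m' : ℕ).factorization p := by
    rw [hm, Nat.factorization_mul hp.ne_zero hm0.ne', Finsupp.add_apply, hp.factorization_self] at hpf
    rw [hm']; omega
  have h4 := h2 p hp u hu2 σ hσ m' hf
  have hlt : m' < n := by
    rw [← PNat.coe_lt_coe, hm', hm]
    nlinarith [hp.two_le]
  have h5 : ξ m' = 0 := ih m' hlt
  have h6 : x m' = 0 := Subtype.ext ((h1 m').trans h5)
  rw [h6, map_zero, ← hd] at h4
  rw [← h1 n, ← h4]; rfl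

theorem zN_sum (Q d : ℕ) (hQ : 0 < Q) (hd : d ∣ Q) (n : ℕ) : ∑ i ∈ Finset.range d, zN Q ^ (i * (Q / d) * n) = if d ∣ n then (d : ℂ) else 0 := by
  have hd0 : 0 < d := Nat.pos_of_dvd_of_pos hd hQ
  have e : zN d = zN Q ^ (Q / d) := by
    have := zN_pow_mul Q (Q / d) hQ (Nat.div_dvd_of_dvd hd)
    rwa [Nat.div_div_self hd hQ.ne'] at this
  have hp := zN_prim d hd0
  have : ∀ i, zN Q ^ (i * (Q / d) * n) = (zN d ^ n) ^ i := by
    intro i; rw [e, ← pow_mul, ← pow_mul]; congr 1; ring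
  simp only [this]
  split_ifs with h
  · rw [(hp.pow_eq_one_iff_dvd n).2 h]; simp
  · have h1 : zN d ^ n ≠ 1 := fun h1 => h ((hp.pow_eq_one_iff_dvd n).1 h1)
    rw [geom_sum_eq h1, ← pow_mul, mul_comm, pow_mul, hp.pow_eq_one]; simp

theorem V_lemma (Q : ℕ) (hQ : 0 < Q) (d : ℕ+) (hd : (d : ℕ) ∣ Q) {y : ℂ} (hy : y ∈ Algebra.adjoin ℤ {zN (Q / d)}) :
    ∃ θ ∈ GamQ Q, θ d = d * y ∧ ∀ n : ℕ+, ¬ d ∣ n → θ n = 0 := by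
  have hy' : y ∈ Submodule.span ℤ (Set.range fun j : ℕ => zN (Q / d) ^ j) := by
    rw [← Subalgebra.mem_toSubmodule, Algebra.adjoin_eq_span] at hy
    refine Submodule.span_mono ?_ hy
    intro z hz
    obtain ⟨j, rfl⟩ := Submonoid.mem_closure_singleton.1 hz
    exact ⟨j, rfl⟩
  clear hy
  induction hy' using Submodule.span_induction with
  | mem z hz =>
    obtain ⟨j, rfl⟩ := hz
    have key : ∀ n : ℕ+, (∑ i ∈ Finset.range d, zetaVec (((j + i * (Q / d) : ℕ) : ℚ) / Q)) n
        = zN Q ^ (j * (n : ℕ)) * (if (d : ℕ) ∣ n then (d : ℂ) else 0) := by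
      intro n
      rw [← zN_sum Q d hQ hd n, Finset.sum_apply, Finset.mul_sum]
      refine Finset.sum_congr rfl fun i _ => ?_
      rw [zeta_val Q hQ, ← pow_add]; congr 1; ring
    refine ⟨_, sum_mem fun i _ => AddSubgroup.subset_closure ⟨_, rfl⟩, (key d).trans ?_, fun n hn => (key n).trans ?_⟩
    · rw [if_pos dvd_rfl, zN_pow_mul Q d hQ hd]
      simp only [← pow_mul]; rw [mul_comm, mul_comm j]
    · rw [if_neg (fun h => hn (PNat.dvd_iff.2 h)), mul_zero]
  | zero => exact ⟨0, zero_mem _, by simp, fun _ _ => rfl⟩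
  | add a b _ _ ha hb =>
    obtain ⟨θ, h1, h2, h3⟩ := ha
    obtain ⟨θ', h1', h2', h3'⟩ := hb
    exact ⟨θ + θ', add_mem h1 h1', by rw [Pi.add_apply, h2, h2']; ring, fun n hn => by rw [Pi.add_apply, h3 n hn, h3' n hn, add_zero]⟩
  | smul k a _ ha =>
    obtain ⟨θ, h1, h2, h3⟩ := ha
    exact ⟨k • θ, AddSubgroup.zsmul_mem _ h1 k, by rw [Pi.smul_apply, h2, zsmul_eq_mul, zsmul_eq_mul]; ring,
      fun n hn => by rw [Pi.smul_apply, h3 n hn, smul_zero]⟩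

theorem fixed_mem (Q : ℕ) (hQ : 0 < Q) (d : ℕ) (hd : d ∣ Q) (y : CF Q)
    (hy : ∀ w : ℕ, w.Coprime Q → w ≡ 1 [MOD Q / d] → ∀ σ : CF Q ≃ₐ[ℚ] CF Q, σ (zC Q) = zC Q ^ w → σ y = y) :
    (y : ℂ) ∈ CF (Q / d) := by
  have hNZ : NeZero Q := ⟨hQ.ne'⟩
  let F : IntermediateField ℚ (CF Q) := IntermediateField.adjoin ℚ {zC Q ^ d}
  have hF : y ∈ F := by
    rw [← IsGalois.fixedField_fixingSubgroup F, IntermediateField.mem_fixedField_iff]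
    intro σ hσ
    obtain ⟨w, hw, hσw⟩ := CF_aut_exp Q σ
    refine hy w hw ?_ σ hσw
    have h1 : σ (zC Q ^ d) = zC Q ^ d := (IntermediateField.mem_fixingSubgroup_iff _ _).1 hσ _ (IntermediateField.mem_adjoin_simple_self ℚ _)
    rw [map_pow, hσw, ← pow_mul, zC_pow_congr_iff hQ] at h1
    nth_rewrite 2 [← one_mul d] at h1
    have := Nat.ModEq.cancel_right_div_gcd hQ h1
    rwa [Nat.gcd_eq_right hd] at this
  let v : CF Q →ₐ[ℚ] ℂ := (algebraMap (CF Q) ℂ).toRatAlgHom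
  have h2 : v y ∈ (IntermediateField.adjoin ℚ {zC Q ^ d}).map v := ⟨y, hF, rfl⟩
  rw [IntermediateField.adjoin_map, Set.image_singleton, map_pow] at h2
  rw [CF, zN_pow_mul Q d hQ hd]
  exact h2

theorem EQS_main (Q : ℕ) (hQ : 0 < Q) {ξ : ℕ+ → ℂ} (h : ξ ∈ EQS Q) (hW : ξ ∈ WR) : ξ ∈ GamQ Q := by
  have key : ∀ m : ℕ, ∃ θ ∈ GamQ Q, ∀ d : ℕ+, (d : ℕ) ∣ Q → (d : ℕ) ≤ m → (ξ - θ) d = 0 := by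
    intro m
    induction m with
    | zero => exact ⟨0, zero_mem _, fun d _ hd => absurd d.pos (by omega)⟩
    | succ m ih =>
      obtain ⟨θ, h1, h2⟩ := ih
      by_cases hm : m + 1 ∣ Q
      swap
      · refine ⟨θ, h1, fun d hd hdm => h2 d hd ?_⟩
        have : (d : ℕ) ≠ m + 1 := by intro h; rw [h] at hd; exact hm hd
        omega
      obtain ⟨e, he⟩ : ∃ e : ℕ+, (e : ℕ) = m + 1 := ⟨⟨m + 1, by omega⟩, rfl⟩
      have heQ : (e : ℕ) ∣ Q := by rw [he]; exact hm
      have hW' : ξ - θ ∈ WR := sub_mem hW (GamQ_WR Q h1)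
      have hE' : ξ - θ ∈ EQS Q := sub_mem h (GamQ_EQS Q hQ h1)
      obtain ⟨y, hyi, hy⟩ := div_lemma hW' e (fun d' hd' hne => h2 d' ((PNat.dvd_iff.1 hd').trans heQ) (by
        have := PNat.le_of_dvd hd'
        have h3 : d' < e := lt_of_le_of_ne this hne
        rw [← PNat.coe_lt_coe] at h3; omega))
      have hQe : NeZero (Q / e) := ⟨(Nat.div_pos (Nat.le_of_dvd hQ heQ) e.pos).ne'⟩
      have hyC : y ∈ CF (Q / e) := by
        obtain ⟨x, k1, k2, k3⟩ := hE'
        have := fixed_mem Q hQ e heQ (x e) (k3 e heQ)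
        rw [k1, hy] at this
        have he0 : ((e : ℕ) : ℂ) ≠ 0 := by exact_mod_cast e.ne_zero
        have h4 := mul_mem (inv_mem (natCast_mem (CF (Q / e)) (e : ℕ))) this
        rwa [inv_mul_cancel_left₀ he0] at h4
      obtain ⟨θ', g1, g2, g3⟩ := V_lemma Q hQ e heQ (CF_integral hyC hyi)
      refine ⟨θ + θ', add_mem h1 g1, fun d hd hdm => ?_⟩
      have e1 : (ξ - (θ + θ')) d = (ξ - θ) d - θ' d := by simp only [Pi.sub_apply, Pi.add_apply]; ring
      rw [e1]
      by_cases hde : d = e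
      · rw [hde, hy, g2, sub_self]
      · have hlt : (d : ℕ) < e := by
          have : (d : ℕ) ≠ e := fun h => hde (PNat.eq h)
          omega
        rw [h2 d hd (by omega), g3 d (fun hh => absurd (PNat.le_of_dvd hh) (by rw [← PNat.coe_le_coe]; omega)), sub_zero]
  obtain ⟨θ, h1, h2⟩ := key Q
  have := EQS_vanish Q hQ (sub_mem h (GamQ_EQS Q hQ h1)) (fun d hd => h2 d hd (Nat.le_of_dvd hQ hd))
  rw [sub_eq_zero] at this
  rw [this]; exact h1

theorem resH_zC {N Q D : ℕ} (hQ : 0 < Q) (hD : 0 < D) (e : Q = N * D) [NeZero N] (hle : CF N ≤ CF Q) (σ : CF Q ≃ₐ[ℚ] CF Q) (u : ℕ)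
    (hσ : σ (zC Q) = zC Q ^ u) : resH hle σ (zC N) = zC N ^ u := by
  have inj : Function.Injective (IntermediateField.inclusion hle) := (IntermediateField.inclusion hle).injective
  apply inj
  rw [resH_apply, map_pow]
  have e : IntermediateField.inclusion hle (zC N) = zC Q ^ D := by
    apply Subtype.ext
    have := zN_pow_mul Q D hQ (e ▸ dvd_mul_left _ _)
    have e2 : Q / D = N := by rw [e, Nat.mul_div_cancel _ hD]
    rw [e2] at this
    rw [SubmonoidClass.coe_pow]
    exact this
  rw [e, map_pow, hσ, ← pow_mul, ← pow_mul, mul_comm u]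

theorem E_aux {ξ : ℕ+ → ℂ} {N D Q : ℕ} {x : ℕ+ → CF N} (H : EData ξ N D x) (e : Q = N * D) : ξ ∈ EQS Q := by
  have hQ : 0 < Q := e ▸ Nat.mul_pos H.hN H.hD
  have hNZ : NeZero N := ⟨H.hN.ne'⟩
  have hNZ' : NeZero Q := ⟨hQ.ne'⟩
  have hle : CF N ≤ CF Q := CF_mono hQ (e ▸ dvd_mul_right _ _)
  refine ⟨fun n => IntermediateField.inclusion hle (x n), fun n => (IntermediateField.coe_inclusion hle (x n)).trans (H.coe n), fun p hp u hu σ hσ n hn => ?_, fun d hd w hw hw1 σ hσ => ?_⟩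
  · rw [← resH_apply, H.frob p hp u (hu.of_dvd ?_) _ (resH_zC hQ H.hD e hle σ u hσ) n (le_trans ?_ hn)]
    · exact Nat.ordCompl_dvd_ordCompl_of_dvd (e ▸ dvd_mul_right _ _) p
    · rw [e, Nat.factorization_mul H.hN.ne' H.hD.ne', Finsupp.add_apply]; omega
  · rw [← resH_apply, H.fixed d (e ▸ hd) w (hw.coprime_dvd_right (e ▸ dvd_mul_right _ _)) (e ▸ hw1) _ (resH_zC hQ H.hD e hle σ w hσ)]

theorem E_main {ξ : ℕ+ → ℂ} (h : ξ ∈ WaQ) (N : ℕ) (hN : 0 < N) (hval : ∀ n, ξ n ∈ CF N) :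
    ξ ∈ Submodule.span ℤ (Set.range zetaVec) := by
  obtain ⟨D, x, H⟩ := exists_EData h N hN hval
  exact GamQ_span _ (EQS_main _ (Nat.mul_pos hN H.hD) (E_aux H rfl) (mem_WR.2 h.1))
end PartE4

section PartC1
open scoped Real
open NumberField
open scoped Nat

/-! ### Part C1: counting ideals -/

theorem pf_ge {B p0 i p : ℕ} (hB : B = p0 !) (hp : p ∈ (1 + i * B).primeFactorsList) : p.Prime ∧ p0 ≤ p := by
  have hpp := Nat.prime_of_mem_primeFactorsList hp
  have hd := Nat.dvd_of_mem_primeFactorsList hp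
  refine ⟨hpp, ?_⟩
  by_contra h
  have h1 : p ∣ B := by rw [hB]; exact Nat.dvd_factorial hpp.pos (by omega)
  have h2 : p ∣ 1 := (Nat.dvd_add_left (h1.mul_left i)).1 hd
  exact hpp.one_lt.ne' (Nat.dvd_one.1 h2)

theorem two_primes_contra (L : Type*) [Field L] [NumberField L] (p0 : ℕ)
    (h : ∀ p : ℕ, p.Prime → p0 ≤ p → ∃ P1 P2 : Ideal (𝓞 L), P1 ≠ P2 ∧ P1.IsPrime ∧ P2.IsPrime ∧
      Ideal.absNorm P1 = p ∧ Ideal.absNorm P2 = p) : False := by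
  classical
  have h' : ∀ p : ℕ, ∃ P1 P2 : Ideal (𝓞 L), p.Prime → p0 ≤ p → (P1 ≠ P2 ∧ P1.IsPrime ∧ P2.IsPrime ∧
      Ideal.absNorm P1 = p ∧ Ideal.absNorm P2 = p) := by
    intro p
    by_cases hp : p.Prime ∧ p0 ≤ p
    · obtain ⟨P1, P2, H⟩ := h p hp.1 hp.2
      exact ⟨P1, P2, fun _ _ => H⟩
    · exact ⟨⊤, ⊤, fun h1 h2 => absurd ⟨h1, h2⟩ hp⟩
  choose P1 P2 H using h'
  obtain ⟨B, hB⟩ : ∃ B, B = p0 ! := ⟨_, rfl⟩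
  have hB0 : 0 < B := by rw [hB]; exact Nat.factorial_pos _
  let m1 : ℕ → Multiset (Ideal (𝓞 L)) := fun i => ((1 + i * B).primeFactorsList : Multiset ℕ).map P1
  let m2 : ℕ → Multiset (Ideal (𝓞 L)) := fun i => ((1 + i * B).primeFactorsList : Multiset ℕ).map P2
  let J : ℕ → ℕ → Ideal (𝓞 L) := fun i k => (m1 i + m2 k).prod
  have n1 : ∀ i, (m1 i).map Ideal.absNorm = ((1 + i * B).primeFactorsList : Multiset ℕ) := by
    intro i
    rw [Multiset.map_map]
    conv_rhs => rw [← Multiset.map_id ((1 + i * B).primeFactorsList : Multiset ℕ)]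
    refine Multiset.map_congr rfl fun p hp => ?_
    obtain ⟨a, b⟩ := pf_ge hB (Multiset.mem_coe.1 hp)
    exact (H p a b).2.2.2.1
  have n2 : ∀ i, (m2 i).map Ideal.absNorm = ((1 + i * B).primeFactorsList : Multiset ℕ) := by
    intro i
    rw [Multiset.map_map]
    conv_rhs => rw [← Multiset.map_id ((1 + i * B).primeFactorsList : Multiset ℕ)]
    refine Multiset.map_congr rfl fun p hp => ?_
    obtain ⟨a, b⟩ := pf_ge hB (Multiset.mem_coe.1 hp)
    exact (H p a b).2.2.2.2
  have hpr : ∀ i k, ∀ Q ∈ m1 i + m2 k, Prime Q := by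
    intro i k Q hQ
    have key : ∃ p, p.Prime ∧ p0 ≤ p ∧ (Q = P1 p ∨ Q = P2 p) := by
      rcases Multiset.mem_add.1 hQ with hQ | hQ
      · obtain ⟨p, hp, rfl⟩ := Multiset.mem_map.1 hQ
        obtain ⟨a, b⟩ := pf_ge hB (Multiset.mem_coe.1 hp)
        exact ⟨p, a, b, Or.inl rfl⟩
      · obtain ⟨p, hp, rfl⟩ := Multiset.mem_map.1 hQ
        obtain ⟨a, b⟩ := pf_ge hB (Multiset.mem_coe.1 hp)
        exact ⟨p, a, b, Or.inr rfl⟩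
    obtain ⟨p, hp, hp0, hc⟩ := key
    obtain ⟨-, q1, q2, q3, q4⟩ := H p hp hp0
    rcases hc with rfl | rfl
    · refine Ideal.prime_of_isPrime ?_ q1
      intro h0; rw [h0, Ideal.absNorm_bot] at q3; exact hp.ne_zero q3.symm
    · refine Ideal.prime_of_isPrime ?_ q2
      intro h0; rw [h0, Ideal.absNorm_bot] at q4; exact hp.ne_zero q4.symm
  have hnorm : ∀ i k, Ideal.absNorm (J i k) = (1 + i * B) * (1 + k * B) := by
    intro i k
    change Ideal.absNorm (m1 i + m2 k).prod = _
    rw [map_multiset_prod, Multiset.map_add, n1, n2, Multiset.prod_add, Multiset.prod_coe, Multiset.prod_coe,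
      Nat.prod_primeFactorsList (by omega), Nat.prod_primeFactorsList (by omega)]
  have hinj : ∀ i k i' k', J i k = J i' k' → i = i' ∧ k = k' := by
    intro i k i' k' he
    have h1 : m1 i + m2 k = m1 i' + m2 k' := by
      rw [← UniqueFactorizationMonoid.normalizedFactors_prod_of_prime (hpr i k),
        ← UniqueFactorizationMonoid.normalizedFactors_prod_of_prime (hpr i' k')]
      exact congrArg _ he
    have f1 : ∀ i k, (m1 i + m2 k).filter (fun I => I = P1 (Ideal.absNorm I)) = m1 i := by
      intro i k
      rw [Multiset.filter_add, Multiset.filter_eq_self.2, Multiset.filter_eq_nil.2, add_zero]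
      · intro Q hQ hQ'
        obtain ⟨p, hp, rfl⟩ := Multiset.mem_map.1 hQ
        obtain ⟨a, b⟩ := pf_ge hB (Multiset.mem_coe.1 hp)
        rw [(H p a b).2.2.2.2] at hQ'
        exact (H p a b).1 hQ'.symm
      · intro Q hQ
        obtain ⟨p, hp, rfl⟩ := Multiset.mem_map.1 hQ
        obtain ⟨a, b⟩ := pf_ge hB (Multiset.mem_coe.1 hp)
        rw [(H p a b).2.2.2.1]
    have h2 : m1 i = m1 i' := by rw [← f1 i k, h1, f1]
    have h3 : m2 k = m2 k' := by rw [h2] at h1; exact add_left_cancel h1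
    have h4 := congrArg (fun m => (m.map Ideal.absNorm).prod) h2
    have h5 := congrArg (fun m => (m.map Ideal.absNorm).prod) h3
    simp only [n1, n2, Multiset.prod_coe] at h4 h5
    rw [Nat.prod_primeFactorsList (by omega), Nat.prod_primeFactorsList (by omega)] at h4 h5
    exact ⟨Nat.eq_of_mul_eq_mul_right hB0 (by omega), Nat.eq_of_mul_eq_mul_right hB0 (by omega)⟩
  have hT := NumberField.Ideal.tendsto_norm_le_div_atTop L
  set κ := ((2 ^ InfinitePlace.nrRealPlaces L * (2 * π) ^ InfinitePlace.nrComplexPlaces L * Units.regulator L * classNumber L) /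
        (Units.torsionOrder L * Real.sqrt |discr L|)) with hκ
  have key : ∀ M : ℕ, (∑ i ∈ Finset.range M, (1 : ℝ) / (1 + i * B)) / B ≤ κ := by
    intro M
    let Pi : ℕ := ∏ i ∈ Finset.range M, (1 + i * B)
    have hPi : 0 < Pi := Finset.prod_pos fun i _ => by omega
    let c : ℕ → ℕ := fun i => Pi / (1 + i * B)
    have hc : ∀ i ∈ Finset.range M, (1 + i * B) * c i = Pi := fun i hi =>
      Nat.mul_div_cancel' (Finset.dvd_prod_of_mem (fun i => 1 + i * B) hi)
    have hcount : ∀ R : ℕ, ∑ i ∈ Finset.range M, R * c i ≤ Nat.card {I : Ideal (𝓞 L) // (Ideal.absNorm I : ℝ) ≤ ((R * B * Pi : ℕ) : ℝ)} := by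
      intro R
      have hfin : Finite {I : Ideal (𝓞 L) // (Ideal.absNorm I : ℝ) ≤ ((R * B * Pi : ℕ) : ℝ)} := by
        have := Ideal.finite_setOfPred_absNorm_le (S := 𝓞 L) (R * B * Pi)
        refine (this.subset ?_).to_subtype
        intro I hI
        have hI' : (Ideal.absNorm I : ℝ) ≤ ((R * B * Pi : ℕ) : ℝ) := hI
        exact Nat.cast_le.1 hI'
      let F : Finset (Σ _ : ℕ, ℕ) := (Finset.range M).sigma fun i => Finset.range (R * c i)
      have hF : F.card = ∑ i ∈ Finset.range M, R * c i := by
        rw [Finset.card_sigma]; simp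
      rw [← hF, ← Set.ncard_coe_finset F, ← Nat.card_coe_set_eq]
      refine Nat.card_le_card_of_injective (fun q : (F : Set (Σ _ : ℕ, ℕ)) => ⟨J q.1.1 q.1.2, ?_⟩) ?_
      · obtain ⟨⟨i, k⟩, hq⟩ := q
        have hq' := Finset.mem_sigma.1 (Finset.mem_coe.1 hq)
        have hk := Finset.mem_range.1 hq'.2
        rw [hnorm]
        have h1 := hc i hq'.1
        simp only at hk h1 ⊢
        have h2 : 1 + k * B ≤ R * c i * B := by nlinarith
        have h3 : (1 + i * B) * (1 + k * B) ≤ R * B * Pi := by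
          calc _ ≤ (1 + i * B) * (R * c i * B) := Nat.mul_le_mul_left _ h2
            _ = R * B * ((1 + i * B) * c i) := by ring
            _ = _ := by rw [h1]
        exact_mod_cast h3
      · rintro ⟨⟨i, k⟩, hq⟩ ⟨⟨i', k'⟩, hq'⟩ he
        obtain ⟨rfl, rfl⟩ := hinj _ _ _ _ (congrArg Subtype.val he)
        rfl
    have hseq : Filter.Tendsto (fun R : ℕ => (((R + 1) * B * Pi : ℕ) : ℝ)) Filter.atTop Filter.atTop := by
      refine tendsto_natCast_atTop_atTop.comp ?_
      refine Filter.tendsto_atTop_mono (fun n => ?_) Filter.tendsto_id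
      have : 0 < B * Pi := Nat.mul_pos hB0 hPi
      simp only [id]
      nlinarith
    refine ge_of_tendsto' (hT.comp hseq) fun R => ?_
    simp only [Function.comp]
    have h1 := hcount (R + 1)
    have hpos : (0 : ℝ) < (((R + 1) * B * Pi : ℕ) : ℝ) := by
      have := Nat.mul_pos (Nat.mul_pos (Nat.succ_pos R) hB0) hPi
      exact_mod_cast this
    rw [le_div_iff₀ hpos]
    refine le_trans (le_of_eq ?_) (Nat.cast_le.2 h1)
    push_cast
    rw [div_mul_eq_mul_div, div_eq_iff (by exact_mod_cast hB0.ne'), Finset.sum_mul, Finset.sum_mul]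
    refine Finset.sum_congr rfl fun i hi => ?_
    have h2 : ((1 + i * B : ℝ)) * c i = Pi := by exact_mod_cast hc i hi
    rw [← h2]
    have : (1 + i * B : ℝ) ≠ 0 := by positivity
    field_simp
  have hdiv := Real.tendsto_sum_range_one_div_nat_succ_atTop
  obtain ⟨M, hM⟩ := (hdiv.eventually_gt_atTop (κ * B * B)).exists
  have h1 := key M
  have hBr : (1 : ℝ) ≤ B := by exact_mod_cast hB0
  rw [div_le_iff₀ (by linarith)] at h1
  have h2 : ∑ i ∈ Finset.range M, (1 : ℝ) / (i + 1) ≤ (∑ i ∈ Finset.range M, (1 : ℝ) / (1 + i * B)) * B := by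
    rw [Finset.sum_mul]
    refine Finset.sum_le_sum fun i _ => ?_
    rw [div_mul_eq_mul_div, one_mul, div_le_div_iff₀ (by positivity) (by positivity)]
    nlinarith [(Nat.cast_nonneg i : (0 : ℝ) ≤ i)]
  have h3 := mul_le_mul_of_nonneg_right h1 (by linarith : (0 : ℝ) ≤ B)
  linarith
end PartC1

section PartC2
open scoped Real
open NumberField
open Polynomial in
theorem exists_nat_of_pow {R : Type*} [CommRing R] {p : ℕ} (hp : p.Prime) (P : Ideal R) [hP : P.IsPrime] (hpP : (p : R) ∈ P)
    {c : R} (hc : c ^ p - c ∈ P) : ∃ j : ℕ, c - j ∈ P := by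
  classical
  have hf : Fact p.Prime := ⟨hp⟩
  have h0 : ((p : ℕ) : R ⧸ P) = 0 := by
    have := Ideal.Quotient.eq_zero_iff_mem.2 hpP
    rwa [map_natCast] at this
  have hch : CharP (R ⧸ P) p := by
    have := CharP.exists (R ⧸ P)
    obtain ⟨q, hq⟩ := this
    have h1 : q ∣ p := (CharP.cast_eq_zero_iff _ q p).1 h0
    rcases (Nat.dvd_prime hp).1 h1 with h2 | h2
    · subst h2; exact absurd rfl (CharP.char_ne_one (R ⧸ P) 1)
    · rwa [h2] at hq
  let f : ZMod p →+* R ⧸ P := ZMod.castHom dvd_rfl (R ⧸ P)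
  have hfi : Function.Injective f := f.injective
  let F : (R ⧸ P)[X] := X ^ p - X
  have hF0 : F ≠ 0 := by
    intro h
    have : (X ^ p : (R ⧸ P)[X]) = X := sub_eq_zero.1 h
    have h2 := congrArg natDegree this
    rw [natDegree_X_pow, natDegree_X] at h2
    exact hp.one_lt.ne' h2
  have hdeg : F.natDegree ≤ p := by
    refine (natDegree_sub_le _ _).trans ?_
    rw [natDegree_X_pow, natDegree_X]; exact max_le le_rfl hp.one_lt.le
  have hsub : Finset.univ.image f ⊆ F.roots.toFinset := by
    intro z hz
    obtain ⟨j, -, rfl⟩ := Finset.mem_image.1 hz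
    rw [Multiset.mem_toFinset, mem_roots hF0, IsRoot.def]
    simp only [F, eval_sub, eval_pow, eval_X]
    rw [← map_pow, ZMod.pow_card, sub_self]
  have heq := Finset.eq_of_subset_of_card_le hsub (by
    rw [Finset.card_image_of_injective _ hfi, Finset.card_univ, ZMod.card]
    exact (Multiset.toFinset_card_le _).trans ((card_roots' F).trans hdeg))
  have hmem : Ideal.Quotient.mk P c ∈ F.roots.toFinset := by
    rw [Multiset.mem_toFinset, mem_roots hF0, IsRoot.def]
    simp only [F, eval_sub, eval_pow, eval_X]
    rw [← map_pow, ← map_sub]; exact Ideal.Quotient.eq_zero_iff_mem.2 hc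
  rw [← heq] at hmem
  obtain ⟨j, -, hj⟩ := Finset.mem_image.1 hmem
  refine ⟨j.val, ?_⟩
  rw [← Ideal.Quotient.eq_zero_iff_mem, map_sub, map_natCast, ← hj]
  have : ((j.val : ℕ) : ZMod p) = j := ZMod.natCast_zmod_val j
  have e := congrArg f this
  rw [map_natCast] at e
  rw [← e, sub_self]

theorem absNorm_of_pow {L : Type*} [Field L] [NumberField L] {p : ℕ} (hp : p.Prime) (P : Ideal (𝓞 L)) [hP : P.IsPrime] (hpP : (p : 𝓞 L) ∈ P)
    (hc : ∀ c : 𝓞 L, c ^ p - c ∈ P) : Ideal.absNorm P = p := by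
  have hf : Fact p.Prime := ⟨hp⟩
  have h0 : ((p : ℕ) : 𝓞 L ⧸ P) = 0 := by
    have := Ideal.Quotient.eq_zero_iff_mem.2 hpP
    rwa [map_natCast] at this
  have hch : CharP (𝓞 L ⧸ P) p := by
    have := CharP.exists (𝓞 L ⧸ P)
    obtain ⟨q, hq⟩ := this
    have h1 : q ∣ p := (CharP.cast_eq_zero_iff _ q p).1 h0
    rcases (Nat.dvd_prime hp).1 h1 with h2 | h2
    · subst h2; exact absurd rfl (CharP.char_ne_one (𝓞 L ⧸ P) 1)
    · rwa [h2] at hq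
  let f : ZMod p →+* 𝓞 L ⧸ P := ZMod.castHom dvd_rfl (𝓞 L ⧸ P)
  have hs : Function.Surjective f := by
    intro z
    obtain ⟨c, rfl⟩ := Ideal.Quotient.mk_surjective z
    obtain ⟨j, hj⟩ := exists_nat_of_pow hp P hpP (hc c)
    refine ⟨j, ?_⟩
    rw [map_natCast, eq_comm, ← sub_eq_zero, ← map_natCast (Ideal.Quotient.mk P), ← map_sub]
    exact Ideal.Quotient.eq_zero_iff_mem.2 hj
  rw [Ideal.absNorm_apply, Submodule.cardQuot_apply, ← Nat.card_eq_of_bijective f ⟨f.injective, hs⟩, Nat.card_zmod]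

theorem abelian_of_central (K : IntermediateField ℚ ℂ) [FiniteDimensional ℚ K] [IsGalois ℚ K] (p0 : ℕ)
    (h : ∀ p : ℕ, p.Prime → p0 ≤ p → ∀ P : Ideal (𝓞 K), P.IsPrime → (p : 𝓞 K) ∈ P → ∀ φ : K ≃ₐ[ℚ] K, Frob p P φ →
      φ ∈ Subgroup.center (K ≃ₐ[ℚ] K)) : ∀ σ τ : K ≃ₐ[ℚ] K, σ * τ = τ * σ := by
  have hNF : NumberField K := { to_charZero := inferInstance, to_finiteDimensional := inferInstance }
  by_contra hne
  push Not at hne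
  obtain ⟨τ, g, hg⟩ := hne
  have hgZ : g ∉ Subgroup.center (K ≃ₐ[ℚ] K) := fun hc => hg (Subgroup.mem_center_iff.1 hc τ)
  let L : IntermediateField ℚ K := IntermediateField.fixedField (Subgroup.center (K ≃ₐ[ℚ] K))
  have hLF : NumberField L := { to_charZero := inferInstance, to_finiteDimensional := inferInstance }
  have hfix : ∀ φ ∈ Subgroup.center (K ≃ₐ[ℚ] K), ∀ x : L, φ (x : K) = x := fun φ hφ x =>
    (IntermediateField.mem_fixedField_iff _ _).1 x.2 φ hφ
  have hx : ∃ x : L, g (x : K) ≠ x := by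
    by_contra hc
    push Not at hc
    apply hgZ
    rw [← IntermediateField.fixingSubgroup_fixedField (Subgroup.center (K ≃ₐ[ℚ] K)), IntermediateField.mem_fixingSubgroup_iff]
    exact fun x hx => hc ⟨x, hx⟩
  obtain ⟨x, hx⟩ := hx
  obtain ⟨n, hn, hi⟩ : ∃ n : ℤ, n ≠ 0 ∧ IsIntegral ℤ (n • x) := by
    have hal : IsAlgebraic ℤ x := (IsFractionRing.isAlgebraic_iff ℤ ℚ L).2 (Algebra.IsAlgebraic.isAlgebraic x)
    obtain ⟨n, hn, hi⟩ := hal.exists_integral_multiple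
    exact ⟨n, hn, hi⟩
  let y : 𝓞 L := ⟨n • x, hi⟩
  let ι : 𝓞 L →+* 𝓞 K := algebraMap (𝓞 L) (𝓞 K)
  have hι : ∀ z : 𝓞 L, ((ι z : 𝓞 K) : K) = ((z : L) : K) := fun z => rfl
  have hsm : ∀ (σ : K ≃ₐ[ℚ] K) (z : 𝓞 K), ((σ • z : 𝓞 K) : K) = σ (z : K) := fun σ z => rfl
  let δ : 𝓞 K := g • ι y - ι y
  have hδ : δ ≠ 0 := by
    intro h0
    have h1 : g • ι y = ι y := sub_eq_zero.1 h0
    have h2 : g ((ι y : 𝓞 K) : K) = ((ι y : 𝓞 K) : K) := by rw [← hsm, h1]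
    have h3 : ((ι y : 𝓞 K) : K) = n • (x : K) := rfl
    rw [h3, map_zsmul] at h2
    exact hx (smul_right_injective K hn h2)
  have hgfix : ∀ (φ : K ≃ₐ[ℚ] K), φ ∈ Subgroup.center (K ≃ₐ[ℚ] K) → ∀ z : 𝓞 L, φ • (ι z) = ι z := by
    intro φ hφ z
    apply RingOfIntegers.ext
    rw [hsm]; exact hfix φ hφ z
  refine two_primes_contra L (max p0 (Ideal.absNorm (Ideal.span {δ}) + 1)) ?_
  intro p hp hpge
  obtain ⟨P, hP, hpP⟩ := exists_prime_over K p hp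
  have hδP : δ ∉ P := by
    intro hh
    have h1 := pow_dvd_absNorm p hp P hP.ne_top hpP δ 1 (by rwa [pow_one])
    rw [pow_one] at h1
    have h2 : Ideal.absNorm (Ideal.span {δ}) ≠ 0 := by
      rw [Ne, Ideal.absNorm_eq_zero_iff, Ideal.span_singleton_eq_bot]; exact hδ
    have h3 := Nat.le_of_dvd (Nat.pos_of_ne_zero h2) h1
    have := le_trans (le_max_right _ _) hpge
    omega
  obtain ⟨φ, hφ⟩ := exists_frob K p hp P hpP
  have hφZ := h p hp (le_trans (le_max_left _ _) hpge) P hP hpP φ hφ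
  let f2 : 𝓞 L →+* 𝓞 K := (MulSemiringAction.toRingHom (K ≃ₐ[ℚ] K) (𝓞 K) g).comp ι
  have hf2 : ∀ z, f2 z = g • ι z := fun z => rfl
  have k1 : ∀ c : 𝓞 L, c ^ p - c ∈ P.comap ι := by
    intro c
    rw [Ideal.mem_comap, map_sub, map_pow]
    have := hφ (ι c)
    rw [hgfix φ hφZ] at this
    rw [← neg_sub]; exact neg_mem this
  have k2 : ∀ c : 𝓞 L, c ^ p - c ∈ P.comap f2 := by
    intro c
    rw [Ideal.mem_comap, map_sub, map_pow, hf2]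
    have := hφ (g • ι c)
    have hcomm : φ * g = g * φ := (Subgroup.mem_center_iff.1 hφZ g).symm
    rw [← mul_smul, hcomm, mul_smul, hgfix φ hφZ] at this
    rw [← neg_sub]; exact neg_mem this
  have m1 : ((p : ℕ) : 𝓞 L) ∈ P.comap ι := by rw [Ideal.mem_comap, map_natCast]; exact hpP
  have m2 : ((p : ℕ) : 𝓞 L) ∈ P.comap f2 := by rw [Ideal.mem_comap, map_natCast]; exact hpP
  have i1 : (P.comap ι).IsPrime := Ideal.IsPrime.comap ι
  have i2 : (P.comap f2).IsPrime := Ideal.IsPrime.comap f2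
  refine ⟨P.comap ι, P.comap f2, ?_, i1, i2, absNorm_of_pow hp _ m1 k1, absNorm_of_pow hp _ m2 k2⟩
  intro heq
  obtain ⟨j, hj⟩ := exists_nat_of_pow hp _ m1 (k1 y)
  have hj2 := hj
  rw [heq] at hj2
  rw [Ideal.mem_comap, map_sub, map_natCast] at hj hj2
  apply hδP
  have := sub_mem hj2 hj
  rw [sub_sub_sub_cancel_right] at this
  exact this
end PartC2

section PartC3
open scoped Real
open NumberField

theorem exists_splitting (S : Set ℂ) (hS : S.Finite) (hi : ∀ s ∈ S, IsIntegral ℚ s) :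
    ∃ K : IntermediateField ℚ ℂ, FiniteDimensional ℚ K ∧ IsGalois ℚ K ∧ (∀ s ∈ S, s ∈ K) ∧
     ∀ c : K ≃ₐ[ℚ] K, (∀ k : K ≃ₐ[ℚ] K, ∀ s : K, (s : ℂ) ∈ S → c (k s) = k s) → c = 1 := by
  classical
  let f : Polynomial ℚ := ∏ s ∈ hS.toFinset, minpoly ℚ s
  have hf0 : f ≠ 0 := Finset.prod_ne_zero_iff.2 fun s hs => minpoly.ne_zero (hi s (hS.mem_toFinset.1 hs))
  let K : IntermediateField ℚ ℂ := IntermediateField.adjoin ℚ (f.rootSet ℂ)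
  have hspl : f.IsSplittingField ℚ K :=
    IntermediateField.adjoin_rootSet_isSplittingField (IsAlgClosed.splits _)
  have hN : Normal ℚ K := Normal.of_isSplittingField f
  have hfd : FiniteDimensional ℚ K := Polynomial.IsSplittingField.finiteDimensional K f
  have hG : IsGalois ℚ K := { }
  have hSK : ∀ s ∈ S, s ∈ f.rootSet ℂ := by
    intro s hs
    rw [Polynomial.mem_rootSet]
    refine ⟨hf0, ?_⟩
    simp only [f, map_prod]
    exact Finset.prod_eq_zero (hS.mem_toFinset.2 hs) (minpoly.aeval _ _)
  refine ⟨K, hfd, hG, fun s hs => IntermediateField.subset_adjoin _ _ (hSK s hs), fun c hc => ?_⟩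
  have hh : (c : K →ₐ[ℚ] K) = ((1 : K ≃ₐ[ℚ] K) : K →ₐ[ℚ] K) := by
    refine IntermediateField.algHom_ext_of_eq_adjoin ℚ (S := K) (s := f.rootSet ℂ) rfl ?_
    rintro x hx
    have hx' := (Polynomial.mem_rootSet.1 hx).2
    simp only [f, map_prod] at hx'
    obtain ⟨s, hs, hs0⟩ := Finset.prod_eq_zero_iff.1 hx'
    rw [hS.mem_toFinset] at hs
    have hsK : s ∈ K := IntermediateField.subset_adjoin _ _ (hSK s hs)
    have hxK : x ∈ K := IntermediateField.subset_adjoin _ _ hx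
    let v : K →ₐ[ℚ] ℂ := (algebraMap K ℂ).toRatAlgHom
    have e1 : minpoly ℚ (⟨s, hsK⟩ : K) = minpoly ℚ s := (minpoly.algHom_eq v v.injective ⟨s, hsK⟩).symm
    have e2 : minpoly ℚ (⟨x, hxK⟩ : K) = minpoly ℚ x := (minpoly.algHom_eq v v.injective ⟨x, hxK⟩).symm
    have e3 : minpoly ℚ s = minpoly ℚ x := minpoly.eq_of_irreducible_of_monic (minpoly.irreducible (hi s hs)) hs0 (minpoly.monic (hi s hs))
    have e4 : minpoly ℚ (⟨x, hxK⟩ : K) = minpoly ℚ (⟨s, hsK⟩ : K) := by rw [e1, e2, e3]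
    obtain ⟨k, hk⟩ := (Normal.minpoly_eq_iff_mem_orbit K).1 e4
    have := hc k ⟨s, hsK⟩ hs
    have hk' : k ⟨s, hsK⟩ = (⟨x, hxK⟩ : K) := hk
    rw [hk'] at this
    exact this
  ext x
  exact congrArg _ (DFunLike.congr_fun hh x)

theorem C_main {ξ : ℕ+ → ℂ} (h : ξ ∈ WaQ) : ∃ K : IntermediateField ℚ ℂ, FiniteDimensional ℚ K ∧ IsGalois ℚ K ∧
    (∀ σ τ : K ≃ₐ[ℚ] K, σ * τ = τ * σ) ∧ ∀ n, ξ n ∈ K := by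
  have hint : ∀ n, IsIntegral ℤ (ξ n) := fun n => WR_int (mem_WR.2 h.1) n
  obtain ⟨K, hfd, hG, hS, hK⟩ := exists_splitting (Set.range ξ) (WaQ_finite h) (by
    rintro _ ⟨n, rfl⟩; exact (hint n).tower_top)
  refine ⟨K, hfd, hG, ?_, fun n => hS _ ⟨n, rfl⟩⟩
  choose x hx using fun n => exists_ringInt (hS _ ⟨n, rfl⟩) (hint n)
  obtain ⟨D, hD, H⟩ := frob_exact K h x hx
  have hcop : ∀ p : ℕ, p.Prime → D + 1 ≤ p → D.factorization p = 0 := fun p hp hpD =>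
    Nat.factorization_eq_zero_of_not_dvd (fun hd => absurd (Nat.le_of_dvd hD hd) (by omega))
  refine abelian_of_central K (D + 1) ?_
  intro p hp hpD P hP hpP φ hφ
  have hconj : ∀ (g : K ≃ₐ[ℚ] K) (n : ℕ+), (g * φ * g⁻¹) (x n : K) = x (ppos p hp * n) := by
    intro g n
    have h1 := H p hp _ ?_ ?_ _ (hφ.conj g) 0 (hcop p hp hpD).le n
    · rw [pow_zero, one_mul, zero_add, pow_one] at h1
      exact congrArg (algebraMap (𝓞 K) K) h1
    · exact (Ideal.IsPrime.comap _).ne_top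
    · rw [Ideal.mem_comap, map_natCast]; exact hpP
  rw [Subgroup.mem_center_iff]
  intro g
  have : φ⁻¹ * (g * φ * g⁻¹) = 1 := by
    refine hK _ fun k s hs => ?_
    obtain ⟨n, hn⟩ := hs
    have e : s = x n := Subtype.ext (by rw [hx]; exact hn.symm)
    have h1 := hconj k⁻¹ n
    have h2 := hconj (k⁻¹ * g) n
    rw [← h1, ← e] at h2
    have h3 := congrArg k h2
    simp only [← AlgEquiv.mul_apply] at h3 ⊢
    have e1 : k * (k⁻¹ * g * φ * (k⁻¹ * g)⁻¹) = g * φ * g⁻¹ * k := by group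
    have e2 : k * (k⁻¹ * φ * k⁻¹⁻¹) = φ * k := by group
    rw [e1, e2] at h3
    rw [mul_assoc φ⁻¹, AlgEquiv.mul_apply, h3, ← AlgEquiv.mul_apply, inv_mul_cancel_left]
  have h2 : g * φ * g⁻¹ = φ := by
    rw [inv_mul_eq_one] at this; exact this.symm
  rw [mul_inv_eq_iff_eq_mul] at h2
  exact h2
end PartC3

section PartD1
open scoped Real
open NumberField

set_option linter.all false
set_option linter.unusedSectionVars false
section D1
variable {E : Type*} [Field E] [CharZero E] {Γ : Type*} [LinearOrderedCommGroupWithZero Γ]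

lemma mltl {a b : Γ} (ha : a < 1) (hb : b ≤ 1) : a * b < 1 := (mul_le_of_le_one_right' hb).trans_lt ha
lemma mllt {a b : Γ} (ha : a ≤ 1) (hb : b < 1) : a * b < 1 := (mul_le_of_le_one_left' ha).trans_lt hb

structure Cg (v : Valuation E Γ) (x y : E) : Prop where
  l : v x ≤ 1
  r : v y ≤ 1
  s : v (x - y) < 1

namespace Cg
variable {v : Valuation E Γ} {x y z w : E}
lemma refl' (h : v x ≤ 1) : Cg v x x := ⟨h, h, by simp⟩
lemma symm' (h : Cg v x y) : Cg v y x := ⟨h.r, h.l, by rw [Valuation.map_sub_swap]; exact h.s⟩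
lemma trans' (h : Cg v x y) (h' : Cg v y z) : Cg v x z :=
  ⟨h.l, h'.r, by
    have := v.map_add_lt h.s h'.s
    rwa [sub_add_sub_cancel] at this⟩
lemma add' (h : Cg v x y) (h' : Cg v z w) : Cg v (x + z) (y + w) :=
  ⟨v.map_add_le h.l h'.l, v.map_add_le h.r h'.r, by
    have := v.map_add_lt h.s h'.s
    rwa [show x - y + (z - w) = x + z - (y + w) by ring] at this⟩
lemma mul' (h : Cg v x y) (h' : Cg v z w) : Cg v (x * z) (y * w) :=
  ⟨by rw [map_mul]; exact mul_le_one' h.l h'.l, by rw [map_mul]; exact mul_le_one' h.r h'.r, by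
    rw [show x * z - y * w = (x - y) * z + y * (z - w) by ring]
    apply v.map_add_lt
    · rw [map_mul]; exact mltl h.s h'.l
    · rw [map_mul]; exact mllt h.r h'.s⟩
lemma neg' (h : Cg v x y) : Cg v (-x) (-y) :=
  ⟨by rw [Valuation.map_neg]; exact h.l, by rw [Valuation.map_neg]; exact h.r, by
    rw [show -x - -y = -(x - y) by ring, Valuation.map_neg]; exact h.s⟩
lemma sub' (h : Cg v x y) (h' : Cg v z w) : Cg v (x - z) (y - w) := by
  rw [sub_eq_add_neg, sub_eq_add_neg]; exact h.add' h'.neg'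
lemma pow' (h : Cg v x y) (n : ℕ) : Cg v (x ^ n) (y ^ n) := by
  induction n with
  | zero => simpa using refl' (v := v) (x := 1) (by simp)
  | succ n ih => rw [pow_succ, pow_succ]; exact ih.mul' h
lemma sum' {ι : Type*} (s : Finset ι) {f g : ι → E} (h : ∀ i ∈ s, Cg v (f i) (g i)) :
    Cg v (∑ i ∈ s, f i) (∑ i ∈ s, g i) := by
  classical
  induction s using Finset.induction_on with
  | empty => simpa using refl' (v := v) (x := 0) (by simp)
  | insert a s ha ih =>
    rw [Finset.sum_insert ha, Finset.sum_insert ha]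
    exact (h a (by simp)).add' (ih fun i hi => h i (by simp [hi]))
lemma veq (h : Cg v x y) (hy : v y = 1) : v x = 1 := by
  have := Valuation.map_add_eq_of_lt_right v (x := x - y) (y := y) (by rw [hy]; exact h.s)
  rw [sub_add_cancel, hy] at this; exact this
lemma zero_iff : Cg v x 0 ↔ v x < 1 :=
  ⟨fun h => by simpa using h.s, fun h => ⟨h.le, by simp, by simpa using h⟩⟩
lemma of_sub (h : v (x - y) < 1) (hy : v y ≤ 1) : Cg v x y :=
  ⟨by have := v.map_add_le h.le hy; rwa [sub_add_cancel] at this, hy, h⟩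
lemma cancel (hw : v w = 1) (h : Cg v (w * x) (w * y)) (hx : v x ≤ 1) (hy : v y ≤ 1) : Cg v x y :=
  ⟨hx, hy, by have := h.s; rwa [← mul_sub, map_mul, hw, one_mul] at this⟩
lemma inv' (h : Cg v x y) (hy : v y = 1) : Cg v x⁻¹ y⁻¹ := by
  have hx := h.veq hy
  have hx0 : x ≠ 0 := by rintro rfl; simp at hx
  have hy0 : y ≠ 0 := by rintro rfl; simp at hy
  refine ⟨by simp [hx], by simp [hy], ?_⟩
  rw [show x⁻¹ - y⁻¹ = -((x - y) * (x⁻¹ * y⁻¹)) by field_simp; ring, Valuation.map_neg, map_mul, map_mul]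
  simp only [map_inv₀, hx, hy]; simpa using h.s
end Cg

structure LD (v : Valuation E Γ) (p : ℕ) (ϖ : E) (I : Subgroup (E ≃ₐ[ℚ] E)) (φ : E ≃ₐ[ℚ] E) : Prop where
  hp : p.Prime
  comm : ∀ σ τ : E ≃ₐ[ℚ] E, σ * τ = τ * σ
  ford : ∃ f : ℕ, 0 < f ∧ φ ^ f = 1
  hI : ∀ σ ∈ I, ∀ x, v x ≤ 1 → v (σ x - x) < 1
  hIv : ∀ σ ∈ I, ∀ x, v (σ x) = v x
  hφv : ∀ x, v (φ x) = v x
  hφ : ∀ x, v x ≤ 1 → v (φ x - x ^ p) < 1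
  hU : ∀ y, y ≠ 0 → (∀ σ ∈ I, σ y = y) → ∃ n : ℤ, v y = v (p : E) ^ n
  ϖ0 : ϖ ≠ 0
  ϖ1 : v ϖ < 1
  hϖ : ∀ x, x ≠ 0 → ∃ n : ℤ, v x = v ϖ ^ n
  vp : v (p : E) < 1

lemma v_nat_le (v : Valuation E Γ) (n : ℕ) : v (n : E) ≤ 1 := by
  induction n with
  | zero => simp
  | succ n ih => push_cast; exact v.map_add_le ih (by simp)
lemma v_int_le (v : Valuation E Γ) (n : ℤ) : v (n : E) ≤ 1 := by
  rcases Int.eq_nat_or_neg n with ⟨m, rfl | rfl⟩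
  · simpa using v_nat_le v m
  · simpa [Valuation.map_neg] using v_nat_le v m

variable {v : Valuation E Γ} {p : ℕ} {ϖ : E} {I : Subgroup (E ≃ₐ[ℚ] E)} {φ : E ≃ₐ[ℚ] E}

namespace LD
lemma p0 (h : LD v p ϖ I φ) : (p : E) ≠ 0 := by exact_mod_cast h.hp.ne_zero
lemma int_lt (h : LD v p ϖ I φ) (n : ℤ) : v (n : E) < 1 ↔ (p : ℤ) ∣ n := by
  constructor
  · intro hn
    by_contra hc
    have hco : IsCoprime (p : ℤ) n := (Nat.prime_iff_prime_int.mp h.hp).coprime_iff_not_dvd.mpr hc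
    obtain ⟨a, b, hab⟩ := hco
    have h1 : v ((a : E) * p + b * n) < 1 := by
      apply v.map_add_lt
      · rw [map_mul]; exact mllt (v_int_le v a) h.vp
      · rw [map_mul]; exact mllt (v_int_le v b) hn
    have : (a : E) * p + b * n = 1 := by exact_mod_cast congrArg (Int.cast : ℤ → E) hab
    rw [this] at h1; simp at h1
  · rintro ⟨c, rfl⟩
    push_cast; rw [map_mul]
    exact mltl h.vp (v_int_le v c)
lemma nat_one (h : LD v p ϖ I φ) {n : ℕ} (hn : ¬ p ∣ n) : v (n : E) = 1 := by
  refine le_antisymm (v_nat_le v n) (not_lt.mp fun hc => hn ?_)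
  have := (h.int_lt n).mp (by exact_mod_cast hc)
  exact_mod_cast this
lemma nat_cg (h : LD v p ϖ I φ) (m n : ℕ) : Cg v (m : E) n ↔ (m : ZMod p) = n := by
  have : (m : ZMod p) = n ↔ (p : ℤ) ∣ (m : ℤ) - n := by
    rw [← ZMod.intCast_zmod_eq_zero_iff_dvd _ p] 
    push_cast; rw [sub_eq_zero]
  rw [this, ← h.int_lt]
  push_cast
  exact ⟨fun h => h.s, fun h => ⟨v_nat_le v m, v_nat_le v n, h⟩⟩
lemma Icg (h : LD v p ϖ I φ) {σ} (hσ : σ ∈ I) {x : E} (hx : v x ≤ 1) : Cg v (σ x) x :=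
  Cg.of_sub (h.hI σ hσ x hx) hx
lemma φcg (h : LD v p ϖ I φ) {x : E} (hx : v x ≤ 1) : Cg v (φ x) (x ^ p) :=
  Cg.of_sub (h.hφ x hx) (by rw [map_pow]; exact pow_le_one' hx p)
lemma exists_nat (h : LD v p ϖ I φ) {c : E} (hc : Cg v (c ^ p) c) : ∃ j : ℕ, Cg v c j := by
  let R := v.valuationSubring
  let P := IsLocalRing.maximalIdeal R
  have hm : ∀ x : R, x ∈ P ↔ v (x : E) < 1 := fun x => v.mem_maximalIdeal_iff
  obtain ⟨j, hj⟩ := exists_nat_of_pow h.hp P (R := R) (c := ⟨c, hc.r⟩) ((hm _).mpr (by simpa using h.vp))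
    ((hm _).mpr (by simpa using hc.s))
  exact ⟨j, hc.r, v_nat_le v j, by simpa using (hm _).mp hj⟩
end LD
end D1
end PartD1

section PartD2
open scoped Real
open NumberField
set_option linter.all false
set_option linter.unusedSectionVars false
section D2
variable {E : Type*} [Field E] [CharZero E] {Γ : Type*} [LinearOrderedCommGroupWithZero Γ]
variable {v : Valuation E Γ} {p : ℕ} {ϖ : E} {I : Subgroup (E ≃ₐ[ℚ] E)} {φ : E ≃ₐ[ℚ] E} {ζ : E}

lemma v_root_one (v : Valuation E Γ) {z : E} {n : ℕ} (hn : 0 < n) (hz : z ^ n = 1) : v z = 1 := by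
  have : v z ^ n = 1 := by rw [← map_pow, hz, map_one]
  exact (pow_left_inj₀ zero_le zero_le hn.ne').mp (this.trans (one_pow n).symm)

lemma zpow_inj' {a : Γ} (h0 : a ≠ 0) (h1 : a < 1) {m n : ℤ} (h : a ^ m = a ^ n) : m = n :=
  zpow_right_injective₀ (zero_lt_iff.mpr h0) h1.ne h

namespace LD
lemma vz (h : LD v p ϖ I φ) (hζ : IsPrimitiveRoot ζ p) : v ζ = 1 := v_root_one v h.hp.pos hζ.pow_eq_one
lemma vlam_le (h : LD v p ϖ I φ) {z : E} (hz : v z ≤ 1) (i : ℕ) : v (1 - z ^ i) ≤ v (1 - z) := by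
  rw [← mul_neg_geom_sum, map_mul]
  refine mul_le_of_le_one_right' (v.map_sum_le fun j _ => ?_)
  rw [map_pow]; exact pow_le_one' hz j
lemma vlam_prim (h : LD v p ϖ I φ) (hζ : IsPrimitiveRoot ζ p) {z : E} (hz : IsPrimitiveRoot z p) :
    v (1 - z) = v (1 - ζ) := by
  have : NeZero p := ⟨h.hp.ne_zero⟩
  apply le_antisymm
  · obtain ⟨i, -, rfl⟩ := hζ.eq_pow_of_pow_eq_one hz.pow_eq_one
    exact h.vlam_le (h.vz hζ).le i
  · obtain ⟨i, -, rfl⟩ := hz.eq_pow_of_pow_eq_one hζ.pow_eq_one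
    exact h.vlam_le (h.vz hz).le i
lemma prim_of_ne (h : LD v p ϖ I φ) {z : E} (hz : z ^ p = 1) (h1 : z ≠ 1) : IsPrimitiveRoot z p := by
  have := h.hp
  rcases (Nat.dvd_prime h.hp).mp (orderOf_dvd_of_pow_eq_one hz) with h2 | h2
  · exact absurd (orderOf_eq_one_iff.mp h2) h1
  · rw [← h2]; exact IsPrimitiveRoot.orderOf z
lemma prim_pow (h : LD v p ϖ I φ) (hζ : IsPrimitiveRoot ζ p) {i : ℕ} (hi : ¬ p ∣ i) : IsPrimitiveRoot (ζ ^ i) p :=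
  hζ.pow_of_coprime i ((h.hp.coprime_iff_not_dvd.mpr hi).symm)
lemma lam0 (h : LD v p ϖ I φ) (hζ : IsPrimitiveRoot ζ p) : 1 - ζ ≠ 0 :=
  sub_ne_zero.mpr (hζ.ne_one h.hp.one_lt).symm
lemma vl0 (h : LD v p ϖ I φ) (hζ : IsPrimitiveRoot ζ p) : v (1 - ζ) ≠ 0 :=
  (Valuation.ne_zero_iff v).mpr (h.lam0 hζ)
lemma vlam_pow (h : LD v p ϖ I φ) (hζ : IsPrimitiveRoot ζ p) : v (p : E) = v (1 - ζ) ^ (p - 1) := by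
  obtain ⟨n, hn⟩ : ∃ n, p = n + 1 := ⟨p - 1, by have := h.hp.pos; omega⟩
  have hζ' : IsPrimitiveRoot ζ (n + 1) := hn ▸ hζ
  have h1 := hζ'.prod_one_sub_pow_eq_order
  have h2 : ((p : ℕ) : E) = n + 1 := by rw [hn]; push_cast; rfl
  rw [h2, ← h1, map_prod, hn, Nat.add_sub_cancel]
  rw [Finset.prod_congr rfl (g := fun _ => v (1 - ζ))]
  · simp
  · intro i hi
    apply h.vlam_prim hζ (h.prim_pow hζ _)
    intro hd
    have := Nat.le_of_dvd (by omega) hd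
    have := Finset.mem_range.mp hi
    omega
lemma vl1 (h : LD v p ϖ I φ) (hζ : IsPrimitiveRoot ζ p) : v (1 - ζ) < 1 := by
  by_contra hc
  have := h.vp
  rw [h.vlam_pow hζ] at this
  exact absurd this (not_lt.mpr (one_le_pow_of_one_le' (not_lt.mp hc) _))
lemma ζcg (h : LD v p ϖ I φ) (hζ : IsPrimitiveRoot ζ p) : Cg v ζ 1 := by
  refine Cg.of_sub ?_ (by simp)
  rw [Valuation.map_sub_swap]; exact h.vl1 hζ
/-- `(1-ζ^a)/(1-ζ) ≡ a`. -/
lemma lam_quot (h : LD v p ϖ I φ) (hζ : IsPrimitiveRoot ζ p) (a : ℕ) :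
    Cg v ((1 - ζ ^ a) / (1 - ζ)) a := by
  have : (1 - ζ ^ a) / (1 - ζ) = ∑ i ∈ Finset.range a, ζ ^ i := by
    rw [← mul_neg_geom_sum, mul_div_cancel_left₀ _ (h.lam0 hζ)]
  rw [this]
  have := Cg.sum' (v := v) (Finset.range a) (f := fun i => ζ ^ i) (g := fun _ => 1)
    (fun i _ => by simpa using (h.ζcg hζ).pow' i)
  simpa using this
lemma pow_sub_one (h : LD v p ϖ I φ) (hζ : IsPrimitiveRoot ζ p) (b : E) :
    b ^ p - 1 = ∏ z ∈ Polynomial.nthRootsFinset p (1 : E), (b - z) := by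
  have := congrArg (Polynomial.eval b) (Polynomial.X_pow_sub_one_eq_prod h.hp.pos hζ)
  simpa [Polynomial.eval_prod] using this
lemma root_le (h : LD v p ϖ I φ) (hζ : IsPrimitiveRoot ζ p) {z : E} (hz : z ^ p = 1) : v (1 - z) ≤ v (1 - ζ) := by
  by_cases h1 : z = 1
  · simp [h1]
  · exact (h.vlam_prim hζ (h.prim_of_ne hz h1)).le
lemma card_roots (h : LD v p ϖ I φ) (hζ : IsPrimitiveRoot ζ p) : (Polynomial.nthRootsFinset p (1 : E)).card = p :=
  hζ.card_nthRootsFinset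
lemma pow_big (h : LD v p ϖ I φ) (hζ : IsPrimitiveRoot ζ p) {b : E} (hb : v (1 - ζ) < v (b - 1)) :
    v (b ^ p - 1) = v (b - 1) ^ p := by
  rw [h.pow_sub_one hζ, map_prod, Finset.prod_congr rfl (g := fun _ => v (b - 1)), Finset.prod_const, h.card_roots hζ]
  intro z hz
  have hz := (Polynomial.mem_nthRootsFinset h.hp.pos _).mp hz
  rw [show b - z = (b - 1) + (1 - z) by ring]
  exact Valuation.map_add_eq_of_lt_left v ((h.root_le hζ hz).trans_lt hb)
lemma pow_small (h : LD v p ϖ I φ) (hζ : IsPrimitiveRoot ζ p) {b : E} (hb : v (b - 1) ≤ v (1 - ζ)) :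
    v (b ^ p - 1) ≤ v (1 - ζ) ^ p := by
  rw [h.pow_sub_one hζ, map_prod]
  refine (Finset.prod_le_pow_card _ _ (v (1 - ζ)) ?_).trans_eq (by rw [h.card_roots hζ])
  intro z hz
  have hz := (Polynomial.mem_nthRootsFinset h.hp.pos _).mp hz
  rw [show b - z = (b - 1) + (1 - z) by ring]
  exact v.map_add_le hb (h.root_le hζ hz)
lemma pow_lt (h : LD v p ϖ I φ) (hζ : IsPrimitiveRoot ζ p) {b : E} (hb : v (b ^ p - 1) < 1) : v (b - 1) < 1 := by
  by_contra hc
  have h1 : v (1 - ζ) < v (b - 1) := (h.vl1 hζ).trans_le (not_lt.mp hc)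
  rw [h.pow_big hζ h1] at hb
  exact absurd hb (not_lt.mpr (one_le_pow_of_one_le' (not_lt.mp hc) _))
lemma small_of_pow (h : LD v p ϖ I φ) (hζ : IsPrimitiveRoot ζ p) {b : E} (hb : v (b ^ p - 1) ≤ v (1 - ζ) ^ p) :
    v (b - 1) ≤ v (1 - ζ) := by
  by_contra hc
  push Not at hc
  rw [h.pow_big hζ hc] at hb
  exact absurd hb (not_le.mpr (pow_lt_pow_left₀ hc zero_le h.hp.ne_zero))
lemma map_prim (h : LD v p ϖ I φ) {z : E} (hz : IsPrimitiveRoot z p) (σ : E ≃ₐ[ℚ] E) : IsPrimitiveRoot (σ z) p :=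
  hz.map_of_injective σ.injective
/-- inertia acts transitively on primitive p-th roots of unity -/
lemma surj (h : LD v p ϖ I φ) (hζ : IsPrimitiveRoot ζ p) {z : E} (hz : IsPrimitiveRoot z p) : ∃ σ ∈ I, σ ζ = z := by
  classical
  let R := (primitiveRoots p E).filter (fun z => ∃ σ ∈ I, σ ζ = z)
  have hmem : ∀ z, z ∈ R ↔ ∃ σ ∈ I, σ ζ = z := by
    intro z
    simp only [R, Finset.mem_filter, mem_primitiveRoots h.hp.pos]
    exact ⟨fun h => h.2, fun ⟨σ, hσ, e⟩ => ⟨e ▸ h.map_prim hζ σ, σ, hσ, e⟩⟩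
  have hle : R.card ≤ p - 1 := by
    refine (Finset.card_filter_le _ _).trans_eq ?_
    rw [hζ.card_primitiveRoots, Nat.totient_prime h.hp]
  have hprim : ∀ z ∈ R, IsPrimitiveRoot z p := fun z hz =>
    (mem_primitiveRoots h.hp.pos).mp (Finset.mem_filter.mp hz).1
  have hv : v (∏ z ∈ R, (1 - z)) = v (1 - ζ) ^ R.card := by
    rw [map_prod, Finset.prod_congr rfl (g := fun _ => v (1 - ζ)), Finset.prod_const]
    intro z hz; exact h.vlam_prim hζ (hprim z hz)
  obtain ⟨n, hn⟩ := h.hU (∏ z ∈ R, (1 - z))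
    (Finset.prod_ne_zero_iff.mpr fun z hz => h.lam0 (hprim z hz)) (by
      intro τ hτ
      rw [map_prod]
      refine Finset.prod_bij (fun z _ => τ z) ?_ ?_ ?_ ?_
      · intro z hz
        obtain ⟨σ, hσ, rfl⟩ := (hmem z).mp hz
        exact (hmem _).mpr ⟨τ * σ, I.mul_mem hτ hσ, rfl⟩
      · intro a _ b _ hab; exact τ.injective hab
      · intro z hz
        obtain ⟨σ, hσ, rfl⟩ := (hmem z).mp hz
        exact ⟨(τ⁻¹ * σ) ζ, (hmem _).mpr ⟨τ⁻¹ * σ, I.mul_mem (I.inv_mem hτ) hσ, rfl⟩, by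
          rw [← AlgEquiv.mul_apply, mul_inv_cancel_left]⟩
      · intro z hz; simp)
  rw [hv, h.vlam_pow hζ, ← zpow_natCast, ← zpow_natCast, ← zpow_mul] at hn
  have hn := zpow_inj' (h.vl0 hζ) (h.vl1 hζ) hn
  have hpos : 0 < R.card := Finset.card_pos.mpr ⟨ζ, (hmem _).mpr ⟨1, I.one_mem, rfl⟩⟩
  have hge : p - 1 ≤ R.card := by
    apply Nat.le_of_dvd hpos
    exact_mod_cast Dvd.intro _ hn.symm
  have hR : R = primitiveRoots p E := by
    apply Finset.eq_of_subset_of_card_le (Finset.filter_subset _ _)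
    rwa [hζ.card_primitiveRoots, Nat.totient_prime h.hp]
  exact (hmem z).mp (hR ▸ (mem_primitiveRoots h.hp.pos).mpr hz)
/-- values on the fixed field of H -/
lemma disc (h : LD v p ϖ I φ) (hζ : IsPrimitiveRoot ζ p) {y : E} (hy : y ≠ 0)
    (hH : ∀ σ ∈ I, σ ζ = ζ → σ y = y) : ∃ n : ℤ, v y = v (1 - ζ) ^ n := by
  classical
  choose! s hsI hs using fun z (hz : IsPrimitiveRoot z p) => h.surj hζ hz
  have key : ∀ τ ∈ I, ∀ z, IsPrimitiveRoot z p → τ (s z y) = s (τ z) y := by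
    intro τ hτ z hz
    have h2 := h.map_prim hz τ
    have h1 := hH ((s (τ z))⁻¹ * (τ * s z)) (I.mul_mem (I.inv_mem (hsI _ h2)) (I.mul_mem hτ (hsI z hz))) (by
      rw [AlgEquiv.mul_apply, AlgEquiv.mul_apply, hs z hz]
      nth_rewrite 2 [← hs _ h2]
      rw [← AlgEquiv.mul_apply, inv_mul_cancel]; rfl)
    have := congrArg (s (τ z)) h1
    rw [← AlgEquiv.mul_apply, mul_inv_cancel_left] at this
    exact this
  obtain ⟨n, hn⟩ := h.hU (∏ z ∈ primitiveRoots p E, s z y)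
    (Finset.prod_ne_zero_iff.mpr fun z hz => by simpa using hy) (by
      intro τ hτ
      rw [map_prod]
      refine Finset.prod_bij (fun z _ => τ z) ?_ ?_ ?_ ?_
      · intro z hz
        rw [mem_primitiveRoots h.hp.pos] at hz ⊢
        exact h.map_prim hz τ
      · intro a _ b _ hab; exact τ.injective hab
      · intro z hz
        rw [mem_primitiveRoots h.hp.pos] at hz
        exact ⟨τ⁻¹ z, (mem_primitiveRoots h.hp.pos).mpr (h.map_prim hz _), by
          rw [← AlgEquiv.mul_apply, mul_inv_cancel]; rfl⟩
      · intro z hz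
        rw [mem_primitiveRoots h.hp.pos] at hz
        exact key τ hτ z hz)
  rw [map_prod, Finset.prod_congr rfl (g := fun _ => v y), Finset.prod_const, hζ.card_primitiveRoots,
    Nat.totient_prime h.hp, h.vlam_pow hζ, ← zpow_natCast, ← zpow_natCast, zpow_comm] at hn
  · refine ⟨n, ?_⟩
    rw [zpow_natCast, zpow_natCast] at hn
    exact (pow_left_inj₀ zero_le zero_le (by have := h.hp.two_le; omega)).mp hn
  · intro z hz
    rw [mem_primitiveRoots h.hp.pos] at hz
    exact h.hIv _ (hsI z hz) y
lemma disc_succ (h : LD v p ϖ I φ) (hζ : IsPrimitiveRoot ζ p) {y : E}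
    (hH : ∀ σ ∈ I, σ ζ = ζ → σ y = y) {k : ℕ} (hk : v y < v (1 - ζ) ^ k) : v y ≤ v (1 - ζ) ^ (k + 1) := by
  by_cases hy : y = 0
  · simp [hy]
  obtain ⟨n, hn⟩ := h.disc hζ hy hH
  have h0 := zero_lt_iff.mpr (h.vl0 hζ)
  rw [hn, ← zpow_natCast] at hk ⊢
  have := (zpow_lt_zpow_iff_right_of_lt_one₀ h0 (h.vl1 hζ)).mp hk
  exact (zpow_le_zpow_iff_right_of_lt_one₀ h0 (h.vl1 hζ)).mpr (by push_cast; omega)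
end LD
end D2
end PartD2

section PartD3
open scoped Real
open NumberField
set_option linter.all false
set_option linter.unusedSectionVars false
section D3
variable {E : Type*} [Field E] [CharZero E] {Γ : Type*} [LinearOrderedCommGroupWithZero Γ]
variable {v : Valuation E Γ} {p : ℕ} {ϖ : E} {I : Subgroup (E ≃ₐ[ℚ] E)} {φ : E ≃ₐ[ℚ] E} {ζ : E}

lemma Cg.zpow' {x y : E} (h : Cg v x y) (hy : v y = 1) (n : ℤ) : Cg v (x ^ n) (y ^ n) := by
  rcases Int.eq_nat_or_neg n with ⟨m, rfl | rfl⟩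
  · simpa using h.pow' m
  · simpa using (h.pow' m).inv' (by simp [hy])

namespace LD
lemma unit_quot (h : LD v p ϖ I φ) {σ} (hσ : σ ∈ I) {u : E} (hu : v u = 1) : Cg v (σ u / u) 1 := by
  have hu0 : u ≠ 0 := by rintro rfl; simp at hu
  have := (h.Icg hσ hu.le).mul' (Cg.refl' (v := v) (x := u⁻¹) (by simp [hu]))
  rwa [mul_inv_cancel₀ hu0, ← div_eq_mul_inv] at this
lemma commA (h : LD v p ϖ I φ) (σ τ : E ≃ₐ[ℚ] E) (x : E) : σ (τ x) = τ (σ x) := by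
  rw [← AlgEquiv.mul_apply, h.comm, AlgEquiv.mul_apply]
lemma v1_quot (h : LD v p ϖ I φ) {σ : E ≃ₐ[ℚ] E} (hσ : ∀ x, v (σ x) = v x) {w : E} (hw : w ≠ 0) : v (σ w / w) = 1 := by
  rw [map_div₀, hσ, div_self ((Valuation.ne_zero_iff v).mpr hw)]
lemma eps (h : LD v p ϖ I φ) {σ} (hσ : σ ∈ I) : ∃ j : ℕ, Cg v (σ ϖ / ϖ) j := by
  apply h.exists_nat
  have h0 := h.ϖ0
  have hε := h.v1_quot (h.hIv σ hσ) h0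
  have hu := h.v1_quot h.hφv h0
  have h1 := (h.φcg hε.le).symm'
  refine h1.trans' ?_
  have h2 := (Cg.refl' hε.le).mul' (h.unit_quot hσ hu)
  rw [mul_one] at h2
  convert h2 using 1
  simp only [map_div₀]
  rw [h.commA φ σ]
  have : φ ϖ ≠ 0 := by simpa using h0
  have : σ ϖ ≠ 0 := by simpa using h0
  field_simp
lemma quot_zpow (h : LD v p ϖ I φ) {σ} (hσ : σ ∈ I) {w : E} (hw : w ≠ 0) {n : ℤ} (hn : v w = v ϖ ^ n) :
    Cg v (σ w / w) ((σ ϖ / ϖ) ^ n) := by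
  have h0 := h.ϖ0
  have hz : ϖ ^ n ≠ 0 := zpow_ne_zero n h0
  have hu : v (w / ϖ ^ n) = 1 := by
    rw [map_div₀, map_zpow₀, ← hn, div_self ((Valuation.ne_zero_iff v).mpr hw)]
  have h2 := (Cg.refl' (v := v) (x := (σ ϖ / ϖ) ^ n) (by rw [map_zpow₀, h.v1_quot (h.hIv σ hσ) h0, one_zpow])).mul' (h.unit_quot hσ hu)
  rw [mul_one] at h2
  convert h2 using 1
  simp only [map_div₀, map_zpow₀, div_zpow]
  have : σ ϖ ^ n ≠ 0 := zpow_ne_zero n (by simpa using h0)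
  field_simp
lemma tame0 (h : LD v p ϖ I φ) (hζ : IsPrimitiveRoot ζ p) {σ} (hσ : σ ∈ I) (hσζ : σ ζ = ζ) : Cg v (σ ϖ / ϖ) 1 := by
  have : Fact p.Prime := ⟨h.hp⟩
  have hl0 := h.lam0 hζ
  obtain ⟨n, hn⟩ := h.hϖ _ hl0
  obtain ⟨m, rfl⟩ : ∃ m : ℕ, n = m := by
    refine Int.eq_ofNat_of_zero_le ?_
    by_contra hc
    have h1 := h.vl1 hζ
    rw [hn] at h1
    have := one_le_zpow_iff_right_of_lt_one₀ (zero_lt_iff.mpr ((Valuation.ne_zero_iff v).mpr h.ϖ0)) h.ϖ1 (n := n)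
    exact absurd h1 (not_lt.mpr (this.mpr (by omega)))
  have key : ∀ τ ∈ I, ∀ a : ℕ, τ ζ = ζ ^ a → ∀ j : ℕ, Cg v (τ ϖ / ϖ) j → ((j : ZMod p)) ^ m = a := by
    intro τ hτ a ha j hj
    have h1 := h.quot_zpow hτ hl0 hn
    rw [zpow_natCast] at h1
    have h2 := (h1.trans' (hj.pow' m)).symm'
    rw [map_sub, map_one, ha] at h2
    have h3 := h2.trans' (h.lam_quot hζ a)
    have : Cg v ((j ^ m : ℕ) : E) a := by push_cast; exact h3
    rw [h.nat_cg] at this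
    exact_mod_cast this
  have nz : ∀ τ ∈ I, ∀ j : ℕ, Cg v (τ ϖ / ϖ) j → (j : ZMod p) ≠ 0 := by
    intro τ hτ j hj h0
    have h1 := hj.symm'.veq (h.v1_quot (h.hIv τ hτ) h.ϖ0)
    have := (h.int_lt j).mpr (by exact_mod_cast (ZMod.natCast_eq_zero_iff j p).mp h0)
    rw [Int.cast_natCast, h1] at this
    exact lt_irrefl _ this
  have hs : Function.Surjective (fun x : (ZMod p)ˣ => x ^ m) := by
    intro u
    have hc : Nat.Coprime u.val.val p := ZMod.val_coe_unit_coprime u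
    obtain ⟨τ, hτ, e⟩ := h.surj hζ (hζ.pow_of_coprime _ hc)
    obtain ⟨j, hj⟩ := h.eps hτ
    have h1 := key τ hτ _ e j hj
    refine ⟨Units.mk0 (j : ZMod p) (nz τ hτ j hj), Units.ext ?_⟩
    simpa using h1
  obtain ⟨j, hj⟩ := h.eps hσ
  have h1 := key σ hσ 1 (by simpa using hσζ) j hj
  have h2 := (Finite.injective_iff_surjective.mpr hs) (a₁ := Units.mk0 (j : ZMod p) (nz σ hσ j hj)) (a₂ := 1)
    (Units.ext (by simpa using h1))
  have h3 : (j : ZMod p) = (1 : ℕ) := by simpa using congrArg Units.val h2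
  rw [← h.nat_cg] at h3
  simpa using hj.trans' h3
lemma tame (h : LD v p ϖ I φ) (hζ : IsPrimitiveRoot ζ p) {σ} (hσ : σ ∈ I) (hσζ : σ ζ = ζ) {w : E} (hw : w ≠ 0) :
    Cg v (σ w / w) 1 := by
  obtain ⟨n, hn⟩ := h.hϖ _ hw
  refine (h.quot_zpow hσ hw hn).trans' ?_
  simpa using (h.tame0 hζ hσ hσζ).zpow' (by simp) n
lemma tame_order (h : LD v p ϖ I φ) (hζ : IsPrimitiveRoot ζ p) {σ} (hσ : σ ∈ I) (hσζ : σ ζ = ζ) {q : ℕ}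
    (hq : ¬ p ∣ q) (h1 : σ ^ q = 1) : σ = 1 := by
  ext x
  by_contra hx
  have hx : σ x - x ≠ 0 := sub_ne_zero.mpr hx
  have hpow : ∀ i : ℕ, (σ ^ i) ζ = ζ := by
    intro i
    induction i with
    | zero => rfl
    | succ i ih => rw [pow_succ, AlgEquiv.mul_apply, hσζ, ih]
  have h2 := Cg.sum' (v := v) (Finset.range q) (f := fun i => (σ ^ i) (σ x - x) / (σ x - x)) (g := fun _ => 1)
    (fun i _ => h.tame hζ (I.pow_mem hσ i) (hpow i) hx)
  have h3 : ∑ i ∈ Finset.range q, (σ ^ i) (σ x - x) / (σ x - x) = 0 := by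
    rw [← Finset.sum_div]
    have : ∀ i, (σ ^ i) (σ x - x) = (σ ^ (i+1)) x - (σ ^ i) x := by
      intro i; rw [map_sub, pow_succ, AlgEquiv.mul_apply]
    simp only [this]
    rw [Finset.sum_range_sub (fun i => (σ ^ i) x), h1]; simp
  rw [h3] at h2
  have h4 := h2.symm'.s
  simp only [Finset.sum_const, Finset.card_range, nsmul_eq_mul, mul_one, sub_zero] at h4
  exact absurd (h.nat_one hq) h4.ne
end LD
end D3
end PartD3

section PartD4
open scoped Real
open NumberField
set_option linter.all false
set_option linter.unusedSectionVars false
section D4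
variable {E : Type*} [Field E] [CharZero E] {Γ : Type*} [LinearOrderedCommGroupWithZero Γ]
variable {v : Valuation E Γ} {p : ℕ} {ϖ : E} {I : Subgroup (E ≃ₐ[ℚ] E)} {φ : E ≃ₐ[ℚ] E} {ζ : E}

structure Eig (p : ℕ) (I : Subgroup (E ≃ₐ[ℚ] E)) (ζ θ : E) : Prop where
  nz : θ ≠ 0
  eq : ∀ σ ∈ I, σ ζ = ζ → (σ θ) ^ p = θ ^ p

lemma Eig.mul {θ t : E} (h : Eig p I ζ θ) (h' : Eig p I ζ t) : Eig p I ζ (θ * t) :=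
  ⟨mul_ne_zero h.nz h'.nz, fun σ hσ hz => by rw [map_mul, mul_pow, h.eq σ hσ hz, h'.eq σ hσ hz, mul_pow]⟩
lemma Eig.pow {θ : E} (h : Eig p I ζ θ) (n : ℕ) : Eig p I ζ (θ ^ n) :=
  ⟨pow_ne_zero n h.nz, fun σ hσ hz => by rw [map_pow, pow_right_comm, h.eq σ hσ hz, pow_right_comm]⟩
lemma Eig.zpow {θ : E} (h : Eig p I ζ θ) (n : ℤ) : Eig p I ζ (θ ^ n) :=
  ⟨zpow_ne_zero n h.nz, fun σ hσ hz => by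
    rw [map_zpow₀, ← zpow_natCast, zpow_comm, zpow_natCast, h.eq σ hσ hz, ← zpow_natCast, zpow_comm, zpow_natCast]⟩
lemma Eig.of_fixed {a : E} (h0 : a ≠ 0) (h : ∀ σ ∈ I, σ ζ = ζ → σ a = a) : Eig p I ζ a :=
  ⟨h0, fun σ hσ hz => by rw [h σ hσ hz]⟩

namespace LD
lemma eig_const (h : LD v p ϖ I φ) (hζ : IsPrimitiveRoot ζ p) {θ : E} (hθ : Eig p I ζ θ) {σ} (hσ : σ ∈ I)
    (hz : σ ζ = ζ) : ∃ i : ℕ, σ θ = ζ ^ i * θ := by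
  have : NeZero p := ⟨h.hp.ne_zero⟩
  have h1 : (σ θ / θ) ^ p = 1 := by
    rw [div_pow, hθ.eq σ hσ hz, div_self (pow_ne_zero _ hθ.nz)]
  obtain ⟨i, -, hi⟩ := hζ.eq_pow_of_pow_eq_one h1
  exact ⟨i, by rw [hi, div_mul_cancel₀ _ hθ.nz]⟩
lemma beta (h : LD v p ϖ I φ) (hζ : IsPrimitiveRoot ζ p) {θ : E} (hθ : Eig p I ζ θ) {g : E ≃ₐ[ℚ] E} {b : ℕ}
    (hg : g ζ = ζ ^ b) : ∀ σ ∈ I, σ ζ = ζ → σ (g θ / θ ^ b) = g θ / θ ^ b := by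
  intro σ hσ hz
  obtain ⟨i, hi⟩ := h.eig_const hζ hθ hσ hz
  have hz0 : ζ ≠ 0 := hζ.ne_zero h.hp.ne_zero
  rw [map_div₀, map_pow, h.commA, hi, map_mul, map_pow, hg, mul_pow, pow_right_comm]
  exact mul_div_mul_left _ _ (pow_ne_zero _ (pow_ne_zero _ hz0))
lemma s5 (h : LD v p ϖ I φ) (hζ : IsPrimitiveRoot ζ p) {θ : E} (hθ : Eig p I ζ θ)
    (hv : v (θ ^ p - 1) ≤ v (1 - ζ) ^ p) {σ} (hσ : σ ∈ I) (hz : σ ζ = ζ) : σ θ = θ := by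
  have h1 := h.small_of_pow hζ hv
  have hl0 := h.lam0 hζ
  have hvl0 := h.vl0 hζ
  set y := (θ - 1) / (1 - ζ) with hy
  have hvy : v y ≤ 1 := by
    rw [hy, map_div₀]; exact (div_le_one₀ (zero_lt_iff.mpr hvl0)).mpr h1
  have hθy : θ = 1 + (1 - ζ) * y := by rw [hy, mul_div_cancel₀ _ hl0]; ring
  have e1 : σ θ - θ = (1 - ζ) * (σ y - y) := by
    rw [hθy]; simp only [map_add, map_mul, map_sub, map_one, hz]; ring
  have e2 : v (σ θ - θ) < v (1 - ζ) := by
    rw [e1, map_mul]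
    exact mul_lt_of_lt_one_right (zero_lt_iff.mpr hvl0) (h.hI σ hσ y hvy)
  have hvθ : v θ = 1 := by
    have : Cg v θ 1 := Cg.of_sub (h1.trans_lt (h.vl1 hζ)) (by simp)
    exact this.veq (by simp)
  obtain ⟨i, hi⟩ := h.eig_const hζ hθ hσ hz
  by_cases hc : ζ ^ i = 1
  · rw [hi, hc, one_mul]
  · exfalso
    have h3 := h.prim_of_ne (z := ζ ^ i) (by rw [pow_right_comm, hζ.pow_eq_one, one_pow]) hc
    rw [hi, show ζ ^ i * θ - θ = -((1 - ζ ^ i) * θ) by ring, Valuation.map_neg, map_mul, hvθ, mul_one,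
      h.vlam_prim hζ h3] at e2
    exact lt_irrefl _ e2
lemma beta_small (h : LD v p ϖ I φ) (hζ : IsPrimitiveRoot ζ p) {β : E} (hβ : ∀ σ ∈ I, σ ζ = ζ → σ β = β)
    (h1 : Cg v (β ^ p) 1) : v (β ^ p - 1) ≤ v (1 - ζ) ^ p := by
  apply h.pow_small hζ
  have h2 := h.pow_lt hζ h1.s
  have := h.disc_succ hζ (y := β - 1) (k := 0) (fun σ hσ hz => by rw [map_sub, hβ σ hσ hz, map_one]) (by simpa using h2)
  simpa using this
lemma s4 (h : LD v p ϖ I φ) (hζ : IsPrimitiveRoot ζ p) {θ : E} (hθ : Eig p I ζ θ) {k : ℕ} (hk : 2 ≤ k) (hkp : k < p)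
    (hv : v (θ ^ p - 1) ≤ v (1 - ζ) ^ k) : v (θ ^ p - 1) ≤ v (1 - ζ) ^ (k + 1) := by
  have : Fact p.Prime := ⟨h.hp⟩
  have hl0 := h.lam0 hζ
  have hvl0 := h.vl0 hζ
  have hvl1 := h.vl1 hζ
  have hlk0 : (1 - ζ) ^ k ≠ 0 := pow_ne_zero k hl0
  have hvlk : v (1 - ζ) ^ k ≠ 0 := pow_ne_zero k hvl0
  apply h.disc_succ hζ (fun σ hσ hz => by rw [map_sub, map_pow, hθ.eq σ hσ hz, map_one])
  obtain ⟨u, hu⟩ : ∃ u : (ZMod p)ˣ, u ^ (k - 1) ≠ 1 := by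
    apply exists_pow_ne_one_of_isCyclic (by omega)
    rw [Nat.card_eq_fintype_card, ZMod.card_units_eq_totient, Nat.totient_prime h.hp]; omega
  set a := u.val.val with ha
  have hua : ((a : ℕ) : ZMod p) = u := by simp [ha]
  obtain ⟨τ, hτ, hτζ⟩ := h.surj hζ (hζ.pow_of_coprime _ (ZMod.val_coe_unit_coprime u))
  rw [← ha] at hτζ
  set α := θ ^ p with hα
  have hα1 : Cg v α 1 := Cg.of_sub (hv.trans_lt (pow_lt_one₀ zero_le hvl1 (by omega))) (by simp)
  have hvα : v α = 1 := hα1.veq (by simp)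
  set β := τ θ / θ ^ a with hβ
  have hβH := h.beta hζ hθ hτζ
  rw [← hβ] at hβH
  have hα0 : α ≠ 0 := pow_ne_zero _ hθ.nz
  have hτα : τ α = α ^ a * β ^ p := by
    rw [hβ, div_pow, pow_right_comm θ a p, ← hα, mul_div_cancel₀ _ (pow_ne_zero _ hα0), hα, map_pow]
  have hτα1 : Cg v (τ α) 1 := (h.Icg hτ hvα.le).trans' hα1
  have hβp : Cg v (β ^ p) 1 := by
    have : β ^ p = τ α * (α ^ a)⁻¹ := by rw [hτα]; field_simp
    rw [this]
    simpa using hτα1.mul' ((hα1.pow' a).inv' (by simp))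
  have hβs := h.beta_small hζ hβH hβp
  have hβlt : v (β ^ p - 1) < v (1 - ζ) ^ k :=
    hβs.trans_lt (pow_lt_pow_right_of_lt_one₀ (zero_lt_iff.mpr hvl0) hvl1 hkp)
  set x := (α - 1) / (1 - ζ) ^ k with hx
  have hvx : v x ≤ 1 := by
    rw [hx, map_div₀, map_pow]; exact (div_le_one₀ (zero_lt_iff.mpr hvlk)).mpr hv
  have e1 : Cg v ((τ α - 1) / (1 - ζ) ^ k) (x * (a : E) ^ k) := by
    have h1 := (h.Icg hτ hvx).mul' ((h.lam_quot hζ a).pow' k)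
    convert h1 using 1
    rw [hx]
    have : (1 - ζ ^ a) ^ k ≠ 0 := pow_ne_zero k (h.lam0 (hτζ ▸ h.map_prim hζ τ))
    simp only [map_div₀, map_pow, map_sub, map_one, hτζ, div_pow]
    field_simp
  have e2 : Cg v ((α ^ a * β ^ p - 1) / (1 - ζ) ^ k) (x * (a : E)) := by
    have h1 : Cg v (∑ i ∈ Finset.range a, α ^ i) (a : E) := by
      simpa using Cg.sum' (v := v) (Finset.range a) (f := fun i => α ^ i) (g := fun _ => 1) (fun i _ => by simpa using hα1.pow' i)
    have h2 : Cg v ((β ^ p - 1) / (1 - ζ) ^ k) 0 := by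
      rw [Cg.zero_iff, map_div₀, map_pow]
      exact (div_lt_one₀ (zero_lt_iff.mpr hvlk)).mpr hβlt
    have h3 := ((Cg.refl' hvx).mul' h1).add' (((hα1.pow' a)).mul' h2)
    rw [mul_zero, add_zero] at h3
    convert h3 using 1
    rw [hx, div_mul_eq_mul_div, mul_geom_sum]
    field_simp; ring
  rw [hτα] at e1
  have e3 := (e1.symm'.trans' e2).s
  have e4 : v (((a : ℤ) ^ k - a : ℤ) : E) = 1 := by
    refine le_antisymm (v_int_le v _) (not_lt.mp fun hc => ?_)
    rw [h.int_lt, ← ZMod.intCast_zmod_eq_zero_iff_dvd] at hc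
    push_cast at hc
    rw [hua, sub_eq_zero] at hc
    apply hu
    have hc' : u ^ k = u := Units.ext (by simpa using hc)
    have : u ^ (k - 1) * u = 1 * u := by rw [← pow_succ, Nat.sub_add_cancel (by omega), hc', one_mul]
    exact mul_right_cancel this
  have e5 : v x < 1 := by
    rw [← mul_sub, map_mul] at e3
    push_cast at e4
    rwa [e4, mul_one] at e3
  rw [hx, map_div₀, map_pow] at e5
  exact (div_lt_one₀ (zero_lt_iff.mpr hvlk)).mp e5
lemma s45 (h : LD v p ϖ I φ) (hζ : IsPrimitiveRoot ζ p) {θ : E} (hθ : Eig p I ζ θ)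
    (hv : v (θ ^ p - 1) ≤ v (1 - ζ) ^ 2) : ∀ σ ∈ I, σ ζ = ζ → σ θ = θ := by
  have key : ∀ k, k + 2 ≤ p → v (θ ^ p - 1) ≤ v (1 - ζ) ^ (k + 2) := by
    intro k
    induction k with
    | zero => intro _; simpa using hv
    | succ k ih => intro hk; exact h.s4 hζ hθ (by omega) (by omega) (ih (by omega))
  have h2 := h.hp.two_le
  have := key (p - 2) (by omega)
  rw [Nat.sub_add_cancel h2] at this
  exact fun σ hσ hz => h.s5 hζ hθ this hσ hz
lemma s3 (h : LD v p ϖ I φ) (hζ : IsPrimitiveRoot ζ p) {η : E} (hη : η ^ p = ζ) {θ : E} (hθ : Eig p I ζ θ)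
    (hv : v (θ ^ p - 1) < 1) : ∃ j : ℕ, v ((θ * η ^ j) ^ p - 1) ≤ v (1 - ζ) ^ 2 := by
  have hl0 := h.lam0 hζ
  have hvl0 := h.vl0 hζ
  have hvl1 := h.vl1 hζ
  obtain ⟨σ, hσ, hσζ⟩ := h.surj hζ (h.map_prim hζ φ)
  have hσi := I.inv_mem hσ
  obtain ⟨ψ, hψ⟩ : ∃ ψ, ψ = σ⁻¹ * φ := ⟨_, rfl⟩
  have ψz : ψ ζ = ζ := by
    rw [hψ, AlgEquiv.mul_apply, ← hσζ, ← AlgEquiv.mul_apply, inv_mul_cancel]; rfl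
  have ψc : ∀ x, v x ≤ 1 → Cg v (ψ x) (x ^ p) := by
    intro x hx
    rw [hψ, AlgEquiv.mul_apply]
    exact (h.Icg hσi (by rw [h.hφv]; exact hx)).trans' (h.φcg hx)
  set α := θ ^ p with hα
  have hα1 : Cg v α 1 := Cg.of_sub hv (by simp)
  have hvα : v α = 1 := hα1.veq (by simp)
  have hα0 : α ≠ 0 := pow_ne_zero _ hθ.nz
  have hαH : ∀ σ ∈ I, σ ζ = ζ → σ α = α := fun σ hσ hz => by rw [hα, map_pow, hθ.eq σ hσ hz]
  have hvα' : v (α - 1) ≤ v (1 - ζ) := by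
    have := h.disc_succ hζ (y := α - 1) (k := 0) (fun σ hσ hz => by rw [map_sub, hαH σ hσ hz, map_one]) (by simpa using hv)
    simpa using this
  obtain ⟨β, hβ⟩ : ∃ β, β = ψ θ / θ ^ 1 := ⟨_, rfl⟩
  have hβH := h.beta hζ hθ (g := ψ) (b := 1) (by simpa using ψz)
  rw [← hβ] at hβH
  have hψα : ψ α = α * β ^ p := by
    rw [hβ, pow_one, div_pow, ← hα, mul_div_cancel₀ _ hα0, hα, map_pow]
  have hψα1 : Cg v (ψ α) 1 := (ψc α hvα.le).trans' (by simpa using hα1.pow' p)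
  have hβp : Cg v (β ^ p) 1 := by
    have : β ^ p = ψ α * α⁻¹ := by rw [hψα]; field_simp
    rw [this]
    simpa using hψα1.mul' (hα1.inv' (by simp))
  have hβs := h.beta_small hζ hβH hβp
  have hβlt : v (β ^ p - 1) < v (1 - ζ) := by
    refine hβs.trans_lt ?_
    have := pow_lt_pow_right_of_lt_one₀ (zero_lt_iff.mpr hvl0) hvl1 h.hp.one_lt
    simpa using this
  set x := (α - 1) / (1 - ζ) with hx
  have hvx : v x ≤ 1 := by
    rw [hx, map_div₀]; exact (div_le_one₀ (zero_lt_iff.mpr hvl0)).mpr hvα'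
  have h2 : Cg v ((β ^ p - 1) / (1 - ζ)) 0 := by
    rw [Cg.zero_iff, map_div₀]
    exact (div_lt_one₀ (zero_lt_iff.mpr hvl0)).mpr hβlt
  have e1 : Cg v (ψ x) x := by
    have h3 := (Cg.refl' hvx).add' (hα1.mul' h2)
    rw [mul_zero, add_zero] at h3
    convert h3 using 1
    rw [hx]
    simp only [map_div₀, map_sub, map_one, ψz, hψα]
    field_simp; ring
  obtain ⟨j, hj⟩ := h.exists_nat ((ψc x hvx).symm'.trans' e1)
  refine ⟨j, ?_⟩
  have hzj : (θ * η ^ j) ^ p = α * ζ ^ j := by rw [mul_pow, pow_right_comm, hη]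
  rw [hzj]
  apply h.disc_succ hζ (k := 1)
  · intro σ hσ hz; rw [map_sub, map_mul, hαH σ hσ hz, map_pow, hz, map_one]
  · have h4 := (hj.mul' (by simpa using (h.ζcg hζ).pow' j : Cg v (ζ ^ j) 1)).sub' (h.lam_quot hζ j)
    rw [mul_one, sub_self, Cg.zero_iff] at h4
    have : x * ζ ^ j - (1 - ζ ^ j) / (1 - ζ) = (α * ζ ^ j - 1) / (1 - ζ) := by
      rw [hx]; field_simp; ring
    rw [this, map_div₀] at h4
    rw [pow_one]
    exact (div_lt_one₀ (zero_lt_iff.mpr hvl0)).mp h4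
lemma s2 (h : LD v p ϖ I φ) (hζ : IsPrimitiveRoot ζ p) {θ : E} (hθ : Eig p I ζ θ) (hv : v θ = 1) :
    ∃ a : E, a ≠ 0 ∧ (∀ σ ∈ I, σ ζ = ζ → σ a = a) ∧ v ((θ * a) ^ p - 1) < 1 := by
  obtain ⟨f, hf, hφ⟩ := h.ford
  have hα0 : θ ^ p ≠ 0 := pow_ne_zero _ hθ.nz
  have hvα : v (θ ^ p) = 1 := by rw [map_pow, hv, one_pow]
  have key : ∀ i, Cg v ((φ ^ i) (θ ^ p)) ((θ ^ p) ^ (p ^ i)) := by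
    intro i
    induction i with
    | zero => simpa using Cg.refl' hvα.le
    | succ i ih =>
      rw [pow_succ', AlgEquiv.mul_apply, pow_succ p, pow_mul]
      exact (h.φcg ih.l).trans' (ih.pow' p)
  have h1 := key f
  rw [hφ, AlgEquiv.one_apply] at h1
  refine ⟨((θ ^ p) ^ (p ^ (f - 1)))⁻¹, by positivity, ?_, ?_⟩
  · intro σ hσ hz; rw [map_inv₀, map_pow, map_pow, hθ.eq σ hσ hz]
  · have h2 := h1.mul' (Cg.refl' (v := v) (x := ((θ ^ p) ^ (p ^ f))⁻¹) (by simp only [map_inv₀, map_pow, hv]; simp))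
    rw [mul_inv_cancel₀ (pow_ne_zero _ hα0)] at h2
    convert h2.s using 3
    rw [mul_pow, inv_pow, ← pow_mul, ← pow_succ, Nat.sub_add_cancel hf]
lemma core1 (h : LD v p ϖ I φ) (hζ : IsPrimitiveRoot ζ p) {η : E} (hη : η ^ p = ζ) {θ : E} (hθ : Eig p I ζ θ)
    (hv : v θ = 1) {σ} (hσ : σ ∈ I) (hση : σ η = η) : σ θ = θ := by
  have hz : σ ζ = ζ := by rw [← hη, map_pow, hση]
  obtain ⟨a, ha0, haH, ha⟩ := h.s2 hζ hθ hv
  have h1 : Eig p I ζ (θ * a) := hθ.mul (Eig.of_fixed ha0 haH)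
  obtain ⟨j, hj⟩ := h.s3 hζ hη h1 ha
  have hη0 : η ≠ 0 := by rintro rfl; rw [zero_pow h.hp.ne_zero] at hη; exact hζ.ne_zero h.hp.ne_zero hη.symm
  have hηE : Eig p I ζ η := ⟨hη0, fun σ hσ hz => by rw [← map_pow, hη, hz]⟩
  have := h.s45 hζ (h1.mul (hηE.pow j)) hj σ hσ hz
  rw [map_mul, map_mul, map_pow, hση, haH σ hσ hz] at this
  exact mul_right_cancel₀ ha0 (mul_right_cancel₀ (pow_ne_zero j hη0) this)
/-- odd case -/
lemma core_odd (h : LD v p ϖ I φ) (hp2 : p ≠ 2) (hζ : IsPrimitiveRoot ζ p) {η : E} (hη : η ^ p = ζ) {θ : E} (hθ : Eig p I ζ θ)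
    {σ} (hσ : σ ∈ I) (hση : σ η = η) : σ θ = θ := by
  have hz : σ ζ = ζ := by rw [← hη, map_pow, hση]
  have hl0 := h.lam0 hζ
  have hvl0 := h.vl0 hζ
  obtain ⟨m, hm⟩ := h.disc hζ (pow_ne_zero p hθ.nz) (fun σ hσ hz => by rw [map_pow, hθ.eq σ hσ hz])
  have hcop : Nat.Coprime 2 p := by
    rw [Nat.coprime_two_left]; exact h.hp.odd_of_ne_two hp2
  obtain ⟨τ, hτ, hτζ⟩ := h.surj hζ (hζ.pow_of_coprime 2 hcop)
  have hτ0 : τ θ ≠ 0 := by simpa using hθ.nz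
  obtain ⟨r, hr⟩ := h.disc hζ (div_ne_zero hτ0 (pow_ne_zero 2 hθ.nz)) (h.beta hζ hθ hτζ)
  obtain ⟨k, rfl⟩ : ∃ k : ℤ, m = p * k := by
    refine ⟨-r, ?_⟩
    rw [map_div₀, h.hIv τ hτ, map_pow] at hr
    have hvθ : v θ ≠ 0 := (Valuation.ne_zero_iff v).mpr hθ.nz
    have h1 : v θ = v (1 - ζ) ^ (-r) := by
      rw [zpow_neg, ← hr]; field_simp
    apply zpow_inj' hvl0 (h.vl1 hζ)
    rw [← hm, map_pow, h1, ← zpow_natCast, ← zpow_mul, mul_comm]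
  have hθv : v θ = v (1 - ζ) ^ k := by
    rw [map_pow, mul_comm, zpow_mul, zpow_natCast] at hm
    exact (pow_left_inj₀ zero_le zero_le h.hp.ne_zero).mp hm
  have hlE : Eig p I ζ ((1 - ζ) ^ (-k)) :=
    (Eig.of_fixed hl0 (fun σ hσ hz => by rw [map_sub, map_one, hz])).zpow _
  have := h.core1 hζ hη (hθ.mul hlE) (by
    rw [map_mul, map_zpow₀, hθv, ← zpow_add₀ hvl0]; simp) hσ hση
  rw [map_mul, map_zpow₀, map_sub, map_one, hz] at this
  exact mul_right_cancel₀ hlE.nz this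
lemma core_two (h : LD v 2 ϖ I φ) {η : E} (hη : η ^ 2 = -1) {s : E} (hs : s ^ 2 = 2) {θ : E}
    (hθ : Eig 2 I (-1) θ) {σ} (hσ : σ ∈ I) (hση : σ η = η) (hσs : σ s = s) : σ θ = θ := by
  have hζ : IsPrimitiveRoot (-1 : E) 2 := IsPrimitiveRoot.neg_one 0 (by norm_num)
  obtain ⟨m, hm⟩ := h.disc hζ (pow_ne_zero 2 hθ.nz) (fun σ hσ hz => by rw [map_pow, hθ.eq σ hσ hz])
  have hs0 : s ≠ 0 := by rintro rfl; norm_num at hs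
  have hsE : Eig 2 I (-1) (s ^ (-m)) :=
    Eig.zpow (⟨hs0, fun σ _ _ => by rw [← map_pow, hs]; exact map_ofNat σ 2⟩ : Eig 2 I (-1) s) _
  have hvs : v s ^ 2 = v (1 - (-1 : E)) := by rw [← map_pow, hs]; norm_num
  have hvs0 : v s ≠ 0 := (Valuation.ne_zero_iff v).mpr hs0
  have := h.core1 hζ hη (hθ.mul hsE) (by
    rw [map_mul, map_zpow₀]
    rw [← hvs, map_pow, ← zpow_natCast, ← zpow_natCast, zpow_comm, zpow_natCast, zpow_natCast] at hm
    rw [(pow_left_inj₀ zero_le zero_le two_ne_zero).mp hm, ← zpow_add₀ hvs0]; simp) hσ hση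
  rw [map_mul, map_zpow₀, hσs] at this
  exact mul_right_cancel₀ hsE.nz this
end LD
end D4
end PartD4

section PartD5
open scoped Real
open NumberField
set_option linter.all false
set_option linter.unusedSectionVars false
section D5
variable {E : Type*} [Field E] [CharZero E] {Γ : Type*} [LinearOrderedCommGroupWithZero Γ]
variable {v : Valuation E Γ} {p : ℕ} {ϖ : E} {I : Subgroup (E ≃ₐ[ℚ] E)} {φ : E ≃ₐ[ℚ] E} {ζ : E}

lemma exists_resolvent (H : Subgroup (E ≃ₐ[ℚ] E)) [Fintype H] (c : H → E) (hc : c 1 ≠ 0) :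
    ∃ z : E, ∑ σ : H, c σ * (σ : E ≃ₐ[ℚ] E) z ≠ 0 := by
  by_contra hcon
  push Not at hcon
  have hli := linearIndependent_monoidHom E E
  have hinj : Function.Injective (fun σ : H => ((σ : E ≃ₐ[ℚ] E) : E →* E)) := by
    intro a b hab
    apply Subtype.ext
    ext x
    exact DFunLike.congr_fun hab x
  have h2 := hli.comp _ hinj
  rw [Fintype.linearIndependent_iff] at h2
  refine hc (h2 c ?_ 1)
  ext z
  simpa using hcon z

def Hsub (I : Subgroup (E ≃ₐ[ℚ] E)) (ζ : E) : Subgroup (E ≃ₐ[ℚ] E) where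
  carrier := {σ | σ ∈ I ∧ σ ζ = ζ}
  mul_mem' := fun {a b} ha hb => ⟨I.mul_mem ha.1 hb.1, by rw [AlgEquiv.mul_apply, hb.2, ha.2]⟩
  one_mem' := ⟨I.one_mem, rfl⟩
  inv_mem' := fun {a} ha => ⟨I.inv_mem ha.1, by
    conv_lhs => rw [← ha.2]
    rw [← AlgEquiv.mul_apply, inv_mul_cancel]; rfl⟩

lemma LD.resolv (h : LD v p ϖ I φ) [Finite (E ≃ₐ[ℚ] E)] (hζ : IsPrimitiveRoot ζ p) {σ₀ : E ≃ₐ[ℚ] E} (h₀ : σ₀ ∈ Hsub I ζ)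
    (hfix : ∀ θ, Eig p I ζ θ → σ₀ θ = θ) : ∃ τ ∈ Hsub I ζ, σ₀ = τ ^ p := by
  classical
  by_contra hcon
  have hp0 : NeZero p := ⟨h.hp.ne_zero⟩
  let H := Hsub I ζ
  letI : CommGroup H := { (inferInstance : Group H) with mul_comm := fun a b => Subtype.ext (h.comm a b) }
  have : Finite H := inferInstance
  let _ : Fintype H := Fintype.ofFinite H
  let Q := H ⧸ (powMonoidHom p : H →* H).range
  have hQ : ∀ x : Q, x ^ p = 1 := by
    intro x
    obtain ⟨y, rfl⟩ := QuotientGroup.mk_surjective x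
    rw [← QuotientGroup.mk_pow, QuotientGroup.eq_one_iff]
    exact ⟨y, rfl⟩
  have hex : Monoid.exponent Q ∣ p := Monoid.exponent_dvd_of_forall_pow_eq_one hQ
  have : HasEnoughRootsOfUnity E p := ⟨⟨ζ, hζ⟩, inferInstance⟩
  have : HasEnoughRootsOfUnity E (Monoid.exponent Q) := HasEnoughRootsOfUnity.of_dvd E hex
  have : NeZero (Monoid.exponent Q) := ⟨fun h0 => h.hp.ne_zero (by rw [h0] at hex; exact zero_dvd_iff.mp hex)⟩
  have hne : (QuotientGroup.mk (⟨σ₀, h₀⟩ : H) : Q) ≠ 1 := by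
    intro h1
    rw [QuotientGroup.eq_one_iff] at h1
    obtain ⟨τ, hτ⟩ := h1
    exact hcon ⟨τ, τ.2, (congrArg Subtype.val hτ).symm⟩
  obtain ⟨χ, hχ⟩ := CommGroup.exists_apply_ne_one_of_hasEnoughRootsOfUnity Q E hne
  let c : H →* Eˣ := χ.comp (QuotientGroup.mk' _)
  have hcp : ∀ σ : H, (c σ : E) ^ p = 1 := by
    intro σ
    have : c σ ^ p = 1 := by
      change χ (QuotientGroup.mk' _ σ) ^ p = 1
      rw [← map_pow, hQ, map_one]
    simpa using congrArg Units.val this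
  have hcfix : ∀ σ τ : H, (σ : E ≃ₐ[ℚ] E) (c τ : E) = c τ := by
    intro σ τ
    obtain ⟨i, -, hi⟩ := hζ.eq_pow_of_pow_eq_one (hcp τ)
    rw [← hi, map_pow, σ.2.2]
  obtain ⟨z, hz⟩ := exists_resolvent H (fun σ => ((c σ)⁻¹ : Eˣ)) (by simp)
  set θ := ∑ σ : H, (((c σ)⁻¹ : Eˣ) : E) * (σ : E ≃ₐ[ℚ] E) z with hθ
  have hτθ : ∀ τ : H, (τ : E ≃ₐ[ℚ] E) θ = c τ * θ := by
    intro τ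
    rw [hθ, map_sum, Finset.mul_sum]
    refine Fintype.sum_bijective (fun σ => τ * σ) (Group.mulLeft_bijective τ) _ _ ?_
    intro σ
    rw [map_mul, Units.val_inv_eq_inv_val, map_inv₀, hcfix, map_mul, mul_inv, Units.val_mul, ← mul_assoc, Units.val_inv_eq_inv_val, Units.val_inv_eq_inv_val]
    rw [← mul_assoc, mul_inv_cancel₀ (Units.ne_zero _), one_mul]
    rfl
  have hE : Eig p I ζ θ := ⟨hz, fun σ hσ hσζ => by
    have := hτθ ⟨σ, hσ, hσζ⟩
    simp only at this
    rw [this, mul_pow, hcp, one_mul]⟩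
  have h1 := hfix θ hE
  have h2 := hτθ ⟨σ₀, h₀⟩
  simp only at h2
  rw [h1] at h2
  apply hχ
  have h3 : (c ⟨σ₀, h₀⟩ : E) = 1 := mul_right_cancel₀ hz (by rw [← h2, one_mul])
  exact Units.ext h3

lemma LD.order_pow (h : LD v p ϖ I φ) [Finite (E ≃ₐ[ℚ] E)] (hζ : IsPrimitiveRoot ζ p) {σ : E ≃ₐ[ℚ] E} (hσ : σ ∈ Hsub I ζ) :
    ∃ k, orderOf σ = p ^ k := by
  obtain ⟨k, q, hq, e⟩ := Nat.exists_eq_pow_mul_and_not_dvd (orderOf_pos σ).ne' p h.hp.ne_one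
  refine ⟨k, ?_⟩
  have h1 := (Hsub I ζ).pow_mem hσ (p ^ k)
  have h2 := h.tame_order hζ h1.1 h1.2 hq (by rw [← pow_mul, ← e, pow_orderOf_eq_one])
  have h3 := orderOf_dvd_of_pow_eq_one h2
  exact Nat.dvd_antisymm h3 (e ▸ dvd_mul_right _ _)

lemma gen_of_pow {G : Type*} [Group G] (comm : ∀ a b : G, a * b = b * a) (H S : Subgroup G) (p n : ℕ)
    (h1 : ∀ h ∈ H, h ^ p ^ n = 1) (h2 : ∀ h ∈ H, ∃ s ∈ S, ∃ h' ∈ H, h = s * h' ^ p) : H ≤ S := by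
  have key : ∀ m, ∀ h ∈ H, ∃ s ∈ S, ∃ h' ∈ H, h = s * h' ^ p ^ m := by
    intro m
    induction m with
    | zero => intro h hh; exact ⟨1, S.one_mem, h, hh, by simp⟩
    | succ m ih =>
      intro h hh
      obtain ⟨s, hs, h', hh', rfl⟩ := ih h hh
      obtain ⟨t, ht, h'', hh'', rfl⟩ := h2 h' hh'
      refine ⟨s * t ^ p ^ m, S.mul_mem hs (S.pow_mem ht _), h'', hh'', ?_⟩
      rw [(show Commute t (h'' ^ p) from comm _ _).mul_pow, ← pow_mul, ← pow_succ', mul_assoc]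
  intro h hh
  obtain ⟨s, hs, h', hh', rfl⟩ := key n h hh
  rw [h1 h' hh', mul_one]; exact hs

lemma arith_odd {p : ℕ} (hp : p.Prime) (hp2 : p ≠ 2) {m k e : ℕ} (h1 : (p : ℤ) ∣ m - 1) (h2 : ¬ ((p : ℤ) ^ 2 ∣ m - 1))
    (h3 : (p : ℤ) ^ e ∣ (m : ℤ) ^ k - 1) : p ^ (e - 1) ∣ k := by
  have hm : ¬ (p : ℤ) ∣ m := fun hd => by
    have : (p : ℤ) ∣ 1 := by simpa using dvd_sub hd h1
    exact hp.one_lt.ne' (by exact_mod_cast Int.eq_one_of_dvd_one (by positivity) this)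
  have h4 := Int.emultiplicity_pow_sub_pow hp (hp.odd_of_ne_two hp2) (x := m) (y := 1) h1 hm k
  rw [one_pow] at h4
  have h5 := le_emultiplicity_of_pow_dvd h3
  have h6 : emultiplicity (p : ℤ) ((m : ℤ) - 1) ≤ 1 := by
    have := emultiplicity_lt_iff_not_dvd.mpr h2
    exact ENat.lt_add_one_iff (by simp) |>.mp (by simpa [one_add_one_eq_two] using this)
  rw [h4] at h5
  rcases e with _ | e
  · simp
  apply pow_dvd_of_le_emultiplicity
  have h7 : ((e + 1 : ℕ) : ℕ∞) ≤ 1 + emultiplicity p k := h5.trans (by gcongr)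
  push_cast at h7
  rw [add_comm (1 : ℕ∞)] at h7
  simpa using (ENat.add_le_add_iff_right (by simp)).mp h7

lemma arith_two {m k e : ℕ} (h1 : m % 8 = 5) (h3 : (2 : ℤ) ^ e ∣ (m : ℤ) ^ k - 1) : 2 ^ (e - 2) ∣ k := by
  have hm : ¬ (2 : ℤ) ∣ m := by omega
  have h4 := Int.two_pow_sub_pow' k (x := m) (y := 1) (by omega) hm
  rw [one_pow] at h4
  have h5 := le_emultiplicity_of_pow_dvd h3
  have h6 : emultiplicity (2 : ℤ) ((m : ℤ) - 1) ≤ 2 := by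
    have := emultiplicity_lt_iff_not_dvd (a := (2 : ℤ)) (b := (m : ℤ) - 1) (k := 3) |>.mpr (by omega)
    exact ENat.lt_add_one_iff (by simp) |>.mp (by simpa [two_add_one_eq_three] using this)
  rw [h4] at h5
  rcases Nat.lt_or_ge e 2 with he | he
  · rw [show e - 2 = 0 by omega]; simp
  obtain ⟨e, rfl⟩ := Nat.exists_eq_add_of_le' he
  have : ((2 : ℤ) ^ e) ∣ (k : ℤ) := by
    apply pow_dvd_of_le_emultiplicity
    have h7 : ((e + 2 : ℕ) : ℕ∞) ≤ 2 + emultiplicity (2 : ℤ) (k : ℤ) := h5.trans (by gcongr)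
    push_cast at h7
    rw [add_comm (2 : ℕ∞)] at h7
    simpa using (ENat.add_le_add_iff_right (by simp)).mp h7
  simpa using (by exact_mod_cast this : 2 ^ e ∣ k)
end D5
end PartD5

section PartD6
open scoped Real
open NumberField
set_option linter.all false
set_option linter.unusedSectionVars false
section D6
variable {E : Type*} [Field E] [CharZero E] {Γ : Type*} [LinearOrderedCommGroupWithZero Γ]
variable {v : Valuation E Γ} {p : ℕ} {ϖ : E} {I : Subgroup (E ≃ₐ[ℚ] E)} {φ : E ≃ₐ[ℚ] E} {ζ : E}

lemma aut_pow_exp {g : E ≃ₐ[ℚ] E} {μ : E} {m : ℕ} (hg : g μ = μ ^ m) (k : ℕ) : (g ^ k) μ = μ ^ m ^ k := by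
  induction k with
  | zero => simp
  | succ k ih => rw [pow_succ, AlgEquiv.mul_apply, hg, map_pow, ih, ← pow_mul, ← pow_succ]

lemma prim_pow_congr {μ : E} {n a b : ℕ} (hμ : IsPrimitiveRoot μ n) (hab : a ≡ b [MOD n]) : μ ^ a = μ ^ b := by
  rw [← pow_mod_orderOf μ a, ← pow_mod_orderOf μ b, ← hμ.eq_orderOf, hab]

lemma prim_pow_eq {μ : E} {n : ℕ} (hμ : IsPrimitiveRoot μ n) (hn : 0 < n) {a b : ℕ} (h : μ ^ a = μ ^ b) : (n : ℤ) ∣ (a : ℤ) - b := by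
  have : NeZero n := ⟨hn.ne'⟩
  have h1 := (IsPrimitiveRoot.isUnit hμ hn.ne')
  rcases le_total b a with hab | hab
  · obtain ⟨c, rfl⟩ := Nat.exists_eq_add_of_le hab
    rw [pow_add] at h
    have : μ ^ c = 1 := mul_left_cancel₀ (pow_ne_zero b (hμ.ne_zero hn.ne')) (by rw [h, mul_one])
    push_cast; rw [add_sub_cancel_left]; exact_mod_cast hμ.dvd_of_pow_eq_one c this
  · obtain ⟨c, rfl⟩ := Nat.exists_eq_add_of_le hab
    rw [pow_add] at h
    have : μ ^ c = 1 := mul_left_cancel₀ (pow_ne_zero a (hμ.ne_zero hn.ne')) (by rw [← h, mul_one])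
    push_cast; rw [sub_add_cancel_left, dvd_neg]; exact_mod_cast hμ.dvd_of_pow_eq_one c this

lemma aut_exp {μ : E} {n : ℕ} (hμ : IsPrimitiveRoot μ n) (hn : 0 < n) (g : E ≃ₐ[ℚ] E) : ∃ m : ℕ, g μ = μ ^ m := by
  have : NeZero n := ⟨hn.ne'⟩
  obtain ⟨i, -, hi⟩ := hμ.eq_pow_of_pow_eq_one (ξ := g μ) (by rw [← map_pow, hμ.pow_eq_one, map_one])
  exact ⟨i, hi.symm⟩

theorem LD.T_odd (h : LD v p ϖ I φ) [Finite (E ≃ₐ[ℚ] E)] (hp2 : p ≠ 2) {e : ℕ} {μ : E}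
    (hμ : IsPrimitiveRoot μ (p ^ (e + 2)))
    (hexp : ∀ σ ∈ Hsub I (μ ^ p ^ (e + 1)), σ ^ p ^ (e + 1) = 1) {t : E ≃ₐ[ℚ] E} (ht : t ∈ I) (htμ : t μ = μ) : t = 1 := by
  have hp0 : NeZero p := ⟨h.hp.ne_zero⟩
  have hpp : 0 < p ^ (e + 2) := pow_pos h.hp.pos _
  obtain ⟨ζ, hζd⟩ : ∃ ζ, ζ = μ ^ p ^ (e + 1) := ⟨_, rfl⟩
  obtain ⟨η, hηd⟩ : ∃ η, η = μ ^ p ^ e := ⟨_, rfl⟩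
  rw [← hζd] at hexp
  have hζ : IsPrimitiveRoot ζ p := by
    rw [hζd]; exact hμ.pow hpp (by ring)
  have hη' : IsPrimitiveRoot η (p ^ 2) := by
    rw [hηd]; exact hμ.pow hpp (by ring)
  have hη : η ^ p = ζ := by rw [hηd, hζd, ← pow_mul, ← pow_succ]
  have hη0 : η ≠ 0 := hη'.ne_zero (pow_pos h.hp.pos _).ne'
  have htH : t ∈ Hsub I ζ := ⟨ht, by rw [hζd, map_pow, htμ]⟩
  have hH1 : ∀ σ ∈ Hsub I ζ, σ η = η → ∃ τ ∈ Hsub I ζ, σ = τ ^ p := fun σ hσ hση =>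
    h.resolv hζ hσ (fun θ hθ => h.core_odd hp2 hζ hη hθ hσ.1 hση)
  have hact : ∀ σ ∈ Hsub I ζ, ∃ i : ℕ, σ η = ζ ^ i * η := fun σ hσ =>
    h.eig_const hζ ⟨hη0, fun σ _ hz => by rw [← map_pow, hη, hz]⟩ hσ.1 hσ.2
  by_cases hg : ∃ g ∈ Hsub I ζ, g η ≠ η
  · obtain ⟨g, hgH, hgη⟩ := hg
    obtain ⟨j, hj⟩ := hact g hgH
    have hpj : ¬ p ∣ j := by
      rintro ⟨c, rfl⟩
      rw [pow_mul, hζ.pow_eq_one, one_pow, one_mul] at hj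
      exact hgη hj
    have hgk : ∀ k : ℕ, (g ^ k) η = ζ ^ (j * k) * η := by
      intro k
      induction k with
      | zero => simp
      | succ k ih => rw [pow_succ, AlgEquiv.mul_apply, hj, map_mul, map_pow, ((Hsub I ζ).pow_mem hgH k).2, ih]; ring
    have hle : Hsub I ζ ≤ Subgroup.zpowers g := by
      refine gen_of_pow h.comm _ _ p (e + 1) hexp ?_
      intro s hs
      obtain ⟨i, hi⟩ := hact s hs
      have : Fact p.Prime := ⟨h.hp⟩
      have hj0 : (j : ZMod p) ≠ 0 := fun h0 => hpj ((ZMod.natCast_eq_zero_iff j p).mp h0)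
      let k := ((i : ZMod p) / j).val
      have hk : ((j * k : ℕ) : ZMod p) = i := by
        push_cast; simp only [k, ZMod.natCast_val, ZMod.cast_id', id]; field_simp
      have hk' : ζ ^ (j * k) = ζ ^ i := by
        exact prim_pow_congr hζ ((ZMod.natCast_eq_natCast_iff _ _ _).mp hk)
      have hgk' : (g ^ k) η = s η := by rw [hgk, hk', hi]
      have hmem : (g ^ k)⁻¹ * s ∈ Hsub I ζ := (Hsub I ζ).mul_mem ((Hsub I ζ).inv_mem ((Hsub I ζ).pow_mem hgH k)) hs
      obtain ⟨τ, hτ, hτe⟩ := hH1 _ hmem (by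
        rw [AlgEquiv.mul_apply, ← hgk', ← AlgEquiv.mul_apply, inv_mul_cancel]; rfl)
      exact ⟨g ^ k, Subgroup.mem_zpowers_iff.mpr ⟨k, by simp⟩, τ, hτ, by rw [← hτe, mul_inv_cancel_left]⟩
    obtain ⟨k, hk⟩ := (mem_powers_iff_mem_zpowers (x := g)).mpr (hle htH)
    simp only at hk
    obtain ⟨m, hm⟩ := aut_exp hμ hpp g
    have hzm : ζ ^ m = ζ ^ 1 := by
      rw [pow_one, hζd, pow_right_comm, ← hm, ← map_pow, ← hζd]; exact hgH.2
    have h1 := prim_pow_eq hζ h.hp.pos hzm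
    have h2 : ¬ ((p : ℤ) ^ 2 ∣ (m : ℤ) - 1) := by
      intro hd
      apply hgη
      rw [hηd, map_pow, hm, pow_right_comm, ← hηd]
      conv_rhs => rw [← pow_one η]
      exact prim_pow_congr hη' ((Nat.modEq_iff_dvd.mpr (by exact_mod_cast hd)) : 1 ≡ m [MOD p ^ 2]).symm
    have h3 : (p : ℤ) ^ (e + 2) ∣ (m : ℤ) ^ k - 1 := by
      have := prim_pow_eq hμ hpp (a := m ^ k) (b := 1) (by rw [← aut_pow_exp hm, hk, htμ, pow_one])
      exact_mod_cast this
    obtain ⟨c, hc⟩ := arith_odd h.hp hp2 (by exact_mod_cast h1) h2 h3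
    rw [← hk, hc, show e + 2 - 1 = e + 1 by omega, pow_mul, hexp g hgH, one_pow]
  · push Not at hg
    have hle : Hsub I ζ ≤ ⊥ := by
      refine gen_of_pow h.comm _ _ p (e + 1) hexp ?_
      intro s hs
      obtain ⟨τ, hτ, hτe⟩ := hH1 s hs (hg s hs)
      exact ⟨1, Subgroup.one_mem _, τ, hτ, by rw [one_mul, hτe]⟩
    exact Subgroup.mem_bot.mp (hle htH)

theorem LD.T_two (h : LD v 2 ϖ ⊤ φ) [Finite (E ≃ₐ[ℚ] E)] {e : ℕ} {μ : E}
    (hμ : IsPrimitiveRoot μ (2 ^ (e + 3)))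
    (hexp : ∀ σ : E ≃ₐ[ℚ] E, σ ^ 2 ^ (e + 1) = 1)
    {c g : E ≃ₐ[ℚ] E} (hc : c μ = μ⁻¹) (hc2 : c ^ 2 = 1) {m : ℕ} (hg : g μ = μ ^ m) (hm : m % 8 = 5)
    {t : E ≃ₐ[ℚ] E} (htμ : t μ = μ) : t = 1 := by
  have hpp : 0 < 2 ^ (e + 3) := pow_pos two_pos _
  have hμ0 : μ ≠ 0 := hμ.ne_zero hpp.ne'
  obtain ⟨ω, hω⟩ : ∃ ω, ω = μ ^ 2 ^ e := ⟨_, rfl⟩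
  have hω8 : IsPrimitiveRoot ω 8 := by
    rw [hω]; exact hμ.pow hpp (by ring)
  have hω0 : ω ≠ 0 := hω8.ne_zero (by norm_num)
  have hω4 : ω ^ 4 = -1 := (hω8.pow (by norm_num) (show 8 = 4 * 2 by norm_num)).eq_neg_one_of_two_right
  have hζ : IsPrimitiveRoot (-1 : E) 2 := IsPrimitiveRoot.neg_one 0 (by norm_num)
  have hs : (ω + ω⁻¹) ^ 2 = 2 := by
    have : ω⁻¹ = - ω ^ 3 := by
      rw [inv_eq_iff_eq_inv, eq_comm]; apply inv_eq_of_mul_eq_one_left; linear_combination -hω4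
    rw [this]; linear_combination (ω ^ 2 - 2 : E) * hω4
  have hη : (ω ^ 2) ^ 2 = -1 := by rw [← pow_mul, hω4]
  have hH1 : ∀ σ : E ≃ₐ[ℚ] E, σ ω = ω → ∃ τ : E ≃ₐ[ℚ] E, σ = τ ^ 2 := fun σ hσ => by
    obtain ⟨τ, -, hτ⟩ := h.resolv hζ (σ₀ := σ) ⟨Subgroup.mem_top _, by simp⟩ (fun θ hθ =>
      h.core_two hη hs hθ (Subgroup.mem_top _) (by rw [map_pow, hσ]) (by rw [map_add, map_inv₀, hσ]))
    exact ⟨τ, hτ⟩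
  have hgω : g ω = ω ^ 5 := by
    rw [hω, map_pow, hg, pow_right_comm, ← hω]
    exact prim_pow_congr hω8 hm
  have hcω : c ω = ω ^ 7 := by
    rw [hω, map_pow, hc, inv_pow, ← hω]
    apply inv_eq_of_mul_eq_one_left
    rw [← pow_succ, hω8.pow_eq_one]
  have hcc : c * c = 1 := by rw [← pow_two, hc2]
  let S : Subgroup (E ≃ₐ[ℚ] E) := 
    { carrier := {s | ∃ k l : ℕ, s = g ^ k * c ^ l}
      one_mem' := ⟨0, 0, by simp⟩
      mul_mem' := by
        rintro a b ⟨k, l, rfl⟩ ⟨k', l', rfl⟩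
        refine ⟨k + k', l + l', ?_⟩
        rw [pow_add, pow_add, mul_assoc, mul_assoc, ← mul_assoc (c ^ l), h.comm (c ^ l), mul_assoc]
      inv_mem' := by
        rintro a ⟨k, l, rfl⟩
        obtain ⟨k', hk'⟩ : ∃ k' : ℕ, (g ^ k)⁻¹ = g ^ k' := by
          obtain ⟨k', hk'⟩ := (mem_powers_iff_mem_zpowers (x := g) (y := (g ^ k)⁻¹)).mpr
            ((Subgroup.zpowers g).inv_mem ((Subgroup.zpowers g).pow_mem (Subgroup.mem_zpowers g) k))
          exact ⟨k', hk'.symm⟩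
        refine ⟨k', l, ?_⟩
        rw [mul_inv_rev, hk', h.comm]
        congr 1
        rw [← inv_pow, inv_eq_of_mul_eq_one_right hcc] }
  have hle : (⊤ : Subgroup (E ≃ₐ[ℚ] E)) ≤ S := by
    refine gen_of_pow h.comm _ _ 2 (e + 1) (fun σ _ => hexp σ) ?_
    intro s _
    obtain ⟨i, hi⟩ := aut_exp hω8 (by norm_num) s
    have key : ∀ r : E ≃ₐ[ℚ] E, r ∈ S → r ω = s ω → ∃ s' ∈ S, ∃ h' ∈ (⊤ : Subgroup (E ≃ₐ[ℚ] E)), s = s' * h' ^ 2 := by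
      intro r hr hrs
      obtain ⟨τ, hτ⟩ := hH1 (r⁻¹ * s) (by rw [AlgEquiv.mul_apply, ← hrs, ← AlgEquiv.mul_apply, inv_mul_cancel]; rfl)
      exact ⟨r, hr, τ, Subgroup.mem_top _, by rw [← hτ, mul_inv_cancel_left]⟩
    have hmod : ∀ j : ℕ, i % 8 = j % 8 → ω ^ j = s ω := by
      intro j hj
      rw [hi]; exact prim_pow_congr hω8 hj.symm
    have hodd : i % 2 = 1 := by
      by_contra hcon
      have h1 : (s ω) ^ 4 = 1 := by
        rw [hi, ← pow_mul, show i * 4 = 8 * (i / 2) by omega, pow_mul, hω8.pow_eq_one, one_pow]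
      rw [← map_pow, hω4] at h1
      simp at h1
      norm_num at h1
    have hcases : i % 8 = 1 ∨ i % 8 = 3 ∨ i % 8 = 5 ∨ i % 8 = 7 := by omega
    rcases hcases with h1 | h1 | h1 | h1
    · exact key 1 S.one_mem (by rw [← hmod 1 (by omega)]; simp)
    · exact key (g * c) ⟨1, 1, by simp⟩ (by
        rw [← hmod 35 (by omega), AlgEquiv.mul_apply, hcω, map_pow, hgω, ← pow_mul])
    · exact key g ⟨1, 0, by simp⟩ (by rw [← hmod 5 (by omega), hgω])
    · exact key c ⟨0, 1, by simp⟩ (by rw [← hmod 7 (by omega), hcω])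
  obtain ⟨k, l, hkl⟩ := hle (Subgroup.mem_top t)
  have hm1 : ∀ k : ℕ, m ^ k % 4 = 1 := by
    intro k
    rw [Nat.pow_mod, show m % 4 = 1 by omega]; simp
  rcases Nat.even_or_odd' l with ⟨l', rfl | rfl⟩
  · rw [pow_mul, hc2, one_pow, mul_one] at hkl
    have h3 : (2 : ℤ) ^ (e + 3) ∣ (m : ℤ) ^ k - 1 := by
      have := prim_pow_eq hμ hpp (a := m ^ k) (b := 1) (by rw [← aut_pow_exp hg, ← hkl, htμ, pow_one])
      exact_mod_cast this
    obtain ⟨d, hd⟩ := arith_two hm h3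
    rw [hkl, hd, show e + 3 - 2 = e + 1 by omega, pow_mul, hexp, one_pow]
  · exfalso
    rw [pow_succ, pow_mul, hc2, one_pow, one_mul] at hkl
    have h1 : t ω = ω := by rw [hω, map_pow, htμ]
    rw [hkl, AlgEquiv.mul_apply, hcω, map_pow, aut_pow_exp hgω, ← pow_mul] at h1
    have h2 := prim_pow_eq hω8 (by norm_num) (b := 1) (by rw [h1, pow_one])
    have h3 : 5 ^ k % 4 = 1 := by rw [Nat.pow_mod]; simp
    push_cast at h2
    have h3' : (5 : ℤ) ^ k % 4 = 1 := by exact_mod_cast h3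
    omega
end D6
end PartD6

section PartD7
open scoped Real
open NumberField
set_option linter.all false
set_option linter.unusedSectionVars false
section D7
variable {E : Type*} [Field E] [NumberField E]

lemma liesOver_of_mem {p : ℕ} (hp : p.Prime) (P : Ideal (𝓞 E)) [P.IsPrime] (hpP : (p : 𝓞 E) ∈ P) :
    P.LiesOver (Ideal.span {(p : ℤ)}) :=
  (Ideal.liesOver_span_iff Ideal.IsPrime.ne_top' (Nat.prime_iff_prime_int.mp hp)).mpr (by simpa using hpP)

lemma span_ne_bot {p : ℕ} (hp : p.Prime) : Ideal.span {(p : ℤ)} ≠ ⊥ := by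
  simpa using hp.ne_zero

lemma prime_ne_bot {p : ℕ} (hp : p.Prime) (P : Ideal (𝓞 E)) (hpP : (p : 𝓞 E) ∈ P) : P ≠ ⊥ := by
  rintro rfl
  exact hp.ne_zero (by exact_mod_cast (Ideal.mem_bot.mp hpP))

lemma e_abs [IsGalois ℚ E] {p : ℕ} (hp : p.Prime) (P : Ideal (𝓞 E)) [P.IsPrime] (hpP : (p : 𝓞 E) ∈ P) :
    (Ideal.span {(p : ℤ)}).ramificationIdx' P = Nat.card (P.inertia (E ≃ₐ[ℚ] E)) := by
  have h1 := liesOver_of_mem hp P hpP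
  have h2 := span_ne_bot hp
  have h3 : (Ideal.span {(p : ℤ)}).IsMaximal := have : Fact p.Prime := ⟨hp⟩; Int.ideal_span_isMaximal_of_prime p
  have : Finite (ℤ ⧸ Ideal.span {(p : ℤ)}) := Ring.HasFiniteQuotients.finiteQuotient h2
  rw [Ideal.card_inertia_eq_ramificationIdxIn (Ideal.span {(p : ℤ)}) P,
    Ideal.ramificationIdxIn_eq_ramificationIdx _ P (E ≃ₐ[ℚ] E), Ideal.ramificationIdx'_eq_ramificationIdx _ _ h2]

lemma e_rel [IsGalois ℚ E] {p : ℕ} (hp : p.Prime) (P : Ideal (𝓞 E)) [P.IsPrime] (hpP : (p : 𝓞 E) ∈ P) 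
    (F : IntermediateField ℚ E) (hF : F = IntermediateField.fixedField (P.inertia (E ≃ₐ[ℚ] E))) :
    (P.under (𝓞 F)).ramificationIdx' P = Nat.card (P.inertia (E ≃ₐ[ℚ] E)) := by
  let H : Subgroup (E ≃ₐ[ℚ] E) := P.inertia (E ≃ₐ[ℚ] E)
  have g : IsGaloisGroup H F E := by
    rw [hF]; exact IsGaloisGroup.subgroup (E ≃ₐ[ℚ] E) ℚ E H
  have g1 : SMulDistribClass H (𝓞 E) E := ⟨fun g r s => by
    exact smul_distrib_smul (g : E ≃ₐ[ℚ] E) r s⟩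
  have g' : IsGaloisGroup H (𝓞 F) (𝓞 E) := IsGaloisGroup.of_isFractionRing H (𝓞 F) (𝓞 E) F E
  have h1 := liesOver_of_mem hp P hpP
  have h2 : P.under (𝓞 F) ≠ ⊥ := prime_ne_bot hp _ (by rw [Ideal.mem_comap]; simpa using hpP)
  have : Finite (𝓞 F ⧸ P.under (𝓞 F)) := Ring.HasFiniteQuotients.finiteQuotient h2
  have h3 : (P.under (𝓞 F)).IsMaximal := Ring.DimensionLEOne.maximalOfPrime h2 inferInstance
  have h4 : Nat.card (P.inertia H) = Nat.card H := by
    have : P.inertia H = ⊤ := by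
      ext σ
      simp only [Subgroup.mem_top, iff_true]
      exact σ.2
    rw [this]; exact Nat.card_congr Subgroup.topEquiv.toEquiv
  rw [Ideal.ramificationIdx'_eq_ramificationIdx _ _ h2, ← Ideal.ramificationIdxIn_eq_ramificationIdx (P.under (𝓞 F)) P H, ← Ideal.card_inertia_eq_ramificationIdxIn (G := H) (P.under (𝓞 F)) P, h4]

lemma e_fix [IsGalois ℚ E] {p : ℕ} (hp : p.Prime) (P : Ideal (𝓞 E)) [P.IsPrime] (hpP : (p : 𝓞 E) ∈ P) 
    (F : IntermediateField ℚ E) (hF : F = IntermediateField.fixedField (P.inertia (E ≃ₐ[ℚ] E))) :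
    (Ideal.span {(p : ℤ)}).ramificationIdx' (P.under (𝓞 F)) = 1 := by
  have h1 : (P.under (𝓞 F)).LiesOver (Ideal.span {(p : ℤ)}) := liesOver_of_mem hp _ (by rw [Ideal.mem_comap]; simpa using hpP)
  have h := Ideal.ramificationIdx'_algebra_tower' (Ideal.span {(p : ℤ)}) (P.under (𝓞 F)) P
  rw [e_abs hp P hpP, e_rel hp P hpP F hF] at h
  have : 0 < Nat.card (P.inertia (E ≃ₐ[ℚ] E)) := Nat.card_pos
  exact (Nat.eq_of_mul_eq_mul_right this (by rw [one_mul]; exact h)).symm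

lemma e_one_iff {p : ℕ} (hp : p.Prime) (P : Ideal (𝓞 E)) [P.IsPrime] (hpP : (p : 𝓞 E) ∈ P) :
    (Ideal.span {(p : ℤ)}).ramificationIdx' P = 1 ↔ (p : 𝓞 E) ∉ P ^ 2 := by
  rw [← not_iff_not, ← Ne, Ideal.ramificationIdx'_ne_one_iff, not_not, Ideal.map_span, Ideal.span_le]
  · simp
  · rw [Ideal.map_span, Ideal.span_le]; simpa using hpP

/-- valuations on the inertia field. -/
lemma val_fix [IsGalois ℚ E] {p : ℕ} (hp : p.Prime) (w : IsDedekindDomain.HeightOneSpectrum (𝓞 E)) (hpP : (p : 𝓞 E) ∈ w.asIdeal) 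
    {y : E} (hy0 : y ≠ 0) (hy : ∀ σ ∈ w.asIdeal.inertia (E ≃ₐ[ℚ] E), σ y = y) :
    ∃ n : ℤ, w.valuation E y = w.valuation E (p : E) ^ n := by
  have hP : w.asIdeal.IsPrime := w.isPrime
  obtain ⟨F, hF⟩ : ∃ F, F = IntermediateField.fixedField (w.asIdeal.inertia (E ≃ₐ[ℚ] E)) := ⟨_, rfl⟩
  have hyF : y ∈ F := by rw [hF, IntermediateField.mem_fixedField_iff]; exact hy
  have hpF : (p : 𝓞 F) ∈ w.asIdeal.under (𝓞 F) := by rw [Ideal.mem_comap]; simpa using hpP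
  let u : IsDedekindDomain.HeightOneSpectrum (𝓞 F) := ⟨w.asIdeal.under (𝓞 F), inferInstance, prime_ne_bot hp _ hpF⟩
  have hlo : w.asIdeal.LiesOver u.asIdeal := ⟨rfl⟩
  have hv := fun x : F => IsDedekindDomain.HeightOneSpectrum.valuation_liesOver E u w x
  have h1 := (e_one_iff hp _ hpF).mp (e_fix hp w.asIdeal hpP F hF)
  have hup : u.valuation F (p : F) = WithZero.exp (-1 : ℤ) := by
    have e1 : (p : F) = algebraMap (𝓞 F) F (p : 𝓞 F) := by simp
    rw [e1, IsDedekindDomain.HeightOneSpectrum.valuation_of_algebraMap]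
    have a1 : u.intValuation (p : 𝓞 F) ≤ WithZero.exp (-((1 : ℕ) : ℤ)) := (u.intValuation_le_pow_iff_mem _ 1).mpr (by rw [pow_one]; exact hpF)
    have a2 : ¬ u.intValuation (p : 𝓞 F) ≤ WithZero.exp (-((2 : ℕ) : ℤ)) := fun h => h1 ((u.intValuation_le_pow_iff_mem _ 2).mp h)
    have a3 : u.intValuation (p : 𝓞 F) ≠ 0 := by
      intro h; rw [h] at a2; exact a2 zero_le'
    rw [← WithZero.exp_log a3] at a1 a2 ⊢
    rw [WithZero.exp_le_exp] at a1 a2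
    congr 1; push_cast at a1 a2; omega
  have hy0' : (⟨y, hyF⟩ : F) ≠ 0 := fun h => hy0 (congrArg Subtype.val h)
  have a4 : u.valuation F ⟨y, hyF⟩ ≠ 0 := (Valuation.ne_zero_iff _).mpr hy0'
  refine ⟨-WithZero.log (u.valuation F ⟨y, hyF⟩), ?_⟩
  have k1 := hv ⟨y, hyF⟩
  have k2 := hv (p : F)
  have k3 : algebraMap F E (⟨y, hyF⟩ : F) = y := rfl
  rw [k3] at k1
  rw [map_natCast (algebraMap F E)] at k2
  rw [← k1, ← k2, hup, ← zpow_natCast, ← zpow_natCast, ← zpow_mul, mul_comm, zpow_mul, ← WithZero.exp_zsmul]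
  congr 1
  conv_lhs => rw [← WithZero.exp_log a4]
  congr 1; simp

theorem LD_exists [IsGalois ℚ E] (hab : ∀ σ τ : E ≃ₐ[ℚ] E, σ * τ = τ * σ) {p : ℕ} (hp : p.Prime) 
    (P : Ideal (𝓞 E)) [hP : P.IsPrime] (hpP : (p : 𝓞 E) ∈ P) (φ : E ≃ₐ[ℚ] E) (hφ : ∀ x : 𝓞 E, φ • x - x ^ p ∈ P) :
    ∃ (v : Valuation E (WithZero (Multiplicative ℤ))) (ϖ : E), LD v p ϖ (P.inertia (E ≃ₐ[ℚ] E)) φ := by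
  let w : IsDedekindDomain.HeightOneSpectrum (𝓞 E) := ⟨P, hP, prime_ne_bot hp _ hpP⟩
  obtain ⟨ϖ, hϖ⟩ := w.valuation_exists_uniformizer E
  refine ⟨w.valuation E, ϖ, ?_⟩
  have hlt : ∀ x : 𝓞 E, w.valuation E (algebraMap (𝓞 E) E x) < 1 ↔ x ∈ P := fun x => by
    rw [w.valuation_lt_one_iff_mem]
  have hle : ∀ x : 𝓞 E, w.valuation E (algebraMap (𝓞 E) E x) ≤ 1 := fun x => w.valuation_le_one x
  have hone : ∀ x : 𝓞 E, x ∉ P → w.valuation E (algebraMap (𝓞 E) E x) = 1 := fun x hx => 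
    le_antisymm (hle x) (not_lt.mp (fun h => hx ((hlt x).mp h)))
  have hsm : ∀ (σ : E ≃ₐ[ℚ] E) (x : 𝓞 E), algebraMap (𝓞 E) E (σ • x) = σ (algebraMap (𝓞 E) E x) := fun σ x => rfl
  have hrep : ∀ x : E, w.valuation E x ≤ 1 → ∃ a b : 𝓞 E, b ∉ P ∧ x * algebraMap (𝓞 E) E b = algebraMap (𝓞 E) E a := by
    intro x hx
    obtain ⟨a, b, hb⟩ := w.exists_primeCompl_mul_eq_of_integer x hx
    exact ⟨a, b, b.2, hb⟩
  have hpres : ∀ σ : E ≃ₐ[ℚ] E, (∀ x : 𝓞 E, σ • x ∈ P ↔ x ∈ P) → ∀ x : E, w.valuation E (σ x) = w.valuation E x := by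
    intro σ hσ
    have h1 : ∀ x : E, w.valuation E x ≤ 1 → w.valuation E (σ x) ≤ 1 := by
      intro x hx
      obtain ⟨a, b, hb, hab⟩ := hrep x hx
      have e1 : σ x * algebraMap (𝓞 E) E (σ • b) = algebraMap (𝓞 E) E (σ • a) := by rw [hsm, hsm, ← map_mul, hab]
      have e2 := hone _ (fun h => hb ((hσ b).mp h))
      have e3 := congrArg (w.valuation E) e1
      rw [map_mul, e2, mul_one] at e3
      rw [e3]; exact hle _
    have h2 : ∀ x y : E, w.valuation E x ≤ w.valuation E y → w.valuation E (σ x) ≤ w.valuation E (σ y) := by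
      intro x y hxy
      by_cases hy : y = 0
      · subst hy
        rw [map_zero, le_zero_iff, map_eq_zero] at hxy
        rw [hxy]
      have e1 := h1 (x / y) (by rw [map_div₀]; exact div_le_one_of_le₀ hxy zero_le')
      rw [map_div₀, map_div₀] at e1
      rwa [div_le_one₀ (zero_lt_iff.mpr (by rw [Valuation.ne_zero_iff]; simpa using hy))] at e1
    have h3 : ∀ k : ℕ, ∀ x y : E, w.valuation E x ≤ w.valuation E y → w.valuation E ((σ ^ k) x) ≤ w.valuation E ((σ ^ k) y) := by
      intro k
      induction k with
      | zero => intro x y h; simpa using h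
      | succ k ih => intro x y h; rw [pow_succ, AlgEquiv.mul_apply, AlgEquiv.mul_apply]; exact ih _ _ (h2 _ _ h)
    intro x
    obtain ⟨k, hk⟩ : ∃ k, orderOf σ = k + 1 := Nat.exists_eq_succ_of_ne_zero (orderOf_pos σ).ne'
    have hk1 : σ ^ (k + 1) = 1 := by rw [← hk]; exact pow_orderOf_eq_one σ
    rcases le_total (w.valuation E (σ x)) (w.valuation E x) with h | h
    · refine le_antisymm h ?_
      have h4 : ∀ j : ℕ, w.valuation E ((σ ^ (j + 1)) x) ≤ w.valuation E (σ x) := by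
        intro j
        induction j with
        | zero => simp
        | succ j ih => 
          refine le_trans ?_ ih
          have := h3 (j + 1) _ _ h
          rwa [← AlgEquiv.mul_apply, ← pow_succ] at this
      have := h4 k
      rwa [hk1] at this
    · refine le_antisymm ?_ h
      have h4 : ∀ j : ℕ, w.valuation E (σ x) ≤ w.valuation E ((σ ^ (j + 1)) x) := by
        intro j
        induction j with
        | zero => simp
        | succ j ih => 
          refine le_trans ih ?_
          have := h3 (j + 1) _ _ h
          rwa [← AlgEquiv.mul_apply, ← pow_succ] at this
      have := h4 k
      rwa [hk1] at this
  have hIP : ∀ σ ∈ P.inertia (E ≃ₐ[ℚ] E), ∀ x : 𝓞 E, σ • x - x ∈ P := fun σ hσ x => hσ x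
  have hIv : ∀ σ ∈ P.inertia (E ≃ₐ[ℚ] E), ∀ x : 𝓞 E, σ • x ∈ P ↔ x ∈ P := by
    intro σ hσ x
    have := hIP σ hσ x
    constructor
    · intro h; have := P.sub_mem h this; simpa using this
    · intro h; have := P.add_mem this h; simpa using this
  have hφv : ∀ x : 𝓞 E, φ • x ∈ P ↔ x ∈ P := by
    intro x
    have := hφ x
    constructor
    · intro h; have := P.sub_mem h this; exact hP.mem_of_pow_mem p (by simpa using this)
    · intro h; have := P.add_mem this (P.pow_mem_of_mem h p hp.pos); simpa using this
  have hcong : ∀ (σ : E ≃ₐ[ℚ] E) (k : ℕ), (∀ x : 𝓞 E, σ • x - x ^ k ∈ P) → (∀ x : E, w.valuation E (σ x) = w.valuation E x) →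
      ∀ x : E, w.valuation E x ≤ 1 → w.valuation E (σ x - x ^ k) < 1 := by
    intro σ k h hv x hx
    obtain ⟨a, b, hb, hab⟩ := hrep x hx
    have hb1 := hone b hb
    have hσb : w.valuation E (σ (algebraMap (𝓞 E) E b)) = 1 := by rw [hv, hb1]
    have hb0 : algebraMap (𝓞 E) E b ≠ 0 := by
      intro h0; rw [h0, map_zero] at hb1; exact zero_ne_one hb1
    have e1 : (σ x - x ^ k) * (σ (algebraMap (𝓞 E) E b) * algebraMap (𝓞 E) E b ^ k) = algebraMap (𝓞 E) E ((σ • a - a ^ k) * b ^ k - a ^ k * (σ • b - b ^ k)) := by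
      have e2 : σ x * σ (algebraMap (𝓞 E) E b) = σ (algebraMap (𝓞 E) E a) := by rw [← map_mul, hab]
      simp only [map_sub, map_mul, map_pow, hsm]
      rw [← e2, ← hab]; ring
    have e3 := (hlt ((σ • a - a ^ k) * b ^ k - a ^ k * (σ • b - b ^ k))).mpr (P.sub_mem (P.mul_mem_right _ (h a)) (P.mul_mem_left _ (h b)))
    rw [← e1, map_mul, map_mul, map_pow, hσb, hb1, one_pow, mul_one, mul_one] at e3
    exact e3
  refine { hp := hp, comm := hab, ford := ⟨orderOf φ, orderOf_pos φ, pow_orderOf_eq_one φ⟩, hI := ?_, hIv := fun σ hσ => hpres σ (hIv σ hσ), hφv := hpres φ hφv, hφ := hcong φ p hφ (hpres φ hφv), hU := fun y h0 hy => val_fix hp w hpP h0 hy, ϖ0 := ?_, ϖ1 := ?_, hϖ := ?_, vp := ?_ }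
  · intro σ hσ x hx
    have := hcong σ 1 (fun x => by rw [pow_one]; exact hIP σ hσ x) (hpres σ (hIv σ hσ)) x hx
    rwa [pow_one] at this
  · rintro rfl
    rw [map_zero] at hϖ
    exact WithZero.exp_ne_zero hϖ.symm
  · rw [hϖ, ← WithZero.exp_zero, WithZero.exp_lt_exp]; norm_num
  · intro x hx
    refine ⟨-WithZero.log (w.valuation E x), ?_⟩
    rw [hϖ]
    have a4 : w.valuation E x ≠ 0 := (Valuation.ne_zero_iff _).mpr hx
    rw [← WithZero.exp_zsmul]
    conv_lhs => rw [← WithZero.exp_log a4]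
    congr 1; simp
  · have := (hlt (p : 𝓞 E)).mpr hpP
    simpa using this
end D7
end PartD7

section PartD8
open scoped Real
open NumberField
set_option linter.all false
set_option linter.unusedSectionVars false
section D8

def Unr (E : Type*) [Field E] (q : ℕ) : Prop := ∀ P : Ideal (𝓞 E), P.IsPrime → (q : 𝓞 E) ∈ P → (q : 𝓞 E) ∉ P ^ 2

lemma Unr.of_hom {E₁ E₂ : Type*} [Field E₁] [Field E₂] [NumberField E₂] (f : E₁ →+* E₂) {q : ℕ} (h : Unr E₂ q) : Unr E₁ q := by
  intro P hP hq hq2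
  letI := f.toAlgebra
  have hint : Algebra.IsIntegral (𝓞 E₁) (𝓞 E₂) := inferInstance
  obtain ⟨Q, hQ, hQP⟩ := Ideal.exists_ideal_over_prime_of_isIntegral P (⊥ : Ideal (𝓞 E₂)) (by
    rw [← RingHom.ker_eq_comap_bot, (RingHom.injective_iff_ker_eq_bot (algebraMap (𝓞 E₁) (𝓞 E₂))).mp (FaithfulSMul.algebraMap_injective _ _)]; exact bot_le)
  have hmap : P.map (algebraMap (𝓞 E₁) (𝓞 E₂)) ≤ Q := by rw [Ideal.map_le_iff_le_comap, hQP.2]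
  refine h Q hQP.1 ?_ ?_
  · have := hmap (Ideal.mem_map_of_mem _ hq); simpa using this
  · have := Ideal.pow_right_mono hmap 2 (by rw [← Ideal.map_pow]; exact Ideal.mem_map_of_mem _ hq2); simpa using this

variable {E : Type*} [Field E] [NumberField E]

lemma unr_iff_e {q : ℕ} (hq : q.Prime) : Unr E q ↔ Algebra.IsUnramifiedIn (𝓞 E) (Ideal.span {(q : ℤ)}) := by
  rw [Algebra.isUnramifiedIn_iff_forall_ramificationIdx_eq_one]
  constructor
  · intro h P _ hP
    have hm : (q : 𝓞 E) ∈ P := by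
      have : (q : ℤ) ∈ P.under ℤ := by rw [← hP.1]; exact Ideal.mem_span_singleton_self _
      simpa using this
    rw [← Ideal.ramificationIdx'_eq_ramificationIdx _ _ (span_ne_bot hq), e_one_iff hq P hm]
    exact h P inferInstance hm
  · intro h P _ hm
    have hP := liesOver_of_mem hq P hm
    rw [← e_one_iff hq P hm, Ideal.ramificationIdx'_eq_ramificationIdx _ _ (span_ne_bot hq)]
    exact h P hP

lemma unr_finite : ∃ S : Finset ℕ, ∀ q : ℕ, q.Prime → q ∉ S → Unr E q := by
  refine ⟨(discr E).natAbs.primeFactors, fun q hq hS => ?_⟩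
  rw [unr_iff_e hq, ← not_dvd_discr_iff_isUnramifiedIn E (𝓞 E) (Nat.prime_iff_prime_int.mp hq)]
  intro h
  exact hS (Nat.mem_primeFactors.mpr ⟨hq, Int.natCast_dvd.mp h, Int.natAbs_ne_zero.mpr (discr_ne_zero E)⟩)

lemma unr_all (h : ∀ q : ℕ, q.Prime → Unr E q) : Module.finrank ℚ E = 1 := by
  by_contra H
  obtain ⟨p, hp, hn⟩ := NumberField.exists_not_isUnramifiedIn (𝒪 := 𝓞 E) H
  exact hn ((unr_iff_e hp).mp (h p hp))

lemma unr_iff_inertia [IsGalois ℚ E] {q : ℕ} (hq : q.Prime) : Unr E q ↔ ∀ P : Ideal (𝓞 E), P.IsPrime → (q : 𝓞 E) ∈ P →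
    ∀ σ : E ≃ₐ[ℚ] E, (∀ x : 𝓞 E, σ • x - x ∈ P) → σ = 1 := by
  refine forall_congr' fun P => forall_congr' fun hP => forall_congr' fun hm => ?_
  rw [← e_one_iff hq P hm, e_abs hq P hm, ← Subgroup.eq_bot_iff_card, Subgroup.eq_bot_iff_forall]
  rfl

lemma unr_fix [IsGalois ℚ E] {p : ℕ} (hp : p.Prime) (P : Ideal (𝓞 E)) [P.IsPrime] (hpP : (p : 𝓞 E) ∈ P) 
    (F : IntermediateField ℚ E) (hF : F = IntermediateField.fixedField (P.inertia (E ≃ₐ[ℚ] E))) [IsGalois ℚ F] : Unr F p := by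
  intro Q hQ hm
  have h := e_fix hp P hpP F hF
  have hpF : (p : 𝓞 F) ∈ P.under (𝓞 F) := by rw [Ideal.mem_comap]; simpa using hpP
  have h1 := liesOver_of_mem hp _ hpF
  have h2 := liesOver_of_mem hp Q hm
  rw [← e_one_iff hp Q hm, ← h, Ideal.ramificationIdx'_eq_ramificationIdx _ _ (span_ne_bot hp), Ideal.ramificationIdx'_eq_ramificationIdx _ _ (span_ne_bot hp)]
  exact Ideal.ramificationIdx_eq_of_isGaloisGroup (Ideal.span {(p : ℤ)}) Q (P.under (𝓞 F)) (F ≃ₐ[ℚ] F)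

lemma CF_unr (N : ℕ) [NeZero N] {q : ℕ} (hq : q.Prime) (hqN : q.Coprime N) : Unr (CF N) q := by
  rw [unr_iff_inertia hq]
  intro P hP hm σ hσ
  obtain ⟨u, hu, hu'⟩ := CF_aut_exp N σ
  have hz := zC_prim N (NeZero.pos N)
  let z : 𝓞 (CF N) := hz.toInteger
  have hzN : z ^ N = 1 := by apply RingOfIntegers.ext; exact hz.pow_eq_one
  have hzz : ((z : 𝓞 (CF N)) : CF N) = zC N := rfl
  have hsz : σ • z = z ^ u := by apply RingOfIntegers.ext; exact hu'
  let w : 𝓞 (CF N) := z ^ u * z ^ (N - 1)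
  have hwz : w * z = z ^ u := by
    have : z ^ (N - 1) * z = 1 := by rw [← pow_succ, Nat.sub_add_cancel (NeZero.one_le), hzN]
    simp only [w]; rw [mul_assoc, this, mul_one]
  have hwN : w ^ N = 1 := by simp only [w]; rw [mul_pow, pow_right_comm, hzN, pow_right_comm, hzN]; simp
  have hw1 : w - 1 ∈ P := by
    have h1 := hσ z
    rw [hsz, ← hwz] at h1
    have h2 := P.mul_mem_right (z ^ (N - 1)) h1
    have e : (w * z - z) * z ^ (N - 1) = w - 1 := by
      have : z * z ^ (N - 1) = 1 := by rw [← pow_succ', Nat.sub_add_cancel (NeZero.one_le), hzN]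
      linear_combination (w - 1) * this
    rwa [e] at h2
  have hw : w = 1 := by
    by_contra hne
    have hs : (∑ i ∈ Finset.range N, w ^ i) = 0 := by
      have := mul_geom_sum w N
      rw [hwN, sub_self] at this
      exact (mul_eq_zero.mp this).resolve_left (sub_ne_zero.mpr hne)
    have hs2 : (∑ i ∈ Finset.range N, (w ^ i - 1)) ∈ P := by
      refine P.sum_mem fun i _ => ?_
      exact P.mem_of_dvd (sub_one_dvd_pow_sub_one w i) hw1
    rw [Finset.sum_sub_distrib, hs] at hs2
    simp only [Finset.sum_const, Finset.card_range, nsmul_eq_mul, mul_one, zero_sub, neg_mem_iff] at hs2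
    have hb := Nat.isCoprime_iff_coprime.mpr hqN
    obtain ⟨a, b, hab⟩ := hb
    apply hP.ne_top
    rw [Ideal.eq_top_iff_one]
    have : ((a * q + b * N : ℤ) : 𝓞 (CF N)) ∈ P := by
      push_cast; exact P.add_mem (P.mul_mem_left _ hm) (P.mul_mem_left _ hs2)
    rw [hab] at this; simpa using this
  apply CF_hom_ext
  rw [hu', AlgEquiv.one_apply, ← hzz, ← map_pow, ← hwz, hw, one_mul]
end D8
end PartD8

section PartD9
open scoped Real
open NumberField
set_option linter.all false
set_option linter.unusedSectionVars false
section D9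

structure AbK (K : IntermediateField ℚ ℂ) : Prop where
  fd : FiniteDimensional ℚ K
  gal : IsGalois ℚ K
  comm : ∀ σ τ : K ≃ₐ[ℚ] K, σ * τ = τ * σ

lemma AbK.nf {K : IntermediateField ℚ ℂ} (h : AbK K) : NumberField K :=
  { to_charZero := inferInstance, to_finiteDimensional := h.fd }

lemma sup_ext {K₁ K₂ : IntermediateField ℚ ℂ} (σ τ : ↥(K₁ ⊔ K₂) ≃ₐ[ℚ] ↥(K₁ ⊔ K₂))
    (h1 : ∀ x : ℂ, ∀ hx : x ∈ K₁, σ ⟨x, (le_sup_left : K₁ ≤ K₁ ⊔ K₂) hx⟩ = τ ⟨x, (le_sup_left : K₁ ≤ K₁ ⊔ K₂) hx⟩)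
    (h2 : ∀ x : ℂ, ∀ hx : x ∈ K₂, σ ⟨x, (le_sup_right : K₂ ≤ K₁ ⊔ K₂) hx⟩ = τ ⟨x, (le_sup_right : K₂ ≤ K₁ ⊔ K₂) hx⟩) : σ = τ := by
  have hh : (σ : ↥(K₁ ⊔ K₂) →ₐ[ℚ] ↥(K₁ ⊔ K₂)) = τ := by
    refine IntermediateField.algHom_ext_of_eq_adjoin ℚ (S := K₁ ⊔ K₂) (s := (K₁ : Set ℂ) ∪ K₂) ?_ ?_
    · rw [IntermediateField.adjoin_union, IntermediateField.adjoin_self, IntermediateField.adjoin_self]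
    · rintro x (hx | hx)
      · exact h1 x hx
      · exact h2 x hx
  ext x
  exact congrArg _ (DFunLike.congr_fun hh x)

lemma normal_of_gal {K : IntermediateField ℚ ℂ} (h : AbK K) : Normal ℚ K := have := h.gal; inferInstance

lemma AbK.sup {K₁ K₂ : IntermediateField ℚ ℂ} (h1 : AbK K₁) (h2 : AbK K₂) : AbK (K₁ ⊔ K₂) := by
  have n1 := normal_of_gal h1
  have n2 := normal_of_gal h2
  have f1 := h1.fd
  have f2 := h2.fd
  have hN : Normal ℚ ↥(K₁ ⊔ K₂) := by
    exact @IntermediateField.normal_sup ℚ ℂ _ _ _ K₁ K₂ n1 n2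
  have hfd : FiniteDimensional ℚ ↥(K₁ ⊔ K₂) := @IntermediateField.finiteDimensional_sup ℚ ℂ _ _ _ K₁ K₂ f1 f2
  refine ⟨hfd, { }, fun σ τ => ?_⟩
  have key : ∀ (K : IntermediateField ℚ ℂ) (hK : AbK K) (hle : K ≤ K₁ ⊔ K₂) (x : ℂ) (hx : x ∈ K), (σ * τ) ⟨x, hle hx⟩ = (τ * σ) ⟨x, hle hx⟩ := by
    intro K hK hle x hx
    have := normal_of_gal hK
    apply Subtype.ext
    rw [← resH_coe hle (σ * τ) ⟨x, hx⟩, ← resH_coe hle (τ * σ) ⟨x, hx⟩, map_mul, map_mul, hK.comm]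
  exact sup_ext _ _ (key K₁ h1 le_sup_left) (key K₂ h2 le_sup_right)

lemma AbK.cf (N : ℕ) [NeZero N] : AbK (CF N) := by
  refine ⟨inferInstance, inferInstance, fun σ τ => CF_hom_ext ?_⟩
  obtain ⟨u, -, hu⟩ := CF_aut_exp N σ
  obtain ⟨w, -, hw⟩ := CF_aut_exp N τ
  rw [AlgEquiv.mul_apply, AlgEquiv.mul_apply, hu, hw, map_pow, map_pow, hu, hw, ← pow_mul, ← pow_mul, mul_comm]

/-- ring of integers inclusion -/
lemma unr_res {K L : IntermediateField ℚ ℂ} (hK : AbK K) (hL : AbK L) (h : K ≤ L) {q : ℕ} (hq : q.Prime)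
    (hu : Unr K q) (P : Ideal (𝓞 L)) (hP : P.IsPrime) (hqP : (q : 𝓞 L) ∈ P) (σ : L ≃ₐ[ℚ] L)
    (hσ : ∀ x : 𝓞 L, σ • x - x ∈ P) (x : ℂ) (hx : x ∈ K) : σ ⟨x, h hx⟩ = ⟨x, h hx⟩ := by
  have := normal_of_gal hK
  have := hK.gal
  have := hK.nf
  let i : 𝓞 K →+* 𝓞 L := RingOfIntegers.mapRingHom (IntermediateField.inclusion h).toRingHom
  have hr : resH h σ = 1 := by
    refine (unr_iff_inertia hq).1 hu (P.comap i) (Ideal.IsPrime.comap _) (by rw [Ideal.mem_comap, map_natCast]; exact hqP) _ fun y => ?_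
    rw [Ideal.mem_comap, map_sub]
    have e : i (resH h σ • y) = σ • i y := by
      apply RingOfIntegers.ext
      exact resH_apply h σ y
    rw [e]; exact hσ _
  apply Subtype.ext
  rw [← resH_coe h σ ⟨x, hx⟩, hr]; rfl

lemma unr_sup {K₁ K₂ : IntermediateField ℚ ℂ} (h1 : AbK K₁) (h2 : AbK K₂) {q : ℕ} (hq : q.Prime)
    (hu1 : Unr K₁ q) (hu2 : Unr K₂ q) : Unr ↥(K₁ ⊔ K₂) q := by
  have h12 := h1.sup h2
  have := h12.gal
  have := h12.nf
  rw [unr_iff_inertia hq]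
  intro P hP hqP σ hσ
  exact sup_ext _ _ (unr_res h1 h12 le_sup_left hq hu1 P hP hqP σ hσ) (unr_res h2 h12 le_sup_right hq hu2 P hP hqP σ hσ)

/-- subfields of abelian fields -/
lemma AbK.sub {K : IntermediateField ℚ ℂ} (hK : AbK K) (F : IntermediateField ℚ K) :
    IsGalois ℚ F ∧ AbK (F.map (algebraMap K ℂ).toRatAlgHom) ∧ 
    (∀ q, Unr K q → Unr ↥(F.map (algebraMap K ℂ).toRatAlgHom) q) ∧
    (∀ q, Unr F q → Unr ↥(F.map (algebraMap K ℂ).toRatAlgHom) q) := by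
  have := hK.gal
  have := hK.fd
  have := hK.nf
  have hn : F.fixingSubgroup.Normal := ⟨fun a ha b => by rw [hK.comm b a, mul_inv_cancel_right]; exact ha⟩
  have hF : IsGalois ℚ F := by
    have := IsGalois.of_fixedField_normal_subgroup F.fixingSubgroup
    rwa [IsGalois.fixedField_fixingSubgroup] at this
  let g : K →ₐ[ℚ] ℂ := (algebraMap K ℂ).toRatAlgHom
  let e : F ≃ₐ[ℚ] F.map g := IntermediateField.equivMap F g
  have hFf : NumberField F := inferInstance
  have hFn : NumberField ↥(F.map g) := NumberField.of_ringEquiv _ _ e.toRingEquiv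
  refine ⟨hF, ⟨hFn.to_finiteDimensional, IsGalois.of_algEquiv e, ?_⟩, ?_, ?_⟩
  · have hc : ∀ σ τ : F ≃ₐ[ℚ] F, σ * τ = τ * σ := by
      intro σ τ
      obtain ⟨s, rfl⟩ := AlgEquiv.restrictNormalHom_surjective K (K₁ := F) σ
      obtain ⟨t, rfl⟩ := AlgEquiv.restrictNormalHom_surjective K (K₁ := F) τ
      rw [← map_mul, hK.comm, map_mul]
    intro σ τ
    apply (AlgEquiv.autCongr e.symm).injective
    rw [map_mul, map_mul, hc]
  · intro q hq
    exact Unr.of_hom ((algebraMap F K).comp e.symm.toRingEquiv.toRingHom) hq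
  · intro q hq
    exact Unr.of_hom e.symm.toRingEquiv.toRingHom hq

end D9
end PartD9

section PartD10
open scoped Real
open NumberField
set_option linter.all false
set_option linter.unusedSectionVars false
section D10

lemma top_of {L : IntermediateField ℚ ℂ} (hL : AbK L) (F : IntermediateField ℚ L) (μ : L)
    (h : ∀ t ∈ F.fixingSubgroup, t μ = μ → t = 1) :
    L ≤ F.map (algebraMap L ℂ).toRatAlgHom ⊔ IntermediateField.adjoin ℚ {(μ : ℂ)} := by
  have := hL.gal
  have := hL.fd
  have ht : F ⊔ IntermediateField.adjoin ℚ {μ} = ⊤ := by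
    rw [← IsGalois.fixedField_fixingSubgroup (F ⊔ IntermediateField.adjoin ℚ {μ})]
    have : (F ⊔ IntermediateField.adjoin ℚ {μ}).fixingSubgroup = ⊥ := by
      rw [eq_bot_iff]
      intro t ht
      rw [Subgroup.mem_bot]
      rw [IntermediateField.mem_fixingSubgroup_iff] at ht
      refine h t ?_ (ht μ ((le_sup_right : _ ≤ F ⊔ IntermediateField.adjoin ℚ {μ}) (IntermediateField.mem_adjoin_simple_self ℚ μ)))
      rw [IntermediateField.mem_fixingSubgroup_iff]
      exact fun x hx => ht x ((le_sup_left : F ≤ F ⊔ IntermediateField.adjoin ℚ {μ}) hx)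
    rw [this, IntermediateField.fixedField_bot]
  have hm := congrArg (IntermediateField.map (algebraMap L ℂ).toRatAlgHom) ht
  rw [IntermediateField.map_sup, IntermediateField.adjoin_map, Set.image_singleton] at hm
  change _ ⊔ IntermediateField.adjoin ℚ {(μ : ℂ)} = _ at hm
  rw [hm]
  intro x hx
  rw [IntermediateField.mem_map]
  exact ⟨⟨x, hx⟩, IntermediateField.mem_top, rfl⟩

noncomputable def mu (K : IntermediateField ℚ ℂ) (n : ℕ) : ↥(K ⊔ CF n) := ⟨zN n, (le_sup_right : CF n ≤ K ⊔ CF n) (zN_mem n)⟩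

lemma mu_prim (K : IntermediateField ℚ ℂ) (n : ℕ) (hn : 0 < n) : IsPrimitiveRoot (mu K n) n :=
  IsPrimitiveRoot.of_map_of_injective (f := (algebraMap ↥(K ⊔ CF n) ℂ)) (zN_prim n hn) (algebraMap ↥(K ⊔ CF n) ℂ).injective

lemma mu_ext {K : IntermediateField ℚ ℂ} (hK : AbK K) {n : ℕ} [NeZero n] [Normal ℚ K] (σ : ↥(K ⊔ CF n) ≃ₐ[ℚ] ↥(K ⊔ CF n))
    (h1 : resH (le_sup_left : K ≤ K ⊔ CF n) σ = 1) (h2 : σ (mu K n) = mu K n) : σ = 1 := by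
  have hc : resH (le_sup_right : CF n ≤ K ⊔ CF n) σ = 1 := by
    apply CF_hom_ext
    apply Subtype.ext
    rw [resH_coe]
    exact congrArg Subtype.val h2
  refine sup_ext _ _ (fun x hx => ?_) (fun x hx => ?_)
  · apply Subtype.ext
    rw [← resH_coe (le_sup_left : K ≤ K ⊔ CF n) σ ⟨x, hx⟩, h1]; rfl
  · apply Subtype.ext
    rw [← resH_coe (le_sup_right : CF n ≤ K ⊔ CF n) σ ⟨x, hx⟩, hc]; rfl

lemma res_pow {G G' : Type*} [Group G] [Group G'] [Finite G'] (f : G →* G') {p k e : ℕ} (hp : p.Prime) (hc : Nat.card G' < p ^ (e + 2))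
    {σ : G} (hσ : orderOf σ = p ^ k) : f σ ^ p ^ (e + 1) = 1 := by
  have h1 : orderOf (f σ) ∣ p ^ k := hσ ▸ orderOf_map_dvd f σ
  obtain ⟨j, -, hj⟩ := (Nat.dvd_prime_pow hp).1 h1
  have h2 : orderOf (f σ) ≤ Nat.card G' := Nat.le_of_dvd Nat.card_pos (orderOf_dvd_natCard _)
  rw [hj] at h2
  have h3 : j < e + 2 := (Nat.pow_lt_pow_iff_right hp.one_lt).1 (h2.trans_lt hc)
  apply orderOf_dvd_iff_pow_eq_one.1
  rw [hj]; exact pow_dvd_pow _ (by omega)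

lemma exists_e (p n : ℕ) (hp : p.Prime) : ∃ e, n < p ^ (e + 2) :=
  ⟨n, (Nat.lt_pow_self hp.one_lt).trans (Nat.pow_lt_pow_right hp.one_lt (by omega))⟩

lemma step_odd {K : IntermediateField ℚ ℂ} (hK : AbK K) {p : ℕ} (hp : p.Prime) (hp2 : p ≠ 2) :
    ∃ (K'' : IntermediateField ℚ ℂ) (e : ℕ), AbK K'' ∧ Unr K'' p ∧ (∀ q : ℕ, q.Prime → q ≠ p → Unr K q → Unr K'' q) ∧
      K ≤ K'' ⊔ CF (p ^ e) := by
  have nK := normal_of_gal hK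
  have gK := hK.gal
  have fK := hK.fd
  obtain ⟨e, he⟩ := exists_e p (Nat.card (K ≃ₐ[ℚ] K)) hp
  have hpos : 0 < p ^ (e + 2) := pow_pos hp.pos _
  have : NeZero (p ^ (e + 2)) := ⟨hpos.ne'⟩
  have hL := hK.sup (AbK.cf (p ^ (e + 2)))
  have := hL.nf
  have := hL.gal
  have := hL.fd
  obtain ⟨P, hP, hpP⟩ := exists_prime_over ↥(K ⊔ CF (p ^ (e + 2))) p hp
  obtain ⟨φ, hφ⟩ := exists_frob (K ⊔ CF (p ^ (e + 2))) p hp P hpP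
  obtain ⟨v, ϖ, hLD⟩ := LD_exists hL.comm hp P hpP φ hφ
  set I := P.inertia (↥(K ⊔ CF (p ^ (e + 2))) ≃ₐ[ℚ] ↥(K ⊔ CF (p ^ (e + 2)))) with hI
  set μ := mu K (p ^ (e + 2)) with hμdef
  have hμ : IsPrimitiveRoot μ (p ^ (e + 2)) := mu_prim K _ hpos
  have hζ : IsPrimitiveRoot (μ ^ p ^ (e + 1)) p := hμ.pow hpos (by rw [← pow_succ])
  have hexp : ∀ σ ∈ Hsub I (μ ^ p ^ (e + 1)), σ ^ p ^ (e + 1) = 1 := by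
    intro σ hσ
    obtain ⟨k, hk⟩ := hLD.order_pow hζ hσ
    refine mu_ext hK _ ?_ ?_
    · rw [map_pow]; exact res_pow _ hp he hk
    · obtain ⟨m, hm⟩ := aut_exp hμ hpos σ
      have h1 : (μ ^ p ^ (e + 1)) ^ m = (μ ^ p ^ (e + 1)) ^ 1 := by
        have := hσ.2
        rw [map_pow, hm, ← pow_mul, mul_comm, pow_mul] at this
        rw [this, pow_one]
      have h2 := prim_pow_eq hζ hp.pos h1
      have h3 := dvd_sub_pow_of_dvd_sub (R := ℤ) (p := p) (a := m) (b := 1) (by simpa using h2) (e + 1)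
      rw [aut_pow_exp hm]
      rw [prim_pow_congr hμ (b := 1), pow_one]
      refine ((Nat.modEq_iff_dvd).2 ?_).symm
      push_cast
      simpa using h3
  set F := IntermediateField.fixedField I with hF
  obtain ⟨hFg, hA, hU, hU'⟩ := hL.sub F
  refine ⟨_, e + 2, hA, hU' p (unr_fix hp P hpP F hF), fun q hq hqp hqK => hU q ?_, ?_⟩
  · exact unr_sup hK (AbK.cf _) hq hqK (CF_unr _ hq (((Nat.coprime_primes hq hp).2 hqp).pow_right _))
  · refine le_trans le_sup_left (top_of hL F μ ?_)
    intro t ht htμ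
    rw [hF, IntermediateField.fixingSubgroup_fixedField] at ht
    exact hLD.T_odd hp2 hμ hexp ht htμ

lemma odd_pow_aux (m : ℤ) (hm : Odd m) (j : ℕ) : (2 : ℤ) ^ (j + 3) ∣ m ^ 2 ^ (j + 1) - 1 := by
  induction j with
  | zero => simpa using Int.eight_dvd_sq_sub_one_of_odd hm
  | succ j ih =>
    have : m ^ 2 ^ (j + 1 + 1) - 1 = (m ^ 2 ^ (j + 1) - 1) * (m ^ 2 ^ (j + 1) + 1) := by
      rw [pow_succ 2 (j + 1), pow_mul]; ring
    rw [this, show j + 1 + 3 = (j + 3) + 1 by ring, pow_succ]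
    exact mul_dvd_mul ih (hm.pow.add_one).two_dvd

lemma conj_ex {L : IntermediateField ℚ ℂ} (hL : AbK L) : ∃ c : L ≃ₐ[ℚ] L, ∀ x : L, ((c x : L) : ℂ) = (starRingEnd ℂ) x := by
  have := normal_of_gal hL
  refine ⟨(Complex.conjAe.restrictScalars ℚ).restrictNormal L, fun x => ?_⟩
  exact AlgEquiv.restrictNormal_commutes (Complex.conjAe.restrictScalars ℚ) L x

lemma step_two {K : IntermediateField ℚ ℂ} (hK : AbK K) (hu : ∀ q : ℕ, q.Prime → q ≠ 2 → Unr K q) : ∃ e, K ≤ CF (2 ^ e) := by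
  have nK := normal_of_gal hK
  have gK := hK.gal
  have fK := hK.fd
  have hp := Nat.prime_two
  obtain ⟨e, he⟩ := exists_e 2 (Nat.card (K ≃ₐ[ℚ] K)) hp
  have hpos : 0 < 2 ^ (e + 3) := pow_pos hp.pos _
  have : NeZero (2 ^ (e + 3)) := ⟨hpos.ne'⟩
  have hL := hK.sup (AbK.cf (2 ^ (e + 3)))
  have := hL.nf
  have := hL.gal
  have := hL.fd
  have nL := normal_of_gal hL
  obtain ⟨P, hP, hpP⟩ := exists_prime_over ↥(K ⊔ CF (2 ^ (e + 3))) 2 hp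
  obtain ⟨φ, hφ⟩ := exists_frob (K ⊔ CF (2 ^ (e + 3))) 2 hp P hpP
  obtain ⟨v, ϖ, hLD⟩ := LD_exists hL.comm hp P hpP φ hφ
  set I := P.inertia (↥(K ⊔ CF (2 ^ (e + 3))) ≃ₐ[ℚ] ↥(K ⊔ CF (2 ^ (e + 3)))) with hI
  set F := IntermediateField.fixedField I with hF
  obtain ⟨hFg, hA, hU, hU'⟩ := hL.sub F
  have hnF : NumberField F := inferInstance
  have hF1 : Module.finrank ℚ F = 1 := by
    apply unr_all
    intro q hq
    by_cases hq2 : q = 2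
    · rw [hq2]; exact unr_fix hp P hpP F hF
    · refine Unr.of_hom (algebraMap F ↥(K ⊔ CF (2 ^ (e + 3)))) ?_
      exact unr_sup hK (AbK.cf _) hq (hu q hq hq2) (CF_unr _ hq (((Nat.coprime_primes hq hp).2 hq2).pow_right _))
  have hFb : F = ⊥ := IntermediateField.finrank_eq_one_iff.1 hF1
  have hIt : I = ⊤ := by
    rw [← IntermediateField.fixingSubgroup_fixedField I, ← hF, hFb, IntermediateField.fixingSubgroup_bot]
  rw [hIt] at hLD
  set μ := mu K (2 ^ (e + 3)) with hμdef
  have hμ : IsPrimitiveRoot μ (2 ^ (e + 3)) := mu_prim K _ hpos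
  have hζ : IsPrimitiveRoot (-1 : ↥(K ⊔ CF (2 ^ (e + 3)))) 2 := IsPrimitiveRoot.neg_one 0 (by decide)
  have hexp : ∀ σ : ↥(K ⊔ CF (2 ^ (e + 3))) ≃ₐ[ℚ] ↥(K ⊔ CF (2 ^ (e + 3))), σ ^ 2 ^ (e + 1) = 1 := by
    intro σ
    obtain ⟨k, hk⟩ := hLD.order_pow hζ (σ := σ) ⟨Subgroup.mem_top _, by simp⟩
    refine mu_ext hK _ ?_ ?_
    · rw [map_pow]; exact res_pow _ hp he hk
    · obtain ⟨m, hm⟩ := aut_exp hμ hpos σ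
      have h0 : IsPrimitiveRoot (μ ^ m) (2 ^ (e + 3)) := by
        rw [← hm]; exact hμ.map_of_injective (f := σ) σ.injective
      have h1 := (hμ.pow_iff_coprime hpos m).1 h0
      have h2 : Odd m := by
        rw [← Nat.coprime_two_right]; exact Nat.Coprime.coprime_dvd_right (dvd_pow_self 2 (by omega)) h1
      have h3 := odd_pow_aux m (by exact_mod_cast h2) e
      rw [aut_pow_exp hm]
      rw [prim_pow_congr hμ (b := 1), pow_one]
      refine ((Nat.modEq_iff_dvd).2 ?_).symm
      push_cast
      simpa using h3
  obtain ⟨c, hc⟩ := conj_ex hL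
  have hcμ : c μ = μ⁻¹ := by
    apply Subtype.ext
    rw [hc]
    change (starRingEnd ℂ) (zN (2 ^ (e + 3))) = (zN (2 ^ (e + 3)))⁻¹
    rw [Complex.inv_eq_conj ((zN_prim _ hpos).norm'_eq_one hpos.ne')]
  have hc2 : c ^ 2 = 1 := by
    ext x
    rw [pow_two, AlgEquiv.mul_apply, hc, hc, Complex.conj_conj]; rfl
  obtain ⟨g', hg'⟩ := CF_aut (2 ^ (e + 3)) 5 (Nat.Coprime.pow_right _ (by decide))
  obtain ⟨g, hg⟩ := resH_surj (le_sup_right : CF (2 ^ (e + 3)) ≤ K ⊔ CF (2 ^ (e + 3))) g'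
  have hgμ : g μ = μ ^ 5 := by
    apply Subtype.ext
    have := resH_coe (le_sup_right : CF (2 ^ (e + 3)) ≤ K ⊔ CF (2 ^ (e + 3))) g (zC (2 ^ (e + 3)))
    rw [hg, hg'] at this
    exact this.symm
  refine ⟨e + 3, le_trans le_sup_left ((top_of hL ⊥ μ ?_).trans ?_)⟩
  · intro t _ htμ
    exact hLD.T_two hμ hexp hcμ hc2 hgμ (by norm_num) htμ
  · rw [IntermediateField.map_bot, bot_sup_eq]; exact le_rfl

theorem KW_aux (S : Finset ℕ) : ∀ K : IntermediateField ℚ ℂ, AbK K → (∀ q : ℕ, q.Prime → q ≠ 2 → q ∉ S → Unr K q) →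
    ∃ N, 0 < N ∧ K ≤ CF N := by
  induction S using Finset.induction_on with
  | empty =>
    intro K hK hu
    obtain ⟨e, he⟩ := step_two hK (fun q hq h2 => hu q hq h2 (by simp))
    exact ⟨2 ^ e, by positivity, he⟩
  | insert p S hpS ih =>
    intro K hK hu
    by_cases hp : p.Prime ∧ p ≠ 2
    · obtain ⟨K'', e, hA, hup, huq, hle⟩ := step_odd hK hp.1 hp.2
      obtain ⟨N, hN, hle'⟩ := ih K'' hA (fun q hq h2 hqS => by
        by_cases hqp : q = p
        · rw [hqp]; exact hup
        · exact huq q hq hqp (hu q hq h2 (by simp [hqp, hqS])))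
      have hpos : 0 < N * p ^ e := Nat.mul_pos hN (pow_pos hp.1.pos _)
      exact ⟨N * p ^ e, hpos, hle.trans (sup_le (hle'.trans (CF_mono hpos (dvd_mul_right _ _))) (CF_mono hpos (dvd_mul_left _ _)))⟩
    · refine ih K hK fun q hq h2 hqS => hu q hq h2 ?_
      rw [Finset.mem_insert, not_or]
      refine ⟨?_, hqS⟩
      rintro rfl
      exact hp ⟨hq, h2⟩

theorem KW {K : IntermediateField ℚ ℂ} (hK : AbK K) : ∃ N, 0 < N ∧ K ≤ CF N := by
  have := hK.nf
  obtain ⟨S, hS⟩ := unr_finite (E := K)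
  exact KW_aux S K hK fun q hq _ hqS => hS q hq hqS

end D10
end PartD10

/-- The ring homomorphism `Φ : ℤ[ℚ/ℤ] → ℂ^{ℕ≥1}` determined on group
elements by `Φ([γ]) = ζ^(γ)` is injective with image exactly `W^a_ℤ(ℤ̄)`; in particular
`W^a_ℤ(ℤ̄) ≅ ℤ[ℚ/ℤ]` as rings, and the integral Witt vectors over `ℤ` are precisely the
`ℤ`-linear combinations of the vectors `ζ^(γ)`, `γ ∈ ℚ`. -/
theorem waQ_eq_group_ring :
    (∃ Φ : AddMonoidAlgebra ℤ (AddCircle (1 : ℚ)) →+* (ℕ+ → ℂ),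
      (∀ γ : ℚ, Φ (AddMonoidAlgebra.single (↑γ : AddCircle (1 : ℚ)) 1) = zetaVec γ) ∧
      Function.Injective Φ ∧ Set.range Φ = WaQ) ∧
    WaQ = ↑(Submodule.span ℤ (Set.range zetaVec)) := by
  exact final_of (fun ξ h => by
    obtain ⟨K, hfd, hG, hab, hv⟩ := C_main h
    obtain ⟨N, hN, hle⟩ := KW (K := K) ⟨hfd, hG, hab⟩
    exact E_main h N hN (fun n => hle (hv n)))
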